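/- arXiv:1908.02424 — 3 statements merged into one kernel-verified Lean document; each statement's English description precedes it below -/
import Mathlib

section
/- Let R be a ring and m a two-sided ideal with R m-adically complete and R/m left artinian. Then the category of finitely generated projective left R-modules is a Krull-Schmidt category: every finitely generated projective R-module is a finite direct sum of modules with local endomorphism rings. -/
variable {R : Type*} [Ring R]

/-- The `n`-th power of a (two-sided) ideal of a possibly noncommutative ring. -/
def idealPow (m : Ideal R) : ℕ → Ideal R
  | 0 => ⊤
  | n + 1 => Ideal.span {x | ∃ a ∈ m, ∃ b ∈ idealPow m n, x = a * b}

/-- `R` is `m`-adically complete: `R → lim R/mⁱ` is bijective. -/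
def IsAdicCompleteRing (m : Ideal R) : Prop :=
  (∀ x : R, (∀ i, x ∈ idealPow m i) → x = 0) ∧
  (∀ a : ℕ → R, (∀ i, a (i + 1) - a i ∈ idealPow m i) →
    ∃ x : R, ∀ i, x - a i ∈ idealPow m i)

/-- A ring filtration by additive subgroups for which the ring is separated and complete. -/
structure IsCompleteFiltration {E : Type*} [Ring E] (F : ℕ → AddSubgroup E) : Prop where
  zero : F 0 = ⊤
  succ_le : ∀ i, F (i + 1) ≤ F i
  mul_mem : ∀ {i j : ℕ} {a b : E}, a ∈ F i → b ∈ F j → a * b ∈ F (i + j)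
  separated : ∀ a, (∀ i, a ∈ F i) → a = 0
  complete : ∀ a : ℕ → E, (∀ i, a (i + 1) - a i ∈ F i) → ∃ x, ∀ i, x - a i ∈ F i

namespace IsCompleteFiltration

variable {E : Type*} [Ring E] {F : ℕ → AddSubgroup E}

theorem antitone (hF : IsCompleteFiltration F) : Antitone F :=
  antitone_nat_of_succ_le hF.succ_le

theorem mul_mem_left (hF : IsCompleteFiltration F) {i : ℕ} (a : E) {b : E} (hb : b ∈ F i) :
    a * b ∈ F i := by
  have ha : a ∈ F 0 := by simp [hF.zero]
  simpa using hF.mul_mem ha hb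

theorem mul_mem_right (hF : IsCompleteFiltration F) {i : ℕ} {a : E} (b : E) (ha : a ∈ F i) :
    a * b ∈ F i := by
  have hb : b ∈ F 0 := by simp [hF.zero]
  simpa using hF.mul_mem ha hb

theorem pow_mem (hF : IsCompleteFiltration F) {u : E} (hu : u ∈ F 1) (k : ℕ) : u ^ k ∈ F k := by
  induction k with
  | zero => simp [hF.zero]
  | succ k ih => rw [pow_succ]; exact hF.mul_mem ih hu

theorem isUnit_one_sub (hF : IsCompleteFiltration F) {u : E} (hu : u ∈ F 1) :
    IsUnit (1 - u) := by
  obtain ⟨s, hs⟩ := hF.complete (fun k ↦ ∑ i ∈ Finset.range k, u ^ i) fun k ↦ by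
    simpa [Finset.sum_range_succ] using hF.pow_mem hu k
  have left : s * (1 - u) = 1 := by
    refine sub_eq_zero.mp (hF.separated _ fun k ↦ ?_)
    have h : s * (1 - u) - 1 = (s - ∑ i ∈ Finset.range k, u ^ i) * (1 - u) - u ^ k := by
      rw [sub_mul _ _ (1 - u), geom_sum_mul_neg]; abel
    rw [h]
    exact sub_mem (hF.mul_mem_right _ (hs k)) (hF.pow_mem hu k)
  have right : (1 - u) * s = 1 := by
    refine sub_eq_zero.mp (hF.separated _ fun k ↦ ?_)
    have h : (1 - u) * s - 1 = (1 - u) * (s - ∑ i ∈ Finset.range k, u ^ i) - u ^ k := by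
      rw [mul_sub (1 - u), mul_neg_geom_sum]; abel
    rw [h]
    exact sub_mem (hF.mul_mem_left _ (hs k)) (hF.pow_mem hu k)
  exact isUnit_iff_exists.mpr ⟨s, right, left⟩

theorem isUnit_of_sub_one_mem (hF : IsCompleteFiltration F) {a : E} (ha : a - 1 ∈ F 1) :
    IsUnit a := by
  have h := hF.isUnit_one_sub (neg_mem ha)
  rwa [show 1 - -(a - 1) = a by abel] at h

theorem isUnit_of_inverse_mod (hF : IsCompleteFiltration F) {a b : E}
    (hab : a * b - 1 ∈ F 1) (hba : b * a - 1 ∈ F 1) : IsUnit a := by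
  obtain ⟨c, hc⟩ := (hF.isUnit_of_sub_one_mem hab).exists_right_inv
  obtain ⟨d, hd⟩ := (hF.isUnit_of_sub_one_mem hba).exists_left_inv
  rw [mul_assoc] at hc
  rw [← mul_assoc] at hd
  exact isUnit_iff_exists.mpr ⟨b * c, hc, left_inv_eq_right_inv hd hc ▸ hd⟩

/-- Newton iteration improves an approximate idempotent. -/
theorem newton_step (hF : IsCompleteFiltration F) {k : ℕ} {f : E} (hf : f * f - f ∈ F (k + 1)) :
    ∃ g, g * g - g ∈ F (k + 2) ∧ g - f ∈ F (k + 1) := by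
  refine ⟨3 * f ^ 2 - 2 * f ^ 3, ?_, ?_⟩
  · have h : (3 * f ^ 2 - 2 * f ^ 3) * (3 * f ^ 2 - 2 * f ^ 3) - (3 * f ^ 2 - 2 * f ^ 3) =
        (f * f - f) * (f * f - f) * (4 * f ^ 2 - 4 * f - 3) := by noncomm_ring
    rw [h]
    exact hF.mul_mem_right _ (hF.antitone (by omega) (hF.mul_mem hf hf))
  · have h : 3 * f ^ 2 - 2 * f ^ 3 - f = (f * f - f) * (1 - 2 * f) := by noncomm_ring
    rw [h]
    exact hF.mul_mem_right _ hf

theorem exists_isIdempotentElem (hF : IsCompleteFiltration F) {f : E} (hf : f * f - f ∈ F 1) :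
    ∃ e, IsIdempotentElem e ∧ e - f ∈ F 1 := by
  choose! g hg hgf using fun (k : ℕ) (f : E) (hf : f * f - f ∈ F (k + 1)) ↦ hF.newton_step hf
  let a : ℕ → E := fun k ↦ Nat.rec f (fun k x ↦ g k x) k
  have ha : ∀ k, a k * a k - a k ∈ F (k + 1) := by
    intro k
    induction k with
    | zero => exact hf
    | succ k ih => exact hg k _ ih
  have hsub : ∀ k, a (k + 1) - a k ∈ F (k + 1) := fun k ↦ hgf k _ (ha k)
  obtain ⟨e, he⟩ := hF.complete a fun k ↦ hF.succ_le k (hsub k)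
  refine ⟨e, sub_eq_zero.mp (hF.separated _ fun k ↦ ?_), ?_⟩
  · have h : e * e - e = e * (e - a k) + (e - a k) * a k - (e - a k) + (a k * a k - a k) := by
      noncomm_ring
    rw [h]
    exact add_mem (sub_mem (add_mem (hF.mul_mem_left _ (he k)) (hF.mul_mem_right _ (he k)))
      (he k)) (hF.succ_le k (ha k))
  · simpa [a] using add_mem (he 1) (hsub 0)

end IsCompleteFiltration

section AdicFiltration

variable {m : Ideal R} {M : Type*} [AddCommGroup M] [Module R M]

theorem idealPow_succ (m : Ideal R) (n : ℕ) : idealPow m (n + 1) = m • idealPow m n := by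
  refine le_antisymm (Ideal.span_le.mpr ?_) (Submodule.smul_le.mpr fun a ha b hb ↦ ?_)
  · rintro _ ⟨a, ha, b, hb, rfl⟩
    exact Submodule.smul_mem_smul ha hb
  · exact Ideal.subset_span ⟨a, ha, b, hb, rfl⟩

theorem idealPow_succ_le (m : Ideal R) (n : ℕ) : idealPow m (n + 1) ≤ idealPow m n := by
  induction n with
  | zero => exact le_top
  | succ n ih =>
    rw [idealPow_succ m (n + 1)]
    exact (Submodule.smul_mono le_rfl ih).trans (idealPow_succ m n).ge

theorem idealPow_one (h : ∀ a ∈ m, ∀ r : R, a * r ∈ m) : idealPow m 1 = m := by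
  rw [idealPow_succ]
  refine le_antisymm (Submodule.smul_le.mpr fun a ha r _ ↦ h a ha r) fun a ha ↦ ?_
  have h := Submodule.smul_mem_smul (N := idealPow m 0) ha (Submodule.mem_top (x := 1))
  simpa only [smul_eq_mul (a := a), mul_one] using h

theorem idealPow_zero_smul_top (m : Ideal R) : idealPow m 0 • (⊤ : Submodule R M) = ⊤ := by
  refine eq_top_iff.mpr fun x _ ↦ ?_
  have h := Submodule.smul_mem_smul (I := idealPow m 0) (Submodule.mem_top (x := 1))
    (Submodule.mem_top (R := R) (x := x))
  rwa [one_smul] at h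

theorem idealPow_smul_idealPow_smul_le (m : Ideal R) (i j : ℕ) (N : Submodule R M) :
    idealPow m i • idealPow m j • N ≤ idealPow m (i + j) • N := by
  induction i with
  | zero => rw [Nat.zero_add]; exact Submodule.smul_le.mpr fun r _ x hx ↦ Submodule.smul_mem _ r hx
  | succ i ih =>
    rw [idealPow_succ, Nat.succ_add, idealPow_succ, Submodule.smul_assoc, Submodule.smul_assoc]
    exact Submodule.smul_mono le_rfl ih

theorem idealPow_smul_top_le (m : Ideal R) (i : ℕ) :
    idealPow m i • (⊤ : Submodule R R) ≤ idealPow m i := by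
  induction i with
  | zero => exact le_top
  | succ i ih =>
    rw [idealPow_succ, Submodule.smul_assoc]
    exact Submodule.smul_mono le_rfl ih

theorem apply_mem_smul_top {N : Type*} [AddCommGroup N] [Module R N] (I : Ideal R)
    (f : M →ₗ[R] N) {x : M} (hx : x ∈ I • (⊤ : Submodule R M)) :
    f x ∈ I • (⊤ : Submodule R N) := by
  have h := Submodule.mem_map_of_mem (f := f) hx
  rw [Submodule.map_smul''] at h
  exact Submodule.smul_mono le_rfl le_top h

theorem exists_dual_basis (R M : Type*) [Ring R] [AddCommGroup M] [Module R M]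
    [Module.Finite R M] [Module.Projective R M] :
    ∃ (n : ℕ) (b : Fin n → M) (φ : Fin n → M →ₗ[R] R), ∀ x, ∑ j, φ j x • b j = x := by
  obtain ⟨n, f, g, -, -, hfg⟩ := Module.Finite.exists_comp_eq_id_of_projective R M
  refine ⟨n, fun j ↦ f (Pi.single j 1), fun j ↦ LinearMap.proj j ∘ₗ g, fun x ↦ ?_⟩
  have h : f (g x) = x := LinearMap.congr_fun hfg x
  conv_rhs => rw [← h, pi_eq_sum_univ' (g x), map_sum]
  refine Finset.sum_congr rfl fun j _ ↦ ?_
  rw [map_smul]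
  congr 2

theorem eq_zero_of_mem_idealPow_smul [Module.Finite R M] [Module.Projective R M]
    (hm : IsAdicCompleteRing m) {x : M}
    (hx : ∀ i, x ∈ idealPow m i • (⊤ : Submodule R M)) : x = 0 := by
  obtain ⟨n, b, φ, hb⟩ := exists_dual_basis R M
  rw [← hb x]
  refine Finset.sum_eq_zero fun j _ ↦ ?_
  rw [hm.1 (φ j x) fun i ↦ idealPow_smul_top_le m i (apply_mem_smul_top _ (φ j) (hx i)), zero_smul]

theorem exists_limit_of_idealPow_smul [Module.Finite R M] [Module.Projective R M]
    (hm : IsAdicCompleteRing m) (a : ℕ → M)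
    (ha : ∀ i, a (i + 1) - a i ∈ idealPow m i • (⊤ : Submodule R M)) :
    ∃ x, ∀ i, x - a i ∈ idealPow m i • (⊤ : Submodule R M) := by
  obtain ⟨n, b, φ, hb⟩ := exists_dual_basis R M
  choose y hy using fun j ↦ hm.2 (fun i ↦ φ j (a i)) fun i ↦ by
    rw [← map_sub]
    exact idealPow_smul_top_le m i (apply_mem_smul_top _ (φ j) (ha i))
  refine ⟨∑ j, y j • b j, fun i ↦ ?_⟩
  rw [← hb (a i), ← Finset.sum_sub_distrib]
  refine sum_mem fun j _ ↦ ?_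
  rw [← sub_smul]
  exact Submodule.smul_mem_smul (hy j i) Submodule.mem_top

/-- The endomorphisms of `M` with image in `mⁱ M`. -/
def endFiltration (m : Ideal R) (M : Type*) [AddCommGroup M] [Module R M] (i : ℕ) :
    AddSubgroup (Module.End R M) where
  carrier := {f | ∀ x, f x ∈ idealPow m i • (⊤ : Submodule R M)}
  zero_mem' _ := zero_mem _
  add_mem' hf hg x := add_mem (hf x) (hg x)
  neg_mem' hf x := neg_mem (hf x)

theorem mem_endFiltration {i : ℕ} {f : Module.End R M} :
    f ∈ endFiltration m M i ↔ ∀ x, f x ∈ idealPow m i • (⊤ : Submodule R M) :=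
  Iff.rfl

theorem idealPow_smul_top_succ_le (m : Ideal R) (i : ℕ) :
    idealPow m (i + 1) • (⊤ : Submodule R M) ≤ idealPow m i • ⊤ :=
  Submodule.smul_mono (idealPow_succ_le m i) le_rfl

theorem isCompleteFiltration_endFiltration [Module.Finite R M] [Module.Projective R M]
    (hm : IsAdicCompleteRing m) : IsCompleteFiltration (endFiltration m M) where
  zero := by
    refine eq_top_iff.mpr fun f _ x ↦ ?_
    rw [idealPow_zero_smul_top]
    exact Submodule.mem_top
  succ_le i f hf x := idealPow_smul_top_succ_le m i (hf x)
  mul_mem {i j f g} hf hg x := by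
    have h := Submodule.mem_map_of_mem (f := f) (hg x)
    rw [Submodule.map_smul''] at h
    have hle : Submodule.map f ⊤ ≤ idealPow m i • ⊤ := by
      rintro _ ⟨y, -, rfl⟩
      exact hf y
    rw [add_comm]
    exact idealPow_smul_idealPow_smul_le m j i ⊤ (Submodule.smul_mono le_rfl hle h)
  separated f hf := LinearMap.ext fun x ↦ eq_zero_of_mem_idealPow_smul hm fun i ↦ hf i x
  complete a ha := by
    choose y hy using fun x ↦ exists_limit_of_idealPow_smul hm (fun i ↦ a i x) fun i ↦ ha i x
    refine ⟨{ toFun := y, map_add' := fun u v ↦ ?_, map_smul' := fun r u ↦ ?_ }, fun i x ↦ hy x i⟩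
    · refine sub_eq_zero.mp (eq_zero_of_mem_idealPow_smul hm fun i ↦ ?_)
      have h : y (u + v) - (y u + y v) =
          (y (u + v) - a i (u + v)) - (y u - a i u) - (y v - a i v) := by
        rw [map_add]; abel
      rw [h]
      exact sub_mem (sub_mem (hy _ i) (hy _ i)) (hy _ i)
    · refine sub_eq_zero.mp (eq_zero_of_mem_idealPow_smul hm fun i ↦ ?_)
      have h : y (r • u) - r • y u = (y (r • u) - a i (r • u)) - r • (y u - a i u) := by
        rw [map_smul, smul_sub]; abel
      rw [RingHom.id_apply, h]
      exact sub_mem (hy _ i) (Submodule.smul_mem _ _ (hy _ i))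

end AdicFiltration

section FiniteLength

variable {m : Ideal R} {M : Type*} [AddCommGroup M] [Module R M]

theorem isNoetherian_quotient_of_isArtinian (htwoSided : ∀ a ∈ m, ∀ r : R, a * r ∈ m)
    (hart : IsArtinian R (R ⧸ m)) : IsNoetherian R (R ⧸ m) := by
  have : m.IsTwoSided := ⟨fun r ha ↦ htwoSided _ ha r⟩
  let l : (R ⧸ m) →ₛₗ[Ideal.Quotient.mk m] (R ⧸ m) :=
    { toFun := id
      map_add' := fun _ _ ↦ rfl
      map_smul' := fun r x ↦ by
        obtain ⟨x, rfl⟩ := Ideal.Quotient.mk_surjective x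
        rfl }
  have : IsArtinianRing (R ⧸ m) :=
    (LinearMap.isArtinian_iff_of_bijective l Function.bijective_id).mp hart
  exact (LinearMap.isNoetherian_iff_of_bijective l Function.bijective_id).mpr inferInstance

theorem exists_surjective_quotient_smul_top (m : Ideal R) [Module.Finite R M] :
    ∃ (n : ℕ) (f : (Fin n → R ⧸ m) →ₗ[R] M ⧸ m • (⊤ : Submodule R M)), Function.Surjective f := by
  obtain ⟨n, b, hb⟩ := Module.Finite.exists_fin (R := R) (M := M)
  let g : Fin n → (R ⧸ m) →ₗ[R] M ⧸ m • (⊤ : Submodule R M) := fun j ↦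
    Submodule.mapQ m _ (LinearMap.toSpanSingleton R M (b j)) fun a ha ↦
      Submodule.smul_mem_smul ha Submodule.mem_top
  refine ⟨n, LinearMap.lsum R (fun _ ↦ R ⧸ m) ℕ g, fun y ↦ ?_⟩
  obtain ⟨x, rfl⟩ := Submodule.Quotient.mk_surjective _ y
  obtain ⟨c, rfl⟩ := (Submodule.mem_span_range_iff_exists_fun R).mp (hb ▸ Submodule.mem_top (x := x))
  refine ⟨fun j ↦ Submodule.Quotient.mk (c j), ?_⟩
  rw [← Submodule.mkQ_apply, map_sum, LinearMap.lsum_apply, LinearMap.sum_apply]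
  exact Finset.sum_congr rfl fun j _ ↦ rfl

theorem isArtinian_quotient_smul_top [Module.Finite R M] (hart : IsArtinian R (R ⧸ m)) :
    IsArtinian R (M ⧸ m • (⊤ : Submodule R M)) := by
  obtain ⟨n, f, hf⟩ := exists_surjective_quotient_smul_top (M := M) m
  exact isArtinian_of_surjective _ f hf

theorem isNoetherian_quotient_smul_top [Module.Finite R M] (hnoeth : IsNoetherian R (R ⧸ m)) :
    IsNoetherian R (M ⧸ m • (⊤ : Submodule R M)) := by
  obtain ⟨n, f, hf⟩ := exists_surjective_quotient_smul_top (M := M) m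
  exact isNoetherian_of_surjective f (LinearMap.range_eq_top.mpr hf)

end FiniteLength

section Decomposition

variable {m : Ideal R} {M : Type*} [AddCommGroup M] [Module R M]

/-- An endomorphism of a quotient of a projective module `M` lifts to `M`. -/
theorem exists_end_lift [Module.Projective R M] (K : Submodule R M) (g : Module.End R (M ⧸ K)) :
    ∃ f : Module.End R M, ∀ x, K.mkQ (f x) = g (K.mkQ x) := by
  obtain ⟨f, hf⟩ := Module.projective_lifting_property K.mkQ (g ∘ₗ K.mkQ) K.mkQ_surjective
  exact ⟨f, fun x ↦ LinearMap.congr_fun hf x⟩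

theorem mem_endFiltration_one_iff (htwoSided : ∀ a ∈ m, ∀ r : R, a * r ∈ m)
    {f : Module.End R M} :
    f ∈ endFiltration m M 1 ↔ ∀ x, (m • (⊤ : Submodule R M)).mkQ (f x) = 0 := by
  simp only [mem_endFiltration, idealPow_one htwoSided, Submodule.mkQ_apply,
    Submodule.Quotient.mk_eq_zero]

theorem isUnit_of_isUnit_quotient [Module.Finite R M] [Module.Projective R M]
    (htwoSided : ∀ a ∈ m, ∀ r : R, a * r ∈ m) (hm : IsAdicCompleteRing m)
    {f : Module.End R M} {g : Module.End R (M ⧸ m • (⊤ : Submodule R M))}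
    (hfg : ∀ x, (m • (⊤ : Submodule R M)).mkQ (f x) = g ((m • (⊤ : Submodule R M)).mkQ x))
    (hg : IsUnit g) : IsUnit f := by
  obtain ⟨g', hgg', hg'g⟩ := isUnit_iff_exists.mp hg
  obtain ⟨f', hf'⟩ := exists_end_lift _ g'
  refine (isCompleteFiltration_endFiltration hm).isUnit_of_inverse_mod (b := f') ?_ ?_ <;>
    refine (mem_endFiltration_one_iff htwoSided).mpr fun x ↦ ?_
  · rw [LinearMap.sub_apply, map_sub, Module.End.mul_apply, hfg, hf', ← Module.End.mul_apply, hgg']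
    exact sub_self _
  · rw [LinearMap.sub_apply, map_sub, Module.End.mul_apply, hf', hfg, ← Module.End.mul_apply, hg'g]
    exact sub_self _

/-- The Fitting idempotent modulo `m` of an endomorphism lifts, so that an endomorphism of a module
without nontrivial idempotent endomorphisms is a unit or has unit complement. -/
theorem exists_fitting_idempotent [Module.Finite R M] [Module.Projective R M]
    (htwoSided : ∀ a ∈ m, ∀ r : R, a * r ∈ m) (hm : IsAdicCompleteRing m)
    (hart : IsArtinian R (R ⧸ m)) (f : Module.End R M) :
    ∃ e : Module.End R M, IsIdempotentElem e ∧ (e = 1 → IsUnit f) ∧ (e = 0 → IsUnit (1 - f)) := by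
  set K := m • (⊤ : Submodule R M) with hK
  have := isArtinian_quotient_smul_top (M := M) hart
  have := isNoetherian_quotient_smul_top (M := M)
    (isNoetherian_quotient_of_isArtinian htwoSided hart)
  have hKf : K ≤ K.comap f := fun x hx ↦ apply_mem_smul_top m f hx
  let g : Module.End R (M ⧸ K) := K.mapQ K f hKf
  have hfg : ∀ x, K.mkQ (f x) = g (K.mkQ x) := fun x ↦ rfl
  obtain ⟨n, hn, hn1⟩ := (g.eventually_isCompl_ker_pow_range_pow.and
    (Filter.eventually_ge_atTop 1)).exists
  let p := (LinearMap.range (g ^ n)).projection _ hn.symm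
  have hp : IsIdempotentElem p := Submodule.isIdempotentElem_projection _
  obtain ⟨q, hq⟩ := exists_end_lift K p
  have hF := isCompleteFiltration_endFiltration (M := M) hm
  obtain ⟨e, he, heq⟩ := hF.exists_isIdempotentElem (f := q) <|
    (mem_endFiltration_one_iff htwoSided).mpr fun x ↦ by
      rw [LinearMap.sub_apply, map_sub, Module.End.mul_apply, hq, hq, ← Module.End.mul_apply,
        hp.eq, sub_self]
  have hep : ∀ x, K.mkQ (e x) = p (K.mkQ x) := fun x ↦ by
    rw [← hq, ← sub_eq_zero, ← map_sub]
    exact (mem_endFiltration_one_iff htwoSided).mp heq x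
  refine ⟨e, he, fun h1 ↦ ?_, fun h0 ↦ ?_⟩
  · have hp1 : p = 1 := by
      refine LinearMap.ext fun y ↦ ?_
      obtain ⟨x, rfl⟩ := K.mkQ_surjective y
      rw [← hep, h1]; rfl
    have hrange : LinearMap.range (g ^ n) = ⊤ := by
      rw [← Submodule.range_projection hn.symm]
      change LinearMap.range p = ⊤
      rw [hp1]; exact LinearMap.range_id
    have hker : LinearMap.ker (g ^ n) = ⊥ := by
      have h := hn.inf_eq_bot
      rwa [hrange, inf_top_eq] at h
    refine isUnit_of_isUnit_quotient htwoSided hm hfg ?_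
    rw [← isUnit_pow_iff (n := n) (by omega), Module.End.isUnit_iff]
    exact ⟨LinearMap.ker_eq_bot.mp hker, LinearMap.range_eq_top.mp hrange⟩
  · have hp0 : p = 0 := by
      refine LinearMap.ext fun y ↦ ?_
      obtain ⟨x, rfl⟩ := K.mkQ_surjective y
      rw [← hep, h0]; simp
    have hrange : LinearMap.range (g ^ n) = ⊥ := by
      rw [← Submodule.range_projection hn.symm]
      change LinearMap.range p = ⊥
      rw [hp0]; exact LinearMap.range_zero
    have hnil : IsNilpotent g := ⟨n, LinearMap.range_eq_bot.mp hrange⟩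
    refine isUnit_of_isUnit_quotient htwoSided hm (g := 1 - g) (fun x ↦ ?_) hnil.isUnit_one_sub
    rw [LinearMap.sub_apply, map_sub, hfg]; rfl

theorem isLocalRing_end_of_idempotents [Module.Finite R M] [Module.Projective R M] [Nontrivial M]
    (htwoSided : ∀ a ∈ m, ∀ r : R, a * r ∈ m) (hm : IsAdicCompleteRing m)
    (hart : IsArtinian R (R ⧸ m))
    (h : ∀ e : Module.End R M, IsIdempotentElem e → e = 0 ∨ e = 1) :
    IsLocalRing (Module.End R M) where
  isUnit_or_isUnit_of_add_one {a b} hab := by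
    obtain ⟨e, he, h1, h0⟩ := exists_fitting_idempotent htwoSided hm hart a
    rw [← eq_sub_iff_add_eq'] at hab
    rcases h e he with h' | h'
    · exact .inr (hab ▸ h0 h')
    · exact .inl (h1 h')

/-- A nonzero direct summand is detected modulo `m`. -/
theorem map_mkQ_lt_of_isCompl [Module.Finite R M] [Module.Projective R M]
    (hm : IsAdicCompleteRing m) {A B N : Submodule R M} (hAN : A ≤ N) (hBN : B ≤ N)
    {C : Submodule R M} (hBC : IsCompl B C) (hAC : A ≤ C) (hB : B ≠ ⊥) :
    A.map (m • (⊤ : Submodule R M)).mkQ < N.map (m • (⊤ : Submodule R M)).mkQ := by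
  refine lt_of_le_not_ge (Submodule.map_mono hAN) fun hle ↦ hB ?_
  let p := B.projection C hBC
  have hB' : B ≤ m • B := fun b hb ↦ by
    obtain ⟨a, ha, hab⟩ := hle (Submodule.mem_map_of_mem (hBN hb))
    have hz : b - a ∈ m • (⊤ : Submodule R M) := by
      rw [← Submodule.Quotient.mk_eq_zero, ← Submodule.mkQ_apply, map_sub, hab, sub_self]
    have hpz := Submodule.mem_map_of_mem (f := p) hz
    have hpa : p a = 0 := (Submodule.projection_apply_eq_zero_iff hBC).mpr (hAC ha)
    have hpb : p b = b := Submodule.projection_apply_left hBC ⟨b, hb⟩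
    rwa [Submodule.map_smul'', Submodule.map_top, Submodule.range_projection, map_sub, hpa, hpb,
      sub_zero] at hpz
  have hpow : ∀ i, B ≤ idealPow m i • ⊤ := by
    intro i
    induction i with
    | zero => exact le_top.trans (idealPow_zero_smul_top m).ge
    | succ i ih =>
      rw [idealPow_succ, Submodule.smul_assoc]
      exact hB'.trans (Submodule.smul_mono le_rfl ih)
  exact (Submodule.eq_bot_iff _).mpr fun b hb ↦ eq_zero_of_mem_idealPow_smul hm fun i ↦ hpow i hb

/-- A nontrivial idempotent endomorphism of a submodule splits it. -/
theorem exists_split_of_isIdempotentElem {N : Submodule R M} {e : Module.End R N}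
    (he : IsIdempotentElem e) (h0 : e ≠ 0) (h1 : e ≠ 1) :
    ∃ A B : Submodule R M, A ⊔ B = N ∧ Disjoint A B ∧ A ≠ ⊥ ∧ B ≠ ⊥ := by
  have hc : IsCompl (LinearMap.range e) (LinearMap.ker e) := LinearMap.IsIdempotentElem.isCompl he
  refine ⟨(LinearMap.range e).map N.subtype, (LinearMap.ker e).map N.subtype, ?_, ?_, ?_, ?_⟩
  · rw [← Submodule.map_sup, hc.sup_eq_top, Submodule.map_top, Submodule.range_subtype]
  · exact (Submodule.disjoint_map N.injective_subtype hc.disjoint)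
  · rw [(Submodule.map_injective_of_injective N.injective_subtype).ne_iff' (Submodule.map_bot _),
      Ne, LinearMap.range_eq_bot]
    exact h0
  · rw [(Submodule.map_injective_of_injective N.injective_subtype).ne_iff' (Submodule.map_bot _)]
    intro hker
    refine h1 (LinearMap.ext fun x ↦ LinearMap.ker_eq_bot.mp hker ?_)
    rw [← Module.End.mul_apply, he.eq]; rfl

theorem exists_supIndep_local_of_isCompl [Module.Finite R M] [Module.Projective R M]
    (htwoSided : ∀ a ∈ m, ∀ r : R, a * r ∈ m) (hm : IsAdicCompleteRing m)
    (hart : IsArtinian R (R ⧸ m)) (N C : Submodule R M) (hNC : IsCompl N C) :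
    ∃ s : Finset (Submodule R M), s.SupIndep id ∧ s.sup id = N ∧
      ∀ L ∈ s, IsLocalRing (Module.End R L) := by
  classical
  have := isArtinian_quotient_smul_top (M := M) hart
  induction hX : N.map (m • (⊤ : Submodule R M)).mkQ using
    WellFoundedLT.induction generalizing N C with
  | ind X ih =>
    subst hX
    by_cases hN : N = ⊥
    · exact ⟨∅, Finset.supIndep_empty _, by simp [hN], by simp⟩
    have : Nontrivial N := Submodule.nontrivial_iff_ne_bot.mpr hN
    have : Module.Finite R N := .of_surjective _ (Submodule.projectionOnto_surjective hNC)
    have : Module.Projective R N :=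
      .of_split N.subtype (Submodule.projectionOnto N C hNC)
        (Submodule.projectionOnto_comp_subtype hNC)
    by_cases hidem : ∀ e : Module.End R N, IsIdempotentElem e → e = 0 ∨ e = 1
    · refine ⟨{N}, Finset.supIndep_singleton _ _, by simp, fun L hL ↦ ?_⟩
      rw [Finset.mem_singleton] at hL
      subst hL
      exact isLocalRing_end_of_idempotents htwoSided hm hart hidem
    · push Not at hidem
      obtain ⟨e, he, h0, h1⟩ := hidem
      obtain ⟨A, B, hAB, hdisj, hA, hB⟩ := exists_split_of_isIdempotentElem he h0 h1
      have hAN : A ≤ N := hAB ▸ le_sup_left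
      have hBN : B ≤ N := hAB ▸ le_sup_right
      have hcA : IsCompl A (B ⊔ C) :=
        ⟨hdisj.disjoint_sup_right_of_disjoint_sup_left (hAB ▸ hNC.disjoint),
          codisjoint_iff.mpr (by rw [← sup_assoc, hAB, hNC.sup_eq_top])⟩
      have hcB : IsCompl B (A ⊔ C) :=
        ⟨hdisj.symm.disjoint_sup_right_of_disjoint_sup_left
            (by rw [sup_comm, hAB]; exact hNC.disjoint),
          codisjoint_iff.mpr (by rw [← sup_assoc, sup_comm B A, hAB, hNC.sup_eq_top])⟩
      obtain ⟨s, hs, hsA, hsl⟩ := ih _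
        (map_mkQ_lt_of_isCompl hm hAN hBN hcB le_sup_left hB) A _ hcA rfl
      obtain ⟨t, ht, htB, htl⟩ := ih _
        (map_mkQ_lt_of_isCompl hm hBN hAN hcA le_sup_left hA) B _ hcB rfl
      refine ⟨s ∪ t, hs.union ht (by rwa [hsA, htB]), by rw [Finset.sup_union, hsA, htB, hAB],
        fun L hL ↦ ?_⟩
      exact (Finset.mem_union.mp hL).elim (hsl L) (htl L)

end Decomposition

/-- If `R` is `m`-adically complete for a two-sided ideal `m` and `R/m` is left artinian, then
the category of finitely generated projective left `R`-modules is Krull-Schmidt: every finitely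
generated projective `R`-module is a finite internal direct sum of submodules whose endomorphism
rings are local. -/
theorem projectives_krullSchmidt_of_complete (m : Ideal R)
    (htwoSided : ∀ a ∈ m, ∀ r : R, a * r ∈ m)
    (hcomplete : IsAdicCompleteRing m)
    (hart : IsArtinian R (R ⧸ m))
    (M : Type*) [AddCommGroup M] [Module R M]
    (hfg : Module.Finite R M) (hproj : Module.Projective R M) :
    ∃ (n : ℕ) (N : Fin n → Submodule R M),
      DirectSum.IsInternal N ∧ ∀ i, IsLocalRing (Module.End R (N i)) := by
  obtain ⟨s, hs, hsup, hlocal⟩ :=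
    exists_supIndep_local_of_isCompl htwoSided hcomplete hart (⊤ : Submodule R M) ⊥ isCompl_top_bot
  refine ⟨s.card, fun i ↦ (s.equivFin.symm i : Submodule R M), ?_, fun i ↦
    hlocal _ (s.equivFin.symm i).2⟩
  rw [DirectSum.isInternal_submodule_iff_iSupIndep_and_iSup_eq_top]
  refine ⟨hs.independent.comp s.equivFin.symm.injective, ?_⟩
  rw [s.equivFin.symm.iSup_comp (g := fun L : s ↦ (L : Submodule R M)), ← hsup,
    Finset.sup_eq_iSup, iSup_subtype]
  rfl
end

section
/- Let Λ be a module-finite algebra over a commutative Cohen–Macaulay ring R with canonical module ω, such that Hom_R(Λ, ω) ≅ Λ as Λ-bimodules and Ext^i_R(Λ, ω) = 0 for all i > 0. Then every silting complex in K^b(proj Λ) is a tilting complex. -/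
set_option synthInstance.maxHeartbeats 1000000
set_option maxHeartbeats 1000000

open CategoryTheory CategoryTheory.Limits CategoryTheory.Pretriangulated

noncomputable section

variable {C : Type*} [Category C] [HasZeroObject C] [Preadditive C] [HasShift C ℤ]
  [∀ n : ℤ, (shiftFunctor C n).Additive] [Pretriangulated C]

/-- The objects of the thick triangulated subcategory generated by `T`: closure of `{T}` under
isomorphisms, shifts, extensions (distinguished triangles) and direct summands (retracts). -/
inductive GenBy (T : C) : C → Prop
  | self : GenBy T T
  | zero (X : C) : IsZero X → GenBy T X
  | ofIso {X Y : C} : (X ≅ Y) → GenBy T X → GenBy T Y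
  | shift (X : C) (n : ℤ) : GenBy T X → GenBy T (X⟦n⟧)
  | tri (Tr : Triangle C) (hTr : Tr ∈ distTriang C) :
      GenBy T Tr.obj₁ → GenBy T Tr.obj₂ → GenBy T Tr.obj₃
  | retract {X Y : C} (s : Y ⟶ X) (r : X ⟶ Y) : s ≫ r = 𝟙 Y → GenBy T X → GenBy T Y

end

section

variable (Λ : Type) [Ring Λ]

/-- The bounded homotopy category setting: a cochain complex of `Λ`-modules whose components are
finitely generated projective and which vanishes outside a bounded range of degrees. -/
def IsBddFgProj (P : CochainComplex (ModuleCat Λ) ℤ) : Prop :=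
  (∀ n : ℤ, CategoryTheory.Projective (P.X n) ∧ Module.Finite Λ (P.X n)) ∧
  ∃ a b : ℤ, ∀ n : ℤ, (n < a ∨ b < n) → Limits.IsZero (P.X n)

/-- The image of a complex in the homotopy category. -/
noncomputable def homObj (P : CochainComplex (ModuleCat Λ) ℤ) :
    HomotopyCategory (ModuleCat Λ) (ComplexShape.up ℤ) :=
  (HomotopyCategory.quotient (ModuleCat Λ) (ComplexShape.up ℤ)).obj P

/-- `P` is a silting complex: a bounded complex of finitely generated projectives with no
positive self-extensions in the homotopy category, generating `K^b(proj Λ)` as a thick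
triangulated subcategory. -/
def IsSiltingComplex (P : CochainComplex (ModuleCat Λ) ℤ) : Prop :=
  IsBddFgProj Λ P ∧
  (∀ i : ℤ, 0 < i → ∀ f : homObj Λ P ⟶ (homObj Λ P)⟦i⟧, f = 0) ∧
  (∀ Q : CochainComplex (ModuleCat Λ) ℤ, IsBddFgProj Λ Q → GenBy (homObj Λ P) (homObj Λ Q))

end

section ExtVanishing

theorem ModuleCat.shortExact_of_linearMap {R : Type} [CommRing R]
    {A B C : Type} [AddCommGroup A] [Module R A] [AddCommGroup B] [Module R B]
    [AddCommGroup C] [Module R C] {f : A →ₗ[R] B} {g : B →ₗ[R] C}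
    (hf : Function.Injective f) (hg : Function.Surjective g) (hfg : Function.Exact f g) :
    (ShortComplex.mk (ModuleCat.ofHom f) (ModuleCat.ofHom g)
      (by ext x; exact hfg.apply_apply_eq_zero x)).ShortExact where
  exact := by
    rw [ShortComplex.moduleCat_exact_iff]
    exact fun x hx ↦ (hfg x).1 hx
  mono_f := (ModuleCat.mono_iff_injective _).2 hf
  epi_g := (ModuleCat.epi_iff_surjective _).2 hg

variable {R : Type} [CommRing R] [HasExt.{0} (ModuleCat.{0} R)]

/-- All positive `Ext` groups from `M` to `ω` vanish. -/
def ExtVanishes (R : Type) [CommRing R] [HasExt.{0} (ModuleCat.{0} R)]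
    (M ω : Type) [AddCommGroup M] [Module R M] [AddCommGroup ω] [Module R ω] : Prop :=
  ∀ i : ℕ, 0 < i → Subsingleton (Abelian.Ext.{0} (ModuleCat.of R M) (ModuleCat.of R ω) i)

variable {ω : Type} [AddCommGroup ω] [Module R ω]
  {A B C : Type} [AddCommGroup A] [Module R A] [AddCommGroup B] [Module R B]
  [AddCommGroup C] [Module R C]

/-- Vanishing of `Ext` passes to modules whose identity is a finite sum of maps factoring
through a module with that property. -/
theorem ExtVanishes.of_sum_comp_eq_id (hA : ExtVanishes R A ω) {ι : Type*} [Fintype ι]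
    (s : ι → B →ₗ[R] A) (r : ι → A →ₗ[R] B) (h : ∑ k, r k ∘ₗ s k = LinearMap.id) :
    ExtVanishes R B ω := by
  intro i hi
  have := hA i hi
  refine subsingleton_of_forall_eq 0 fun ξ ↦ ?_
  have hid : (∑ k, ModuleCat.ofHom (s k) ≫ ModuleCat.ofHom (r k)) = 𝟙 (ModuleCat.of R B) := by
    ext x
    simpa [ModuleCat.hom_sum] using LinearMap.congr_fun h x
  rw [← Abelian.Ext.mk₀_id_comp ξ, ← hid, Abelian.Ext.mk₀_sum, Abelian.Ext.sum_comp]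
  refine Finset.sum_eq_zero fun k _ ↦ ?_
  rw [← Abelian.Ext.mk₀_comp_mk₀_assoc,
    Subsingleton.elim ((Abelian.Ext.mk₀ (ModuleCat.ofHom (r k))).comp ξ (zero_add i)) 0,
    Abelian.Ext.comp_zero]

theorem ExtVanishes.of_shortExact {f : A →ₗ[R] B} {g : B →ₗ[R] C}
    (hf : Function.Injective f) (hg : Function.Surjective g) (hfg : Function.Exact f g)
    (hB : ExtVanishes R B ω) (hC : ExtVanishes R C ω) : ExtVanishes R A ω := by
  intro i hi
  have := hB i hi
  have := hC (1 + i) (by omega)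
  refine subsingleton_of_forall_eq 0 fun ξ ↦ ?_
  obtain ⟨x, rfl⟩ := Abelian.Ext.contravariant_sequence_exact₁
    (ModuleCat.shortExact_of_linearMap hf hg hfg) _ ξ rfl (Subsingleton.elim _ _)
  rw [Subsingleton.elim x 0, Abelian.Ext.comp_zero]

theorem ExtVanishes.exists_extension {f : A →ₗ[R] B} {g : B →ₗ[R] C}
    (hf : Function.Injective f) (hg : Function.Surjective g) (hfg : Function.Exact f g)
    (hC : ExtVanishes R C ω) (φ : A →ₗ[R] ω) : ∃ ψ : B →ₗ[R] ω, ψ ∘ₗ f = φ := by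
  have := hC 1 one_pos
  obtain ⟨x, hx⟩ := Abelian.Ext.contravariant_sequence_exact₁
    (ModuleCat.shortExact_of_linearMap hf hg hfg) _ (Abelian.Ext.mk₀ (ModuleCat.ofHom φ))
    (n₁ := 1) rfl (Subsingleton.elim _ _)
  obtain ⟨ψ, rfl⟩ := (Abelian.Ext.mk₀_bijective _ _).2 x
  rw [Abelian.Ext.mk₀_comp_mk₀] at hx
  exact ⟨ψ.hom, congrArg ModuleCat.Hom.hom ((Abelian.Ext.mk₀_bijective _ _).1 hx)⟩

/-- If a complex `X 0 ⟶ X 1 ⟶ ⋯` of modules with vanishing `Ext` into `ω` is eventually zero and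
exact in positive degrees, then so is its `ω`-dual. -/
theorem ExtVanishes.exists_comp_eq_of_comp_eq_zero
    {X : ℕ → Type} [∀ n, AddCommGroup (X n)] [∀ n, Module R (X n)]
    (d : ∀ n, X n →ₗ[R] X (n + 1)) (hX : ∀ n, ExtVanishes R (X n) ω)
    (hd : ∀ n, Function.Exact (d n) (d (n + 1))) {N : ℕ} (hN : ∀ n, N ≤ n → Subsingleton (X n))
    (n : ℕ) (φ : X (n + 1) →ₗ[R] ω) (hφ : φ ∘ₗ d n = 0) :
    ∃ ψ : X (n + 1 + 1) →ₗ[R] ω, ψ ∘ₗ d (n + 1) = φ := by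
  let p : ∀ n, X n →ₗ[R] (d (n + 1)).ker :=
    fun n ↦ (d n).codRestrict _ fun x ↦ (hd n).apply_apply_eq_zero x
  have hp : ∀ n, Function.Surjective (p n) := by
    rintro n ⟨x, hx⟩
    obtain ⟨y, rfl⟩ := (hd n x).1 hx
    exact ⟨y, rfl⟩
  have hpd : ∀ n, Function.Exact (d n).ker.subtype (p n) := by
    intro n x
    rw [Subtype.ext_iff]
    exact ⟨fun h ↦ ⟨⟨x, h⟩, rfl⟩, by rintro ⟨y, rfl⟩; exact y.2⟩
  have hker : ∀ k n, N ≤ n + k → ExtVanishes R (d (n + 1)).ker ω := by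
    intro k
    induction k with
    | zero =>
      intro n hn
      have := hN (n + 1) (by omega)
      exact (hX 0).of_sum_comp_eq_id (ι := Empty) (fun _ ↦ 0) (fun _ ↦ 0)
        (by ext x; exact Subsingleton.elim _ _)
    | succ k ih =>
      intro n hn
      exact .of_shortExact (Submodule.subtype_injective _) (hp _) (hpd _) (hX _)
        (ih (n + 1) (by omega))
  have hle : (p (n + 1)).ker ≤ φ.ker := by
    intro x hx
    obtain ⟨y, rfl⟩ := (hd n x).1 (congrArg Subtype.val hx)
    exact LinearMap.congr_fun hφ y
  obtain ⟨ψ, hψ⟩ := ExtVanishes.exists_extension (Submodule.subtype_injective _) (hp (n + 2))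
    (hpd (n + 2)) (hker N (n + 2) (by omega))
    ((p (n + 1)).ker.liftQ φ hle ∘ₗ ((p (n + 1)).quotKerEquivOfSurjective (hp (n + 1))).symm)
  refine ⟨ψ, LinearMap.ext fun x ↦ ?_⟩
  have h := LinearMap.congr_fun hψ (p (n + 1) x)
  have h2 : ((p (n + 1)).quotKerEquivOfSurjective (hp (n + 1))).symm (p (n + 1) x) =
      (p (n + 1)).ker.mkQ x := by
    rw [LinearEquiv.symm_apply_eq]
    rfl
  simp only [LinearMap.comp_apply, LinearEquiv.coe_coe, h2] at h
  exact h

end ExtVanishing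

/-- A finite dual basis of a module, witnessing that it is finitely generated projective. -/
structure FiniteDualBasis (Λ M : Type*) [Ring Λ] [AddCommGroup M] [Module Λ M] where
  /-- The number of generators. -/
  card : ℕ
  /-- The generators. -/
  gen : Fin card → M
  /-- The coordinate functionals. -/
  coord : Fin card → M →ₗ[Λ] Λ
  sum_coord_smul : ∀ x, ∑ j, coord j x • gen j = x

theorem FiniteDualBasis.nonempty (Λ M : Type*) [Ring Λ] [AddCommGroup M] [Module Λ M]
    [Module.Finite Λ M] [Module.Projective Λ M] : Nonempty (FiniteDualBasis Λ M) := by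
  obtain ⟨n, f, g, -, -, h⟩ := Module.Finite.exists_comp_eq_id_of_projective Λ M
  refine ⟨⟨n, fun j ↦ f (Pi.single j 1), fun j ↦ LinearMap.proj j ∘ₗ g, fun x ↦ ?_⟩⟩
  conv_rhs => rw [← LinearMap.id_apply (R := Λ) x, ← h, LinearMap.comp_apply,
    ← Finset.univ_sum_single (g x)]
  simp only [map_sum, ← map_smul]
  refine Finset.sum_congr rfl fun j _ ↦ congrArg f ?_
  rw [← Pi.single_smul]
  simp

section FormTrace

variable {R Λ ω : Type*} [CommRing R] [Ring Λ] [Algebra R Λ] [AddCommGroup ω] [Module R ω]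
  {M N : Type*} [AddCommGroup M] [AddCommGroup N] [Module Λ M] [Module Λ N]
  [Module R M] [Module R N] [IsScalarTower R Λ M] [IsScalarTower R Λ N]

/-- The linear map `x ↦ c x • y`. -/
def LinearMap.coordSMul (c : M →ₗ[Λ] Λ) : N →ₗ[R] M →ₗ[Λ] N where
  toFun y := c.smulRight y
  map_add' y z := by ext x; simp
  map_smul' r y := by
    ext x
    simp [smul_algebra_smul_comm]

/-- The Hattori–Stallings trace of an endomorphism with respect to a dual basis, evaluated by a
functional `t`. -/
def FiniteDualBasis.trace (D : FiniteDualBasis Λ M) (t : Λ →ₗ[R] ω) :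
    (M →ₗ[Λ] M) →ₗ[R] ω where
  toFun u := ∑ j, t (D.coord j (u (D.gen j)))
  map_add' u v := by simp [Finset.sum_add_distrib]
  map_smul' r u := by
    simp only [LinearMap.smul_apply, LinearMap.map_smul_of_tower, map_smul, RingHom.id_apply,
      Finset.smul_sum]

theorem FiniteDualBasis.trace_apply (D : FiniteDualBasis Λ M) (t : Λ →ₗ[R] ω) (u : M →ₗ[Λ] M) :
    D.trace t u = ∑ j, t (D.coord j (u (D.gen j))) := rfl

theorem FiniteDualBasis.map_eq_sum (D : FiniteDualBasis Λ M) (g : M →ₗ[Λ] N) (x : M) :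
    g x = ∑ j, D.coord j x • g (D.gen j) := by
  conv_lhs => rw [← D.sum_coord_smul x]
  simp

variable {t : Λ →ₗ[R] ω} (ht : ∀ a b, t (a * b) = t (b * a))

include ht in
theorem FiniteDualBasis.trace_comp_comm (D : FiniteDualBasis Λ M) (E : FiniteDualBasis Λ N)
    (g : M →ₗ[Λ] N) (h : N →ₗ[Λ] M) : D.trace t (h ∘ₗ g) = E.trace t (g ∘ₗ h) := by
  simp only [trace_apply, LinearMap.comp_apply]
  have hl : ∀ j, t (D.coord j (h (g (D.gen j)))) =
      ∑ k, t (E.coord k (g (D.gen j)) * D.coord j (h (E.gen k))) := fun j ↦ by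
    rw [E.map_eq_sum h]; simp
  have hr : ∀ k, t (E.coord k (g (h (E.gen k)))) =
      ∑ j, t (E.coord k (g (D.gen j)) * D.coord j (h (E.gen k))) := fun k ↦ by
    rw [D.map_eq_sum g]; simp [ht (E.coord k _)]
  simp_rw [hl, hr]
  exact Finset.sum_comm

include ht in
theorem FiniteDualBasis.trace_coordSMul (D : FiniteDualBasis Λ M) (c : M →ₗ[Λ] Λ) (y : M) :
    D.trace t (LinearMap.coordSMul (R := R) c y) = t (c y) := by
  rw [trace_apply, D.map_eq_sum c y]
  simp [LinearMap.coordSMul, ht (c _)]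

include ht in
/-- Nondegeneracy of the trace pairing. -/
theorem FiniteDualBasis.eq_zero_of_trace_comp_eq_zero (hnd : ∀ b, (∀ a, t (a * b) = 0) → b = 0)
    (D : FiniteDualBasis Λ M) (f : N →ₗ[Λ] M)
    (hf : ∀ g : M →ₗ[Λ] N, D.trace t (f ∘ₗ g) = 0) : f = 0 := by
  ext n
  have hc : ∀ j, D.coord j (f n) = 0 := fun j ↦ hnd _ fun a ↦ by
    have h : f ∘ₗ LinearMap.coordSMul (R := R) (D.coord j) (a • n) =
        LinearMap.coordSMul (R := R) (D.coord j) (a • f n) := by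
      ext x; simp [LinearMap.coordSMul]
    have := hf (LinearMap.coordSMul (R := R) (D.coord j) (a • n))
    rwa [h, D.trace_coordSMul ht, map_smul, smul_eq_mul] at this
  rw [← D.sum_coord_smul (f n)]
  simp [hc]

include ht in
/-- Every functional on `Hom(M, N)` is represented by the trace pairing. -/
theorem FiniteDualBasis.exists_trace_comp_eq
    (hrep : ∀ χ : N →ₗ[R] ω, ∃ c : N →ₗ[Λ] Λ, ∀ y, χ y = t (c y))
    (D : FiniteDualBasis Λ M) (ψ : (M →ₗ[Λ] N) →ₗ[R] ω) :
    ∃ h : N →ₗ[Λ] M, ∀ g, ψ g = D.trace t (h ∘ₗ g) := by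
  choose c hc using fun j ↦ hrep (ψ ∘ₗ LinearMap.coordSMul (D.coord j))
  refine ⟨∑ j, LinearMap.coordSMul (R := R) (c j) (D.gen j), fun g ↦ ?_⟩
  have hg : g = ∑ j, LinearMap.coordSMul (R := R) (D.coord j) (g (D.gen j)) := by
    ext x
    simpa [LinearMap.coordSMul] using D.map_eq_sum g x
  have hcomp : (∑ j, LinearMap.coordSMul (R := R) (c j) (D.gen j)) ∘ₗ g =
      ∑ j, LinearMap.coordSMul (R := R) (c j ∘ₗ g) (D.gen j) := by
    ext x
    simp [LinearMap.coordSMul]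
  rw [hcomp, map_sum]
  simp_rw [D.trace_coordSMul ht]
  conv_lhs => rw [hg, map_sum]
  exact Finset.sum_congr rfl fun j _ ↦ hc j _

end FormTrace

section SymmetricForm

variable {R Λ ω : Type*} [CommRing R] [Ring Λ] [Algebra R Λ] [AddCommGroup ω] [Module R ω]
  (e : (Λ →ₗ[R] ω) ≃ₗ[R] Λ)

theorem symm_one_mul (he_right : ∀ (φ : Λ →ₗ[R] ω) (a : Λ),
      e (φ ∘ₗ LinearMap.mulLeft R a) = e φ * a) (φ : Λ →ₗ[R] ω) (a : Λ) :
    e.symm 1 (e φ * a) = φ a := by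
  have h : e.symm 1 ∘ₗ LinearMap.mulLeft R (e φ) = φ := e.injective (by simp [he_right])
  exact LinearMap.congr_fun h a

theorem symm_one_mul_comm
    (he_left : ∀ (φ : Λ →ₗ[R] ω) (a : Λ), e (φ ∘ₗ LinearMap.mulRight R a) = a * e φ)
    (he_right : ∀ (φ : Λ →ₗ[R] ω) (a : Λ), e (φ ∘ₗ LinearMap.mulLeft R a) = e φ * a)
    (a b : Λ) : e.symm 1 (a * b) = e.symm 1 (b * a) := by
  have h : e.symm 1 ∘ₗ LinearMap.mulLeft R a = e.symm 1 ∘ₗ LinearMap.mulRight R a :=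
    e.injective (by simp [he_left, he_right])
  exact LinearMap.congr_fun h b

theorem eq_zero_of_symm_one_mul
    (he_left : ∀ (φ : Λ →ₗ[R] ω) (a : Λ), e (φ ∘ₗ LinearMap.mulRight R a) = a * e φ)
    (b : Λ) (hb : ∀ a, e.symm 1 (a * b) = 0) : b = 0 := by
  have h : e.symm 1 ∘ₗ LinearMap.mulRight R b = 0 := LinearMap.ext hb
  simpa [he_left] using congrArg e h

/-- `R`-linear functionals on a `Λ`-module correspond to `Λ`-linear functionals. -/
theorem exists_eq_symm_one_comp
    (he_left : ∀ (φ : Λ →ₗ[R] ω) (a : Λ), e (φ ∘ₗ LinearMap.mulRight R a) = a * e φ)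
    (he_right : ∀ (φ : Λ →ₗ[R] ω) (a : Λ), e (φ ∘ₗ LinearMap.mulLeft R a) = e φ * a)
    {N : Type*} [AddCommGroup N] [Module Λ N] [Module R N] [IsScalarTower R Λ N]
    (χ : N →ₗ[R] ω) : ∃ c : N →ₗ[Λ] Λ, ∀ y, χ y = e.symm 1 (c y) := by
  let act : N → Λ →ₗ[R] ω := fun y ↦ χ ∘ₗ (LinearMap.toSpanSingleton Λ N y).restrictScalars R
  refine ⟨{ toFun := fun y ↦ e (act y), map_add' := fun y z ↦ ?_, map_smul' := fun a y ↦ ?_ },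
    fun y ↦ ?_⟩
  · rw [← map_add]
    congr 1
    ext a
    simp [act]
  · rw [RingHom.id_apply, smul_eq_mul, ← he_left]
    congr 1
    ext b
    simp [act, mul_smul]
  · simpa [act] using (symm_one_mul e he_right (act y) 1).symm

end SymmetricForm

section SuperTrace

open CochainComplex.HomComplex

universe u

variable {R Λ ω : Type} [CommRing R] [Ring Λ] [Algebra R Λ] [AddCommGroup ω] [Module R ω]

/-- Modules over an `R`-algebra are `R`-modules. -/
@[reducible]
def ModuleCat.moduleOfAlgebra (R : Type) {Λ : Type} [CommRing R] [Ring Λ] [Algebra R Λ]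
    (M : ModuleCat.{u} Λ) : Module R M :=
  Module.compHom M (algebraMap R Λ)

attribute [local instance] ModuleCat.moduleOfAlgebra

theorem ModuleCat.isScalarTower_of_algebra (R : Type) {Λ : Type} [CommRing R] [Ring Λ]
    [Algebra R Λ] (M : ModuleCat.{u} Λ) : IsScalarTower R Λ M :=
  IsScalarTower.of_algebraMap_smul fun _ _ ↦ rfl

attribute [local instance] ModuleCat.isScalarTower_of_algebra

/-- The category of modules over an `R`-algebra is `R`-linear. -/
@[reducible]
def ModuleCat.linearOfAlgebra (R Λ : Type) [CommRing R] [Ring Λ] [Algebra R Λ] :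
    Linear R (ModuleCat.{u} Λ) where
  homModule _ _ := inferInstance

attribute [local instance] ModuleCat.linearOfAlgebra

variable {P : CochainComplex (ModuleCat.{u} Λ) ℤ} (D : ∀ p, FiniteDualBasis Λ (P.X p))
  (a b : ℤ) (t : Λ →ₗ[R] ω)

/-- The alternating sum of the traces of the components of a cochain of degree zero. -/
noncomputable def superTrace : Cochain P P 0 →ₗ[R] ω where
  toFun z := ∑ p ∈ Finset.Icc a b, p.negOnePow • (D p).trace t (z.v p p (add_zero p)).hom
  map_add' z w := by simp [Finset.sum_add_distrib]
  map_smul' r z := by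
    simp only [Cochain.smul_v, ModuleCat.hom_smul, map_smul, RingHom.id_apply, Finset.smul_sum]
    exact Finset.sum_congr rfl fun p _ ↦ smul_comm _ _ _

theorem superTrace_apply (z : Cochain P P 0) : superTrace D a b t z =
    ∑ p ∈ Finset.Icc a b, p.negOnePow • (D p).trace t (z.v p p (add_zero p)).hom := rfl

variable {a b t}

theorem superTrace_comp {n m : ℤ} (hnm : n + m = 0) (g : Cochain P P n) (f : Cochain P P m) :
    superTrace D a b t (g.comp f hnm) = ∑ p ∈ Finset.Icc a b, p.negOnePow •
      (D p).trace t ((f.v (p + n) p (by omega)).hom ∘ₗ (g.v p (p + n) rfl).hom) := by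
  rw [superTrace_apply]
  refine Finset.sum_congr rfl fun p _ ↦ ?_
  rw [Cochain.comp_v g f hnm p (p + n) p rfl (by omega), ModuleCat.hom_comp]

variable (ht : ∀ a b, t (a * b) = t (b * a))
  (hab : ∀ n : ℤ, (n < a ∨ b < n) → Limits.IsZero (P.X n))

include ht hab in
theorem superTrace_δ (z : Cochain P P (-1)) : superTrace D a b t (δ (-1) 0 z) = 0 := by
  let τ : ℤ → ω := fun p ↦ p.negOnePow •
    (D p).trace t ((P.d (p - 1) p).hom ∘ₗ (z.v p (p - 1) (by omega)).hom)
  have hτ : ∀ p, p.negOnePow • (D p).trace t ((δ (-1) 0 z).v p p (add_zero p)).hom =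
      τ p - τ (p + 1) := by
    intro p
    have hp : ∀ q (hq : q + 1 = p + 1),
        (D (p + 1)).trace t ((P.d q (p + 1)).hom ∘ₗ (z.v (p + 1) q (by omega)).hom) =
        (D p).trace t ((z.v (p + 1) p (by omega)).hom ∘ₗ (P.d p (p + 1)).hom) := by
      intro q hq
      obtain rfl : q = p := by omega
      exact (D (q + 1)).trace_comp_comm ht (D q) _ _
    rw [δ_v (-1) 0 (by omega) z p p (add_zero p) (p - 1) (p + 1) rfl rfl]
    simp only [τ]
    rw [hp (p + 1 - 1) (by omega)]
    simp [Int.negOnePow_succ]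
  rw [superTrace_apply, Finset.sum_congr rfl fun p _ ↦ hτ p, Finset.sum_sub_distrib, sub_eq_zero]
  have h₀ : ∀ p, (p < a + 1 ∨ b < p) → τ p = 0 := by
    intro p hp
    have h : (P.d (p - 1) p).hom ∘ₗ (z.v p (p - 1) (by omega)).hom = 0 := by
      rw [← ModuleCat.hom_comp, ← ModuleCat.hom_zero]
      congr 1
      rcases hp with hp | hp
      · rw [(hab (p - 1) (by omega)).eq_of_src (P.d (p - 1) p) 0, comp_zero]
      · exact (hab p (.inr hp)).eq_of_src _ _
    simp [τ, h]
  have h₁ : ∑ p ∈ Finset.Icc a b, τ (p + 1) = ∑ p ∈ Finset.Icc (a + 1) (b + 1), τ p := by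
    rw [← Finset.map_add_right_Icc, Finset.sum_map]
    rfl
  rw [h₁]
  trans ∑ p ∈ Finset.Icc a (b + 1), τ p
  · refine Finset.sum_subset (Finset.Icc_subset_Icc le_rfl (by omega)) fun p _ hp ↦ h₀ p ?_
    simp only [Finset.mem_Icc] at *
    omega
  · refine (Finset.sum_subset (Finset.Icc_subset_Icc (by omega) le_rfl) fun p _ hp ↦ h₀ p ?_).symm
    simp only [Finset.mem_Icc] at *
    omega

include hab in
theorem cochain_eq_sum_single {n : ℤ} (g : Cochain P P n) :
    g = ∑ p ∈ Finset.Icc a b, Cochain.single (g.v p (p + n) rfl) n := by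
  ext p q hpq : 1
  subst hpq
  have hv : ∀ s : Finset ℤ, (∑ k ∈ s, Cochain.single (g.v k (k + n) rfl) n).v p (p + n) rfl =
      ∑ k ∈ s, (Cochain.single (g.v k (k + n) rfl) n).v p (p + n) rfl := by
    intro s
    induction s using Finset.cons_induction with
    | empty => simp
    | cons k s hk ih => rw [Finset.sum_cons, Finset.sum_cons, Cochain.add_v, ih]
  rw [hv]
  by_cases hp : p ∈ Finset.Icc a b
  · rw [Finset.sum_eq_single_of_mem p hp fun k _ hk ↦
      Cochain.single_v_eq_zero _ _ _ _ _ (Ne.symm hk), Cochain.single_v]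
  · refine (hab p ?_).eq_of_src _ _
    simp only [Finset.mem_Icc] at hp
    omega

variable (P) in
/-- `Cochain.single` as a linear map. -/
def cochainSingle (R : Type) [CommRing R] [Algebra R Λ] (p n : ℤ) :
    (P.X p →ₗ[Λ] P.X (p + n)) →ₗ[R] Cochain P P n where
  toFun g := Cochain.single (ModuleCat.ofHom g) n
  map_add' g h := by
    ext p' q' hpq : 1
    by_cases hp : p' = p
    · subst hp hpq
      simp
    · simp [Cochain.single_v_eq_zero _ _ _ _ _ hp]
  map_smul' r g := by
    ext p' q' hpq : 1
    by_cases hp : p' = p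
    · subst hp hpq
      simp only [Cochain.single_v, Cochain.smul_v, RingHom.id_apply]
      rfl
    · simp [Cochain.single_v_eq_zero _ _ _ _ _ hp]

include ht hab in
/-- Nondegeneracy of the supertrace pairing. -/
theorem eq_zero_of_superTrace_comp_eq_zero (hnd : ∀ b, (∀ a, t (a * b) = 0) → b = 0)
    {n m : ℤ} (hnm : n + m = 0) (f : Cochain P P m)
    (hf : ∀ g : Cochain P P n, superTrace D a b t (g.comp f hnm) = 0) : f = 0 := by
  ext q p hqp : 1
  obtain rfl : q = p + n := by omega
  rw [Cochain.zero_v]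
  by_cases hp : p ∈ Finset.Icc a b
  · refine ModuleCat.hom_ext ((D p).eq_zero_of_trace_comp_eq_zero ht hnd _ fun g ↦ ?_)
    have h := hf (cochainSingle P R p n g)
    rw [superTrace_comp, Finset.sum_eq_single_of_mem p hp fun k _ hk ↦ ?_] at h
    · simpa [cochainSingle, smul_eq_zero_iff_eq] using h
    · simp [cochainSingle, Cochain.single_v_eq_zero _ _ _ _ _ hk]
  · refine (hab p ?_).eq_of_tgt _ _
    simp only [Finset.mem_Icc] at hp
    omega

include ht hab in
/-- Functionals on cochains are represented by the supertrace pairing. -/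
theorem exists_superTrace_comp_eq
    (hrep : ∀ (N : ModuleCat.{u} Λ) (χ : N →ₗ[R] ω), ∃ c : N →ₗ[Λ] Λ, ∀ y, χ y = t (c y))
    {n m : ℤ} (hnm : n + m = 0) (ψ : Cochain P P n →ₗ[R] ω) :
    ∃ h : Cochain P P m, ∀ g, ψ g = superTrace D a b t (g.comp h hnm) := by
  choose h hh using fun p ↦ (D p).exists_trace_comp_eq ht (hrep (P.X (p + n)))
    (ψ ∘ₗ cochainSingle P R p n)
  refine ⟨Cochain.mk fun q p hqp ↦ p.negOnePow •
    ((P.XIsoOfEq (by omega : q = p + n)).hom ≫ ModuleCat.ofHom (h p)), fun g ↦ ?_⟩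
  rw [superTrace_comp]
  conv_lhs => rw [cochain_eq_sum_single hab g, map_sum]
  refine Finset.sum_congr rfl fun p _ ↦ ?_
  have := hh p (g.v p (p + n) rfl).hom
  rw [LinearMap.comp_apply] at this
  refine this.trans ?_
  rcases Int.units_eq_one_or p.negOnePow with hp | hp <;>
    simp [hp, HomologicalComplex.XIsoOfEq]

include D hab in
/-- The identity of the module of cochains is a finite sum of maps factoring through `Λ`. -/
theorem exists_sum_comp_eq_id_cochain (R : Type) [CommRing R] [Algebra R Λ] (n : ℤ) :
    ∃ (ι : Type) (_ : Fintype ι) (s : ι → Cochain P P n →ₗ[R] Λ) (r : ι → Λ →ₗ[R] Cochain P P n),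
      ∑ k, r k ∘ₗ s k = LinearMap.id := by
  let s (p : ℤ) (j : Fin (D p).card) (k : Fin (D (p + n)).card) : Cochain P P n →ₗ[R] Λ :=
    { toFun g := (D (p + n)).coord k ((g.v p (p + n) rfl).hom ((D p).gen j))
      map_add' g h := by simp
      map_smul' r g := by
        rw [Cochain.smul_v, ModuleCat.hom_smul, LinearMap.smul_apply,
          LinearMap.map_smul_of_tower, RingHom.id_apply] }
  let r (p : ℤ) (j : Fin (D p).card) (k : Fin (D (p + n)).card) : Λ →ₗ[R] Cochain P P n :=
    cochainSingle P R p n ∘ₗ LinearMap.coordSMul ((D p).coord j) ∘ₗ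
      (LinearMap.toSpanSingleton Λ _ ((D (p + n)).gen k)).restrictScalars R
  refine ⟨Σ p : Finset.Icc a b, Fin (D p).card × Fin (D (p + n)).card, inferInstance,
    fun i ↦ s i.1 i.2.1 i.2.2, fun i ↦ r i.1 i.2.1 i.2.2, ?_⟩
  ext1 g
  conv_rhs => rw [LinearMap.id_apply, cochain_eq_sum_single hab g]
  rw [LinearMap.sum_apply, Fintype.sum_sigma,
    ← Finset.sum_coe_sort (Finset.Icc a b) fun p ↦ Cochain.single (g.v p (p + n) rfl) n]
  refine Finset.sum_congr rfl fun p _ ↦ ?_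
  rw [Fintype.sum_prod_type]
  have hj : ∀ j, ∑ k, (r p j k ∘ₗ s p j k) g = cochainSingle P R p n
      (LinearMap.coordSMul (R := R) ((D p).coord j) ((g.v p (p + n) rfl).hom ((D p).gen j))) := by
    intro j
    conv_rhs => rw [← (D (p + n)).sum_coord_smul ((g.v p (p + n) rfl).hom ((D p).gen j)),
      map_sum, map_sum]
    rfl
  refine (Finset.sum_congr rfl fun j _ ↦ hj j).trans ?_
  rw [← map_sum]
  refine congrArg (cochainSingle P R p n) (LinearMap.ext fun x ↦ ?_)
  refine Eq.trans ?_ ((D p).map_eq_sum (g.v p (p + n) rfl).hom x).symm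
  simp [LinearMap.coordSMul]

end SuperTrace

section HomotopyCategory

open CochainComplex.HomComplex

theorem forall_hom_shift_eq_zero_iff {Λ : Type} [Ring Λ] (P : CochainComplex (ModuleCat Λ) ℤ)
    {k n m : ℤ} (hk : k + 1 = n) (hm : n + 1 = m) :
    (∀ f : homObj Λ P ⟶ (homObj Λ P)⟦n⟧, f = 0) ↔
      ∀ z : Cochain P P n, δ n m z = 0 → ∃ w : Cochain P P k, δ k n w = z := by
  let c := ((HomotopyCategory.quotient (ModuleCat Λ) (ComplexShape.up ℤ)).commShiftIso n).app P
  have hc : (∀ f : homObj Λ P ⟶ (homObj Λ P)⟦n⟧, f = 0) ↔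
      ∀ x : CohomologyClass P P n, CohomologyClass.toHom x = 0 := by
    refine ⟨fun h x ↦ ?_, fun h f ↦ ?_⟩
    · rw [← cancel_mono c.hom, zero_comp]
      exact h _
    · obtain ⟨x, hx⟩ := (CohomologyClass.toHom_bijective P P n).2 (f ≫ c.inv)
      rw [h, eq_comm] at hx
      exact (cancel_mono c.inv).1 (hx.trans zero_comp.symm)
  rw [hc]
  refine ⟨fun h z hz ↦ ?_, fun h x ↦ ?_⟩
  · exact (mem_coboundaries_iff _ k hk).1
      ((CohomologyClass.toHom_mk_eq_zero_iff (Cocycle.mk z m hm hz)).1 (h _))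
  · obtain ⟨x, rfl⟩ := x.mk_surjective
    exact (CohomologyClass.toHom_mk_eq_zero_iff x).2
      ((mem_coboundaries_iff _ k hk).2 (h _ (x.δ_eq_zero m)))

end HomotopyCategory

section Duality

open CochainComplex.HomComplex

attribute [local instance] ModuleCat.moduleOfAlgebra ModuleCat.isScalarTower_of_algebra
  ModuleCat.linearOfAlgebra

universe u

variable {R Λ ω : Type} [CommRing R] [Ring Λ] [Algebra R Λ] [AddCommGroup ω] [Module R ω]
  [HasExt.{0} (ModuleCat.{0} R)] {P : CochainComplex (ModuleCat.{u} Λ) ℤ}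

/-- If the endomorphism complex of `P` is exact in positive degrees, then so is its dual. -/
theorem exists_functional_comp_δ_eq (D : ∀ p, FiniteDualBasis Λ (P.X p)) {a b : ℤ}
    (hab : ∀ n : ℤ, (n < a ∨ b < n) → Limits.IsZero (P.X n)) (hΛ : ExtVanishes R Λ ω)
    (hP : ∀ n : ℕ, ∀ z : Cochain P P (n + 1 : ℕ), δ (n + 1 : ℕ) (n + 1 + 1 : ℕ) z = 0 →
      ∃ w : Cochain P P n, δ n (n + 1 : ℕ) w = z)
    (n : ℕ) (φ : Cochain P P (n + 1 : ℕ) →ₗ[R] ω)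
    (hφ : ∀ g : Cochain P P n, φ (δ n (n + 1 : ℕ) g) = 0) :
    ∃ ψ : Cochain P P (n + 1 + 1 : ℕ) →ₗ[R] ω, ∀ g, ψ (δ (n + 1 : ℕ) (n + 1 + 1 : ℕ) g) = φ g := by
  choose ι hι s r hrs using fun n : ℕ ↦ exists_sum_comp_eq_id_cochain (P := P) D hab R n
  have hsmall : ∀ n : ℕ, Small.{0} (Cochain P P n) := fun n ↦
    small_of_injective (β := ι n → Λ) (f := fun g k ↦ s n k g) fun g h hgh ↦ by
      rw [← LinearMap.id_apply (R := R) g, ← LinearMap.id_apply (R := R) h, ← hrs n,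
        LinearMap.sum_apply, LinearMap.sum_apply]
      exact Finset.sum_congr rfl fun k _ ↦ congrArg (r n k) (congrFun hgh k)
  let E : ∀ n : ℕ, Shrink.{0} (Cochain P P n) ≃ₗ[R] Cochain P P n :=
    fun n ↦ Shrink.linearEquiv R _
  let d : ∀ n : ℕ, Shrink.{0} (Cochain P P n) →ₗ[R] Shrink.{0} (Cochain P P (n + 1 : ℕ)) :=
    fun n ↦ (E (n + 1)).symm.toLinearMap ∘ₗ δ_hom R P P n (n + 1 : ℕ) ∘ₗ (E n).toLinearMap
  have hd : ∀ n x, E (n + 1) (d n x) = δ n (n + 1 : ℕ) (E n x) := fun n x ↦ by simp [d]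
  have hX : ∀ n, ExtVanishes R (Shrink.{0} (Cochain P P (n : ℕ))) ω := fun n ↦
    hΛ.of_sum_comp_eq_id (fun k ↦ s n k ∘ₗ (E n).toLinearMap)
      (fun k ↦ (E n).symm.toLinearMap ∘ₗ r n k) (by
        ext1 x
        have := LinearMap.congr_fun (hrs n) (E n x)
        rw [LinearMap.sum_apply] at this
        simp only [LinearMap.sum_apply, LinearMap.comp_apply, LinearEquiv.coe_coe] at this ⊢
        rw [← map_sum, this]
        simp)
  have hexact : ∀ n, Function.Exact (d n) (d (n + 1)) := by
    intro n x
    constructor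
    · intro hx
      obtain ⟨w, hw⟩ := hP n (E (n + 1) x) (by rw [← hd, hx, map_zero])
      refine ⟨(E n).symm w, (E (n + 1)).injective ?_⟩
      rw [hd, LinearEquiv.apply_symm_apply, hw]
    · rintro ⟨y, rfl⟩
      refine (E (n + 2)).injective ?_
      rw [hd, hd, δ_δ, map_zero]
  have hzero : ∀ n : ℕ, (b - a).toNat + 1 ≤ n → Subsingleton (Shrink.{0} (Cochain P P n)) := by
    intro n hn
    have : Subsingleton (Cochain P P n) := by
      refine ⟨fun z w ↦ ?_⟩
      ext p q hpq : 1
      by_cases hp : p < a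
      · exact (hab p (.inl hp)).eq_of_src _ _
      · exact (hab q (by omega)).eq_of_tgt _ _
    exact (E n).injective.subsingleton
  obtain ⟨ψ, hψ⟩ := ExtVanishes.exists_comp_eq_of_comp_eq_zero d hX hexact hzero n
    (φ ∘ₗ (E (n + 1)).toLinearMap) (by
      ext1 x
      simpa [hd] using hφ (E n x))
  refine ⟨ψ ∘ₗ (E (n + 2)).symm.toLinearMap, fun g ↦ ?_⟩
  have := LinearMap.congr_fun hψ ((E (n + 1)).symm g)
  simpa [d] using this

/-- Over a symmetric order, a bounded complex of finitely generated projectives without positive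
self-extensions has no negative self-extensions either. -/
theorem exists_δ_eq_of_symmetric (D : ∀ p, FiniteDualBasis Λ (P.X p)) {a b : ℤ}
    (hab : ∀ n : ℤ, (n < a ∨ b < n) → Limits.IsZero (P.X n)) (hΛ : ExtVanishes R Λ ω)
    {t : Λ →ₗ[R] ω} (ht : ∀ a b, t (a * b) = t (b * a))
    (hnd : ∀ b, (∀ a, t (a * b) = 0) → b = 0)
    (hrep : ∀ (N : ModuleCat.{u} Λ) (χ : N →ₗ[R] ω), ∃ c : N →ₗ[Λ] Λ, ∀ y, χ y = t (c y))
    (hP : ∀ n : ℕ, ∀ z : Cochain P P (n + 1 : ℕ), δ (n + 1 : ℕ) (n + 1 + 1 : ℕ) z = 0 →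
      ∃ w : Cochain P P n, δ n (n + 1 : ℕ) w = z)
    (n : ℕ) {k i j : ℤ} (hk : k + 1 = i) (hi : (n + 1 : ℕ) + i = 0) (hj : i + 1 = j)
    (f : Cochain P P i) (hf : δ i j f = 0) : ∃ h : Cochain P P k, δ k i h = f := by
  let φ : Cochain P P (n + 1 : ℕ) →ₗ[R] ω :=
    { toFun g := superTrace D a b t (g.comp f hi)
      map_add' g h := by rw [Cochain.add_comp, map_add]
      map_smul' r g := by rw [Cochain.smul_comp, map_smul, RingHom.id_apply] }
  obtain ⟨ψ, hψ⟩ := exists_functional_comp_δ_eq D hab hΛ hP n φ fun g ↦ by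
    have h := superTrace_δ D ht hab (g.comp f (by omega : (n : ℤ) + i = -1))
    rw [δ_comp g f _ (n + 1 : ℕ) j 0 (by omega) (by omega) hj, hf, Cochain.comp_zero, zero_add]
      at h
    rcases Int.units_eq_one_or i.negOnePow with hs | hs
    · rwa [hs, one_smul] at h
    · rwa [hs, Units.neg_smul, one_smul, map_neg, neg_eq_zero] at h
  obtain ⟨h, hh⟩ := exists_superTrace_comp_eq D ht hab hrep
    (by omega : ((n + 1 + 1 : ℕ) : ℤ) + k = 0) ψ
  have key : ∀ g : Cochain P P (n + 1 : ℕ),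
      superTrace D a b t (g.comp (f + k.negOnePow • δ k i h) hi) = 0 := by
    intro g
    have h₁ := superTrace_δ D ht hab (g.comp h (by omega : ((n + 1 : ℕ) : ℤ) + k = -1))
    rw [δ_comp g h _ (n + 1 + 1 : ℕ) i 0 (by omega) (by omega) hk, map_add] at h₁
    have h₂ : superTrace D a b t (g.comp f hi) =
        superTrace D a b t ((δ (n + 1 : ℕ) (n + 1 + 1 : ℕ) g).comp h (by omega)) :=
      (hψ g).symm.trans (hh _)
    rw [Cochain.comp_add, map_add, h₂, Cochain.comp_units_smul]
    rcases Int.units_eq_one_or k.negOnePow with hs | hs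
    · rw [hs, one_smul] at h₁ ⊢
      rwa [add_comm]
    · rw [hs] at h₁ ⊢
      simp only [Units.neg_smul, one_smul, map_neg] at h₁ ⊢
      rw [← neg_eq_zero, ← h₁]
      abel
  refine ⟨-(k.negOnePow • h), ?_⟩
  have h0 := eq_zero_of_superTrace_comp_eq_zero D ht hab hnd hi _ key
  rw [δ_neg, δ_units_smul]
  exact (eq_neg_of_add_eq_zero_left h0).symm

end Duality

/-- **All silting complexes over a symmetric order are tilting** (Proposition A.2).
Let `R` be a commutative (Cohen-Macaulay) ring, `ω` an `R`-module (the canonical module) and `Λ`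
a module-finite `R`-algebra such that `Hom_R(Λ, ω) ≅ Λ` as `Λ`-bimodules and
`Ext^i_R(Λ, ω) = 0` for all `i > 0` (i.e. `RHom_R(Λ, ω) ≃ Λ` in the derived category of
`Λ`-bimodules).  Then every silting complex in `K^b(proj Λ)` is tilting: its negative
self-extensions vanish as well. -/
theorem silting_is_tilting
    (R : Type) [CommRing R] [IsNoetherianRing R]
    (ω : Type) [AddCommGroup ω] [Module R ω] [Module.Finite R ω]
    [CategoryTheory.HasExt.{0} (ModuleCat.{0} R)]
    (Λ : Type) [Ring Λ] [Algebra R Λ] [Module.Finite R Λ]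
    -- the bimodule isomorphism `Hom_R(Λ, ω) ≅ Λ`
    (e : (Λ →ₗ[R] ω) ≃ₗ[R] Λ)
    (he_left : ∀ (φ : Λ →ₗ[R] ω) (a : Λ),
      e (φ ∘ₗ LinearMap.mulRight R a) = a * e φ)
    (he_right : ∀ (φ : Λ →ₗ[R] ω) (a : Λ),
      e (φ ∘ₗ LinearMap.mulLeft R a) = e φ * a)
    -- `Ext^i_R(Λ, ω) = 0` for `i > 0`, i.e. `Λ` is a maximal Cohen-Macaulay `R`-module
    (hext : ∀ i : ℕ, 0 < i →
      Subsingleton (Abelian.Ext.{0} (ModuleCat.of R Λ) (ModuleCat.of R ω) i))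
    (P : CochainComplex (ModuleCat Λ) ℤ) (hP : IsSiltingComplex Λ P) :
    ∀ i : ℤ, i ≠ 0 → ∀ f : homObj Λ P ⟶ (homObj Λ P)⟦i⟧, f = 0 := by
  obtain ⟨⟨hproj, a, b, hab⟩, hpos, -⟩ := hP
  have D : ∀ p, FiniteDualBasis Λ (P.X p) := fun p ↦ by
    have := (hproj p).2
    have : Module.Projective Λ (P.X p) := (IsProjective.iff_projective _).2 (hproj p).1
    exact (FiniteDualBasis.nonempty Λ (P.X p)).some
  intro i hi
  rcases hi.lt_or_gt with hi | hi
  · rw [forall_hom_shift_eq_zero_iff P (sub_add_cancel i 1) rfl]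
    refine exists_δ_eq_of_symmetric D hab hext (symm_one_mul_comm e he_left he_right)
      (eq_zero_of_symm_one_mul e he_left)
      (fun N χ ↦ ?_)
      (fun n ↦ (forall_hom_shift_eq_zero_iff P (by simp) (by simp)).1 (hpos (n + 1 : ℕ) (by omega)))
      (-i - 1).toNat (sub_add_cancel i 1) (by omega) rfl
    let _ := ModuleCat.moduleOfAlgebra R N
    have := ModuleCat.isScalarTower_of_algebra R N
    exact exists_eq_symm_one_comp e he_left he_right χ
  · exact hpos i hi
end

section
/- Let Λ be the completed preprojective algebra of a non-Dynkin graph Δ and W the Coxeter group of Δ. For any w ∈ W and any reduced expression w = s_{i_1}···s_{i_l}, the ideal I_w := I_{i_1}···I_{i_l} (where I_i = Λ(1−e_i)Λ) is independent of the chosen reduced expression, and the map w ↦ I_w is a bijection from W onto the set ⟨I_1,...,I_n⟩ of products of the ideals I_i. -/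
set_option linter.unusedSectionVars false

section PathAlgebra

variable {K : Type} [Field K] {ι : Type} [Fintype ι] [LinearOrder ι]

/-- Paths in the double quiver of the graph with `m i j` edges between `i` and `j`. -/
inductive Pth (m : ι → ι → ℕ) : ι → ι → Type
  | nil (i : ι) : Pth m i i
  | cons {i j k : ι} (a : Fin (m i j)) (p : Pth m j k) : Pth m i k

/-- The length of a path. -/
def Pth.len {m : ι → ι → ℕ} : ∀ {i j : ι}, Pth m i j → ℕ
  | _, _, .nil _ => 0
  | _, _, .cons _ p => p.len + 1

variable {m : ι → ι → ℕ}

/-- Convolution helper: `go g i F k p` is the coefficient at `p` of the product `F * g` where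
`F` is a family of coefficients for paths starting at `i`. -/
def go (g : ∀ i j : ι, Pth m i j → K) : ∀ (i : ι), (∀ j, Pth m i j → K) → ∀ (k : ι), Pth m i k → K
  | i, F, _, .nil _ => F i (.nil i) * g i i (.nil i)
  | i, F, k, .cons (j := j) a p =>
      F i (.nil i) * g i k (.cons a p) + go g j (fun j' q => F j' (.cons a q)) k p

lemma go_congrF (g : ∀ i j : ι, Pth m i j → K) {i k : ι} {F F' : ∀ j, Pth m i j → K}
    (h : ∀ j q, F j q = F' j q) (p : Pth m i k) : go g i F k p = go g i F' k p := by
  have : F = F' := funext fun j => funext (h j)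
  rw [this]

lemma go_addF (g : ∀ i j : ι, Pth m i j → K) :
    ∀ {i k : ι} (F F' : ∀ j, Pth m i j → K) (p : Pth m i k),
    go g i (fun j q => F j q + F' j q) k p = go g i F k p + go g i F' k p := by
  intro i k F F' p
  induction p with
  | nil i => simp [go, add_mul]
  | cons a p ih =>
      simp only [go]
      rw [ih]
      ring

lemma go_mulF (g : ∀ i j : ι, Pth m i j → K) (c : K) :
    ∀ {i k : ι} (F : ∀ j, Pth m i j → K) (p : Pth m i k),
    go g i (fun j q => c * F j q) k p = c * go g i F k p := by
  intro i k F p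
  induction p with
  | nil i => simp [go]; ring
  | cons a p ih =>
      simp only [go]
      rw [ih]
      ring

lemma go_zeroF (g : ∀ i j : ι, Pth m i j → K) : ∀ {i k : ι} (p : Pth m i k),
    go g i (fun _ _ => (0 : K)) k p = 0 := by
  intro i k p
  induction p with
  | nil i => simp [go]
  | cons a p ih => simp [go, ih]

lemma go_addg (g g' : ∀ i j : ι, Pth m i j → K) :
    ∀ {i k : ι} (F : ∀ j, Pth m i j → K) (p : Pth m i k),
    go (fun i j q => g i j q + g' i j q) i F k p = go g i F k p + go g' i F k p := by
  intro i k F p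
  induction p with
  | nil i => simp [go]; ring
  | cons a p ih =>
      simp only [go]
      rw [ih]
      ring

lemma go_zerog : ∀ {i k : ι} (F : ∀ j, Pth m i j → K) (p : Pth m i k),
    go (fun _ _ _ => (0 : K)) i F k p = 0 := by
  intro i k F p
  induction p with
  | nil i => simp [go]
  | cons a p ih => simp [go, ih]

/-- Raw convolution product. -/
def mulRaw (f g : ∀ i j : ι, Pth m i j → K) : ∀ i j : ι, Pth m i j → K :=
  fun i k p => go g i (f i) k p

lemma go_assoc (g h : ∀ i j : ι, Pth m i j → K) :
    ∀ {i l : ι} (F : ∀ j, Pth m i j → K) (r : Pth m i l),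
    go h i (fun k p => go g i F k p) l r = go (mulRaw g h) i F l r := by
  intro i l F r
  induction r with
  | nil i => simp [go, mulRaw, mul_assoc]
  | cons a r ih =>
      rename_i i0 j0 l0
      simp only [go, mulRaw]
      rw [go_congrF h (F' := fun k p => F i0 (.nil i0) * g i0 k (.cons a p) +
            go g j0 (fun j' q => F j' (.cons a q)) k p) (fun k p => by simp only [go])]
      rw [go_addF h, go_mulF h, ih]
      ring

lemma go_oneF (f : ∀ i j : ι, Pth m i j → K) : ∀ {i k : ι} (p : Pth m i k),
    go f i (fun j q => (match q with | .nil _ => (1 : K) | .cons _ _ => 0 : K)) k p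
      = f i k p := by
  intro i k p
  induction p with
  | nil i => simp [go]
  | cons a p ih =>
      simp only [go]
      rw [go_congrF f (F' := fun _ _ => (0 : K)) (fun j q => rfl), go_zeroF]
      ring

lemma go_oneg : ∀ {i k : ι} (F : ∀ j, Pth m i j → K) (p : Pth m i k),
    go (fun _ _ q => (match q with | .nil _ => (1 : K) | .cons _ _ => 0 : K)) i F k p
      = F k p := by
  intro i k F p
  induction p with
  | nil i => simp [go]
  | cons a p ih => simp [go, ih]

/-- The complete path algebra of the double quiver of the graph `m`: formal possibly infinite
`K`-linear combinations of paths. -/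
@[ext]
structure PreE (K : Type) [Field K] {ι : Type} (m : ι → ι → ℕ) where
  coeff : ∀ i j : ι, Pth m i j → K

namespace PreE

instance : Zero (PreE K m) := ⟨⟨fun _ _ _ => 0⟩⟩
instance : Add (PreE K m) := ⟨fun f g => ⟨fun i j p => f.coeff i j p + g.coeff i j p⟩⟩
instance : Neg (PreE K m) := ⟨fun f => ⟨fun i j p => -f.coeff i j p⟩⟩
instance : One (PreE K m) :=
  ⟨⟨fun _ _ q => (match q with | .nil _ => (1 : K) | .cons _ _ => 0 : K)⟩⟩
instance : Mul (PreE K m) := ⟨fun f g => ⟨mulRaw f.coeff g.coeff⟩⟩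

instance instRing : Ring (PreE K m) :=
  Ring.ofMinimalAxioms
    (fun a b c => by ext i j p; exact add_assoc _ _ _)
    (fun a => by ext i j p; exact zero_add _)
    (fun a => by ext i j p; exact neg_add_cancel _)
    (fun a b c => by
      ext i l r
      exact go_assoc b.coeff c.coeff (a.coeff i) r)
    (fun a => by ext i k p; exact go_oneF a.coeff p)
    (fun a => by ext i k p; exact go_oneg (a.coeff i) p)
    (fun a b c => by
      ext i k p
      exact go_addg b.coeff c.coeff (a.coeff i) p)
    (fun a b c => by
      ext i k p
      exact go_addF c.coeff (a.coeff i) (b.coeff i) p)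

end PreE

end PathAlgebra

section Preprojective

variable (K : Type) [Field K] {ι : Type} [Fintype ι] [LinearOrder ι]

/-- The preprojective relation `ρ = Σ_{α ∈ Q₁} (α α* - α* α)`, an element of the complete path
algebra: it assigns to each two-cycle `i → j → i` through matching dual arrows the
coefficient `+1` if `i < j` and `-1` if `j < i`. -/
def rho (m : ι → ι → ℕ) : PreE K m :=
  ⟨fun i k p =>
    match p with
    | .nil _ => 0
    | .cons (j := j) a q =>
        match q with
        | .nil _ => 0
        | .cons b q' =>
            match q' with
            | .cons _ _ => 0
            | .nil _ =>
                if k = i then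
                  (if (a : ℕ) = (b : ℕ) then (if i < j then (1 : K) else -1) else 0)
                else 0⟩

/-- The two-sided ideal generated by the preprojective relation. -/
def relIdeal (m : ι → ι → ℕ) : TwoSidedIdeal (PreE K m) :=
  TwoSidedIdeal.span {rho K m}

/-- The closure of the preprojective ideal with respect to the arrow-adic topology. -/
def relClosure (m : ι → ι → ℕ) : Set (PreE K m) :=
  {f | ∀ n : ℕ, ∃ g ∈ relIdeal K m, ∀ (i j : ι) (p : Pth m i j),
    p.len < n → f.coeff i j p = g.coeff i j p}

/-- The congruence defining the complete preprojective algebra. -/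
def ppCon (m : ι → ι → ℕ) : RingCon (PreE K m) :=
  ringConGen (fun x y => x - y ∈ relClosure K m)

/-- The complete preprojective algebra of the graph `m`. -/
def PPA (m : ι → ι → ℕ) : Type := (ppCon K m).Quotient

instance (m : ι → ι → ℕ) : Ring (PPA K m) :=
  inferInstanceAs (Ring (ppCon K m).Quotient)

/-- The idempotent `e_i` of the complete preprojective algebra. -/
def eIdem (m : ι → ι → ℕ) (i : ι) : PPA K m :=
  (ppCon K m).mk'
    ⟨fun _ _ p => match p with
      | .nil v => if v = i then (1 : K) else 0
      | .cons _ _ => 0⟩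

/-- The tilting ideal `I_i = Λ(1 - e_i)Λ`. -/
def Igen (m : ι → ι → ℕ) (i : ι) : TwoSidedIdeal (PPA K m) :=
  TwoSidedIdeal.span {1 - eIdem K m i}

/-- The product of two two-sided ideals. -/
def tmul {R : Type} [Ring R] (I J : TwoSidedIdeal R) : TwoSidedIdeal R :=
  TwoSidedIdeal.span {x | ∃ a ∈ I, ∃ b ∈ J, x = a * b}

/-- The product ideal `I_{i_1} ⋯ I_{i_l}` associated to a word in the vertices;
the empty word gives `I_id = Λ`. -/
def prodI (m : ι → ι → ℕ) (l : List ι) : TwoSidedIdeal (PPA K m) :=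
  l.foldr (fun i acc => tmul (Igen K m i) acc) ⊤

end Preprojective

namespace CoxeterSystem

variable {B W : Type*} [Group W] {M : CoxeterMatrix B} (cs : CoxeterSystem M W)

open Classical in
/-- The action of a simple generator on signed reflections. -/
noncomputable def signedConj (i : B) : Function.End (W × ZMod 2) :=
  fun p => (cs.simple i * p.1 * cs.simple i, p.2 + if p.1 = cs.simple i then 1 else 0)

open Classical in
theorem signedConj_mul_pow (i j : B) (k : ℕ) (t : W) (ε : ZMod 2) :
    ((cs.signedConj i * cs.signedConj j) ^ k) (t, ε) =
      ((cs.simple i * cs.simple j) ^ k * t * ((cs.simple i * cs.simple j) ^ k)⁻¹,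
        ε + ∑ q ∈ Finset.range (2 * k),
          if t = cs.simple j * (cs.simple i * cs.simple j) ^ q then 1 else 0) := by
  have hconj : ∀ q : ℕ, cs.simple j * (cs.simple i * cs.simple j) ^ q * cs.simple j =
      ((cs.simple i * cs.simple j) ^ q)⁻¹ := by
    intro q
    have h := conj_pow (i := q) (a := cs.simple j) (b := cs.simple i * cs.simple j)
    rw [cs.inv_simple] at h
    rw [← h, ← inv_pow]
    congr 1
    simp [mul_assoc]
  induction k generalizing t ε with
  | zero => simp [Function.End.one_def]
  | succ k ih =>
    rw [pow_succ']
    change (cs.signedConj i) (cs.signedConj j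
      (((cs.signedConj i * cs.signedConj j) ^ k) (t, ε))) = _
    rw [ih]
    set r := cs.simple i * cs.simple j with hr
    have hjr : cs.simple i = r * cs.simple j := by simp [hr]
    have hsj : ∀ x : W, cs.simple j * (cs.simple j * x) = x := fun x => by simp
    have hc : ∀ q : ℕ, cs.simple j * r ^ q = (r ^ q)⁻¹ * cs.simple j := fun q => by
      rw [← hconj q]; simp [mul_assoc]
    have h1 : (r ^ k * t * (r ^ k)⁻¹ = cs.simple j) ↔ (t = cs.simple j * r ^ (2 * k)) := by
      rw [mul_inv_eq_iff_eq_mul, ← eq_inv_mul_iff_mul_eq, ← mul_assoc, ← hc, mul_assoc, ← pow_add,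
        two_mul]
    have h2 : (cs.simple j * (r ^ k * t * (r ^ k)⁻¹) * cs.simple j = cs.simple i) ↔
        (t = cs.simple j * r ^ (2 * k + 1)) := by
      rw [hjr, mul_left_inj, ← eq_inv_mul_iff_mul_eq, cs.inv_simple, mul_inv_eq_iff_eq_mul,
        ← eq_inv_mul_iff_mul_eq]
      have : (r ^ k)⁻¹ * (cs.simple j * r * r ^ k) = cs.simple j * r ^ (2 * k + 1) := by
        rw [← mul_assoc, ← mul_assoc, ← hc]
        rw [mul_assoc, mul_assoc, ← pow_succ', ← pow_add]
        congr 2; omega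
      rw [this]
    simp only [signedConj]
    rw [show 2 * (k + 1) = 2 * k + 1 + 1 by ring, Finset.sum_range_succ, Finset.sum_range_succ]
    refine Prod.ext ?_ ?_
    · simp only [pow_succ', hr]
      simp [mul_assoc]
    · simp only [h1, h2]
      ring

theorem isLiftable_signedConj : M.IsLiftable cs.signedConj := by
  classical
  intro i j
  funext ⟨t, ε⟩
  rw [signedConj_mul_pow, cs.simple_mul_simple_pow, two_mul, Finset.sum_range_add]
  simp only [pow_add, cs.simple_mul_simple_pow, one_mul, inv_one, mul_one,
    CharTwo.add_self_eq_zero, add_zero]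
  rfl

/-- The parity of the number of times `t` occurs in the right inversion sequence of any word
representing `w`. -/
noncomputable def invParity (w t : W) : ZMod 2 :=
  (cs.lift ⟨cs.signedConj, cs.isLiftable_signedConj⟩ w (t, 0)).2

theorem lift_signedConj_apply (w t : W) (ε : ZMod 2) :
    cs.lift ⟨cs.signedConj, cs.isLiftable_signedConj⟩ w (t, ε) =
      (w * t * w⁻¹, ε + cs.invParity w t) := by
  induction w using cs.simple_induction_left generalizing t ε with
  | one => simp [invParity, Function.End.one_def]
  | mul_simple_left w i ih =>
    have hstep : ∀ p, cs.lift ⟨cs.signedConj, cs.isLiftable_signedConj⟩ (cs.simple i * w) p =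
        cs.signedConj i (cs.lift ⟨cs.signedConj, cs.isLiftable_signedConj⟩ w p) := by
      intro p
      rw [map_mul, cs.lift_apply_simple cs.isLiftable_signedConj]
      rfl
    rw [invParity, hstep, hstep, ih, ih]
    simp [signedConj, mul_assoc, add_assoc]

theorem invParity_mul (w v t : W) :
    cs.invParity (w * v) t = cs.invParity v t + cs.invParity w (v * t * v⁻¹) := by
  have hstep : cs.lift ⟨cs.signedConj, cs.isLiftable_signedConj⟩ (w * v) (t, 0) =
      cs.lift ⟨cs.signedConj, cs.isLiftable_signedConj⟩ w
        (cs.lift ⟨cs.signedConj, cs.isLiftable_signedConj⟩ v (t, 0)) := by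
    rw [map_mul]
    rfl
  rw [invParity, hstep, lift_signedConj_apply, lift_signedConj_apply]
  simp

open Classical in
theorem invParity_simple (i : B) (t : W) :
    cs.invParity (cs.simple i) t = if t = cs.simple i then 1 else 0 := by
  simp [invParity, cs.lift_apply_simple cs.isLiftable_signedConj, signedConj]

@[simp]
theorem invParity_one (t : W) : cs.invParity 1 t = 0 := by
  simp [invParity, Function.End.one_def]

theorem mem_rightInvSeq_of_invParity_ne_zero (ω : List B) (t : W)
    (h : cs.invParity (cs.wordProd ω) t ≠ 0) : t ∈ cs.rightInvSeq ω := by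
  induction ω with
  | nil => simp at h
  | cons i ω ih =>
    rw [rightInvSeq, List.mem_cons]
    rw [wordProd_cons, invParity_mul, invParity_simple] at h
    by_cases h' : cs.invParity (cs.wordProd ω) t = 0
    · left
      have : cs.wordProd ω * t * (cs.wordProd ω)⁻¹ = cs.simple i := by
        by_contra hne
        simp [h', hne] at h
      rw [← this]; group
    · exact Or.inr (ih h')

theorem length_mul_lt_of_invParity_ne_zero {w t : W} (h : cs.invParity w t ≠ 0) :
    cs.length (w * t) < cs.length w := by
  obtain ⟨ω, hω, rfl⟩ := cs.exists_isReduced w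
  exact (cs.isRightInversion_of_mem_rightInvSeq hω
    (cs.mem_rightInvSeq_of_invParity_ne_zero ω t h)).2

theorem invParity_ne_zero_of_isRightDescent {w : W} {i : B} (h : cs.IsRightDescent w i) :
    cs.invParity w (cs.simple i) ≠ 0 := by
  intro h0
  have h1 : cs.invParity (w * cs.simple i) (cs.simple i) ≠ 0 := by
    rw [invParity_mul, invParity_simple]
    simp [h0]
  have := cs.length_mul_lt_of_invParity_ne_zero h1
  rw [cs.simple_mul_simple_cancel_right] at this
  exact absurd h (by unfold IsRightDescent; omega)

/-- The exchange property. -/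
theorem exists_simple_mul_eq_wordProd_eraseIdx {ω : List B} {i : B}
    (h : cs.IsLeftDescent (cs.wordProd ω) i) :
    ∃ k < ω.length, cs.simple i * cs.wordProd ω = cs.wordProd (ω.eraseIdx k) := by
  rw [← isRightDescent_inv_iff, ← wordProd_reverse] at h
  have hmem := cs.mem_rightInvSeq_of_invParity_ne_zero _ _
    (cs.invParity_ne_zero_of_isRightDescent h)
  rw [rightInvSeq_reverse, List.mem_reverse] at hmem
  obtain ⟨k, hk, hki⟩ := List.mem_iff_getElem.1 hmem
  refine ⟨k, by simpa using hk, ?_⟩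
  rw [← cs.getD_leftInvSeq_mul_wordProd, List.getD_eq_getElem _ _ hk, hki]

/-- The entries of the symmetric Cartan matrix used for the dual reflection representation. -/
def cartanEntry [DecidableEq B] (M : CoxeterMatrix B) (i j : B) : ℤ :=
  if i = j then 2 else if M i j = 2 then 0 else if M i j = 3 then -1 else -2

theorem cartanEntry_comm [DecidableEq B] (M : CoxeterMatrix B) (i j : B) :
    cartanEntry M i j = cartanEntry M j i := by
  simp only [cartanEntry, M.symmetric i j, eq_comm (a := i)]

/-- A simple generator acting on the weight lattice. -/
def weightReflection [DecidableEq B] (M : CoxeterMatrix B) (i : B) : Function.End (B → ℤ) :=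
  fun v k => v k - cartanEntry M i k * v i

theorem isLiftable_weightReflection [DecidableEq B] {M : CoxeterMatrix B}
    (hM : ∀ i j, i ≠ j → M i j = 2 ∨ M i j = 3 ∨ M i j = 0) :
    M.IsLiftable (weightReflection M) := by
  intro i j
  by_cases hij : i = j
  · subst hij
    rw [M.diagonal, pow_one]
    funext v k
    change weightReflection M i (weightReflection M i v) k = v k
    simp only [weightReflection]
    have : cartanEntry M i i = 2 := by simp [cartanEntry]
    rw [this]; ring
  · have hii : cartanEntry M i i = 2 := by simp [cartanEntry]
    have hjj : cartanEntry M j j = 2 := by simp [cartanEntry]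
    have hc := cartanEntry_comm M j i
    rcases hM i j hij with h | h | h
    · have h1 : cartanEntry M i j = 0 := by simp [cartanEntry, hij, h]
      rw [h]
      funext v k
      change weightReflection M i (weightReflection M j
        (weightReflection M i (weightReflection M j v))) k = v k
      simp only [weightReflection, hc, h1, hii, hjj]
      ring
    · have h1 : cartanEntry M i j = -1 := by simp [cartanEntry, hij, h]
      rw [h]
      funext v k
      change weightReflection M i (weightReflection M j (weightReflection M i (weightReflection M j
        (weightReflection M i (weightReflection M j v))))) k = v k
      simp only [weightReflection, hc, h1, hii, hjj]
      ring
    · rw [h, pow_zero]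

theorem simple_ne_simple (hM : ∀ i j, i ≠ j → M i j = 2 ∨ M i j = 3 ∨ M i j = 0)
    {i j : B} (hij : i ≠ j) : cs.simple i ≠ cs.simple j := by
  classical
  intro h
  have h1 := congrArg (cs.lift ⟨_, isLiftable_weightReflection hM⟩) h
  rw [cs.lift_apply_simple, cs.lift_apply_simple] at h1
  have h2 := congrFun (congrFun h1 (Pi.single i 1)) i
  simp [weightReflection, cartanEntry, hij.symm] at h2

theorem simple_mul_simple_pow_ne_one (hM : ∀ i j, i ≠ j → M i j = 2 ∨ M i j = 3 ∨ M i j = 0)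
    {i j : B} (hij : i ≠ j) (h0 : M i j = 0) {k : ℕ} (hk : k ≠ 0) :
    (cs.simple i * cs.simple j) ^ k ≠ 1 := by
  classical
  intro h
  have h1 := congrArg (cs.lift ⟨_, isLiftable_weightReflection hM⟩) h
  rw [map_pow, map_mul, cs.lift_apply_simple, cs.lift_apply_simple, map_one] at h1
  have hii : cartanEntry M i i = 2 := by simp [cartanEntry]
  have hjj : cartanEntry M j j = 2 := by simp [cartanEntry]
  have hc := cartanEntry_comm M j i
  have hc' : cartanEntry M i j = -2 := by simp [cartanEntry, hij, h0]
  have key : ∀ n : ℕ,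
      ((weightReflection M i * weightReflection M j) ^ n) (Pi.single j 1) i = -2 * n ∧
      ((weightReflection M i * weightReflection M j) ^ n) (Pi.single j 1) j = 2 * n + 1 := by
    intro n
    induction n with
    | zero => simp [Function.End.one_def, hij]
    | succ n ih =>
      rw [pow_succ']
      set v := ((weightReflection M i * weightReflection M j) ^ n) (Pi.single j 1)
      change weightReflection M i (weightReflection M j v) i = _ ∧
        weightReflection M i (weightReflection M j v) j = _
      simp only [weightReflection, hc, hc', hii, hjj, ih]
      push_cast
      constructor <;> ring
  have h2 := (key k).1
  rw [h1] at h2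
  simp [Function.End.one_def, hij] at h2
  exact hk h2

theorem invParity_dihedral {i j : B}
    (hr : ∀ k : ℕ, k ≠ 0 → (cs.simple i * cs.simple j) ^ k ≠ 1) (k : ℕ) :
    cs.invParity ((cs.simple i * cs.simple j) ^ k) (cs.simple i) = 0 ∧
    cs.invParity (cs.simple j * (cs.simple i * cs.simple j) ^ k) (cs.simple i) = 0 := by
  classical
  set r := cs.simple i * cs.simple j with hrdef
  have hi : cs.simple i = r ^ 1 * cs.simple j := by simp [hrdef]
  have hjinv : ∀ n : ℕ, cs.simple j * (r ^ n)⁻¹ = r ^ n * cs.simple j := by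
    intro n
    induction n with
    | zero => simp
    | succ n ih =>
      rw [pow_succ, mul_inv_rev, ← mul_assoc]
      have : cs.simple j * r⁻¹ = r * cs.simple j := by simp [hrdef]
      rw [this, mul_assoc, ih, ← mul_assoc, ← pow_succ', ← pow_succ]
  have hconj : ∀ n a : ℕ, r ^ n * (r ^ a * cs.simple j) * (r ^ n)⁻¹ =
      r ^ (a + 2 * n) * cs.simple j := by
    intro n a
    rw [← mul_assoc, mul_assoc, hjinv, ← mul_assoc, ← pow_add, ← pow_add]
    congr 2; omega
  have hne : ∀ a : ℕ, a ≠ 0 → r ^ a * cs.simple j ≠ cs.simple j := by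
    intro a ha h
    exact hr a ha (by simpa using h)
  have hne' : ∀ a : ℕ, cs.simple j * (r ^ a * cs.simple j) * (cs.simple j)⁻¹ ≠ cs.simple i := by
    intro a h
    apply hr (a + 1) (by omega)
    rw [mul_assoc, mul_assoc, mul_inv_cancel, mul_one, hi, pow_one] at h
    have h2 : cs.simple j * (r ^ a)⁻¹⁻¹ = (r ^ a)⁻¹ * cs.simple j := by
      have := hjinv a
      rw [inv_inv, eq_inv_mul_iff_mul_eq, ← mul_assoc, ← this, inv_mul_cancel_right]
    rw [inv_inv, h] at h2
    have h3 := mul_right_cancel h2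
    rw [pow_succ']
    exact eq_inv_iff_mul_eq_one.1 h3
  have hstep : ∀ a : ℕ, a ≠ 0 → cs.invParity r (r ^ a * cs.simple j) = 0 := by
    intro a ha
    rw [hrdef, invParity_mul, invParity_simple, invParity_simple, ← hrdef]
    simp only [hne a ha, hne' a, if_false, add_zero]
  have key : ∀ n a : ℕ, a ≠ 0 → cs.invParity (r ^ n) (r ^ a * cs.simple j) = 0 := by
    intro n
    induction n with
    | zero => intros; simp
    | succ n ih =>
      intro a ha
      have h := hconj 1 a
      rw [pow_one] at h
      rw [pow_succ, invParity_mul, hstep a ha, h, ih _ (by omega), add_zero]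
  have h1 : cs.invParity (r ^ k) (cs.simple i) = 0 := by
    rw [hi]; exact key k 1 one_ne_zero
  refine ⟨h1, ?_⟩
  rw [invParity_mul, h1, invParity_simple, hi, hconj, if_neg (hne _ (by omega)), add_zero]

theorem invParity_eq_zero_of_mem_closure (hM : ∀ i j, i ≠ j → M i j = 2 ∨ M i j = 3 ∨ M i j = 0)
    {i j : B} (hij : i ≠ j) (h0 : M i j = 0) {d : W}
    (hd : d ∈ Subgroup.closure {cs.simple i, cs.simple j}) :
    cs.invParity d (cs.simple i) = 0 ∨ cs.invParity d (cs.simple j) = 0 := by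
  let AlternatingForm : W → Prop := fun d => ∃ k : ℕ, d = (cs.simple i * cs.simple j) ^ k ∨
    d = cs.simple j * (cs.simple i * cs.simple j) ^ k ∨
    d = (cs.simple j * cs.simple i) ^ k ∨
    d = cs.simple i * (cs.simple j * cs.simple i) ^ k
  have hleft : ∀ (a b : B) (k : ℕ), ∃ n : ℕ,
      cs.simple a * (cs.simple a * cs.simple b) ^ k =
        cs.simple b * (cs.simple a * cs.simple b) ^ n ∨
      cs.simple a * (cs.simple a * cs.simple b) ^ k =
        cs.simple a * (cs.simple b * cs.simple a) ^ n := by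
    intro a b k
    cases k with
    | zero => exact ⟨0, Or.inr (by simp)⟩
    | succ k => exact ⟨k, Or.inl (by rw [pow_succ']; simp [mul_assoc])⟩
  have hmul : ∀ x ∈ ({cs.simple i, cs.simple j} : Set W), ∀ y, AlternatingForm y →
      AlternatingForm (x * y) := by
    rintro x (rfl | rfl) y ⟨k, rfl | rfl | rfl | rfl⟩
    · obtain ⟨n, h | h⟩ := hleft i j k
      · exact ⟨n, Or.inr (Or.inl h)⟩
      · exact ⟨n, Or.inr (Or.inr (Or.inr h))⟩
    · exact ⟨k + 1, Or.inl (by rw [pow_succ', mul_assoc])⟩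
    · exact ⟨k, Or.inr (Or.inr (Or.inr rfl))⟩
    · exact ⟨k, Or.inr (Or.inr (Or.inl (by simp)))⟩
    · exact ⟨k, Or.inr (Or.inl rfl)⟩
    · exact ⟨k, Or.inl (by simp)⟩
    · obtain ⟨n, h | h⟩ := hleft j i k
      · exact ⟨n, Or.inr (Or.inr (Or.inr h))⟩
      · exact ⟨n, Or.inr (Or.inl h)⟩
    · exact ⟨k + 1, Or.inr (Or.inr (Or.inl (by rw [pow_succ', mul_assoc])))⟩
  have hform : AlternatingForm d := by
    induction hd using Subgroup.closure_induction_left with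
    | one => exact ⟨0, Or.inl (by simp)⟩
    | mul_left x hx y hy ih => exact hmul x hx y ih
    | inv_mul_cancel x hx y hy ih =>
      have : x⁻¹ = x := by rcases hx with rfl | rfl <;> exact cs.inv_simple _
      rw [this]
      exact hmul x hx y ih
  have h0' : M j i = 0 := by rw [M.symmetric]; exact h0
  obtain ⟨k, rfl | rfl | rfl | rfl⟩ := hform
  · exact Or.inl (cs.invParity_dihedral
      (fun _ => cs.simple_mul_simple_pow_ne_one hM hij h0) k).1
  · exact Or.inl (cs.invParity_dihedral
      (fun _ => cs.simple_mul_simple_pow_ne_one hM hij h0) k).2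
  · exact Or.inr (cs.invParity_dihedral
      (fun _ => cs.simple_mul_simple_pow_ne_one hM hij.symm h0') k).1
  · exact Or.inr (cs.invParity_dihedral
      (fun _ => cs.simple_mul_simple_pow_ne_one hM hij.symm h0') k).2

theorem not_isRightDescent_and (hM : ∀ i j, i ≠ j → M i j = 2 ∨ M i j = 3 ∨ M i j = 0)
    {i j : B} (hij : i ≠ j) (h0 : M i j = 0) (w : W) :
    ¬ (cs.IsRightDescent w i ∧ cs.IsRightDescent w j) := by
  rintro ⟨hwi, hwj⟩
  set D := Subgroup.closure {cs.simple i, cs.simple j} with hD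
  obtain ⟨⟨d, hd⟩, -, hmin⟩ := exists_minimalFor_of_wellFoundedLT (fun _ : D => True)
    (fun d : D => cs.length (w * d)) ⟨1, trivial⟩
  have hx : ∀ t ∈ D, cs.invParity (w * d) t = 0 := by
    intro t ht
    by_contra hne
    have h1 := cs.length_mul_lt_of_invParity_ne_zero hne
    have h2 := hmin (j := ⟨d * t, D.mul_mem hd ht⟩) trivial (by simpa [mul_assoc] using h1.le)
    simp only [mul_assoc] at h1 h2
    omega
  have hparity : ∀ s ∈ D, cs.invParity w s = cs.invParity d⁻¹ s := by
    intro s hs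
    have : w = w * d * d⁻¹ := by simp
    rw [this, invParity_mul, hx, add_zero]
    exact D.mul_mem (D.mul_mem (D.inv_mem hd) hs) (D.inv_mem (D.inv_mem hd))
  have hi : cs.simple i ∈ D := Subgroup.subset_closure (by simp)
  have hj : cs.simple j ∈ D := Subgroup.subset_closure (by simp)
  rcases cs.invParity_eq_zero_of_mem_closure hM hij h0 (D.inv_mem hd) with h | h
  · exact cs.invParity_ne_zero_of_isRightDescent hwi (by rw [hparity _ hi, h])
  · exact cs.invParity_ne_zero_of_isRightDescent hwj (by rw [hparity _ hj, h])

theorem isReduced_cons_iff {i : B} {ω : List B} :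
    cs.IsReduced (i :: ω) ↔
      cs.IsReduced ω ∧ cs.length (cs.simple i * cs.wordProd ω) = cs.length (cs.wordProd ω) + 1 := by
  constructor
  · intro h
    have h1 : cs.IsReduced ω := by simpa using h.drop 1
    refine ⟨h1, ?_⟩
    rw [← wordProd_cons, h.eq, h1.eq, List.length_cons]
  · rintro ⟨h1, h2⟩
    rw [IsReduced, wordProd_cons, h2, h1.eq, List.length_cons]

theorem exists_eq_simple_mul_simple_mul {i j : B} (hs : cs.simple i ≠ cs.simple j) {w : W}
    (hi : cs.IsLeftDescent w i) (hj : cs.IsLeftDescent w j) :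
    ∃ x, w = cs.simple j * (cs.simple i * x) ∧ cs.length w = cs.length x + 2 := by
  obtain ⟨ω, hω, hw⟩ := cs.exists_isReduced (cs.simple i * w)
  have hw' : w = cs.wordProd (i :: ω) := by rw [wordProd_cons, ← hw]; simp
  have hlen := cs.isLeftDescent_iff.1 hi
  rw [hw, hω.eq] at hlen
  rw [hw'] at hj
  obtain ⟨k, hk, hkw⟩ := cs.exists_simple_mul_eq_wordProd_eraseIdx hj
  rw [← hw'] at hkw
  cases k with
  | zero =>
    exfalso
    simp only [List.eraseIdx_cons_zero] at hkw
    rw [← hw] at hkw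
    exact hs (mul_right_cancel hkw).symm
  | succ k =>
    rw [List.eraseIdx_cons_succ, wordProd_cons] at hkw
    have hwx : w = cs.simple j * (cs.simple i * cs.wordProd (ω.eraseIdx k)) := by
      rw [← hkw]; simp
    refine ⟨_, hwx, ?_⟩
    have hk' : k < ω.length := by simpa using hk
    have h1 := cs.length_wordProd_le (ω.eraseIdx k)
    rw [List.length_eraseIdx_of_lt hk'] at h1
    have h2 := cs.length_mul_le (cs.simple j) (cs.simple i * cs.wordProd (ω.eraseIdx k))
    have h3 := cs.length_mul_le (cs.simple i) (cs.wordProd (ω.eraseIdx k))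
    rw [← hwx] at h2
    rw [length_simple] at h2 h3
    omega

theorem exists_eq_braid_mul {i j : B} (hs : cs.simple i ≠ cs.simple j) (h3 : M i j = 3) {w : W}
    (hi : cs.IsLeftDescent w i) (hj : cs.IsLeftDescent w j) :
    ∃ x, w = cs.simple i * (cs.simple j * (cs.simple i * x)) ∧ cs.length w = cs.length x + 3 := by
  obtain ⟨x, hx, hlx⟩ := cs.exists_eq_simple_mul_simple_mul hs hi hj
  obtain ⟨ω, hω, rfl⟩ := cs.exists_isReduced x
  have hw' : w = cs.wordProd (j :: i :: ω) := by rw [wordProd_cons, wordProd_cons, hx]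
  have hi' := cs.isLeftDescent_iff.1 hi
  rw [hw'] at hi
  obtain ⟨k, hk, hkw⟩ := cs.exists_simple_mul_eq_wordProd_eraseIdx hi
  rw [← hw'] at hkw
  match k, hk, hkw with
  | 0, _, hkw =>
    exfalso
    rw [List.eraseIdx_cons_zero, wordProd_cons] at hkw
    rw [mul_left_cancel hkw] at hlx
    omega
  | 1, _, hkw =>
    exfalso
    simp only [List.eraseIdx_cons_succ, List.eraseIdx_cons_zero, wordProd_cons] at hkw
    rw [hx, ← mul_assoc, ← mul_assoc] at hkw
    have hcomm := mul_right_cancel hkw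
    have h2 : (cs.simple i * cs.simple j) ^ 2 = 1 := by
      rw [pow_two, ← mul_assoc, hcomm, simple_mul_simple_self]
    have hp := cs.simple_mul_simple_pow i j
    rw [h3, pow_succ, h2, one_mul] at hp
    apply hs
    rw [← cs.inv_simple j]
    exact eq_inv_iff_mul_eq_one.2 hp
  | k + 2, hk, hkw =>
    simp only [List.eraseIdx_cons_succ, wordProd_cons] at hkw
    have hwx : w = cs.simple i * (cs.simple j * (cs.simple i * cs.wordProd (ω.eraseIdx k))) := by
      rw [← hkw]; simp
    refine ⟨_, hwx, ?_⟩
    have hk' : k < ω.length := by simpa using hk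
    have h1 := cs.length_wordProd_le (ω.eraseIdx k)
    rw [List.length_eraseIdx_of_lt hk'] at h1
    have e1 := cs.length_mul_le (cs.simple i)
      (cs.simple j * (cs.simple i * cs.wordProd (ω.eraseIdx k)))
    have e2 := cs.length_mul_le (cs.simple j) (cs.simple i * cs.wordProd (ω.eraseIdx k))
    have e3 := cs.length_mul_le (cs.simple i) (cs.wordProd (ω.eraseIdx k))
    rw [← hwx] at e1
    rw [length_simple] at e1 e2 e3
    rw [hω.eq] at hlx
    omega

theorem simple_commute_of_eq_two {i j : B} (h : M i j = 2) (x : W) :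
    cs.simple i * (cs.simple j * x) = cs.simple j * (cs.simple i * x) := by
  have hp := cs.simple_mul_simple_pow i j
  rw [h, pow_two, mul_eq_one_iff_eq_inv, mul_inv_rev, cs.inv_simple, cs.inv_simple] at hp
  rw [← mul_assoc, hp, mul_assoc]

theorem simple_braid_of_eq_three {i j : B} (h : M i j = 3) (x : W) :
    cs.simple i * (cs.simple j * (cs.simple i * x)) =
      cs.simple j * (cs.simple i * (cs.simple j * x)) := by
  have hp := cs.simple_mul_simple_pow i j
  rw [h, pow_succ, pow_two, mul_assoc, mul_eq_one_iff_eq_inv] at hp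
  simp only [mul_inv_rev, cs.inv_simple] at hp
  have : cs.simple i * (cs.simple j * cs.simple i) =
      cs.simple j * (cs.simple i * cs.simple j) := by
    calc cs.simple i * (cs.simple j * cs.simple i)
        = cs.simple i * cs.simple j * cs.simple i := by rw [mul_assoc]
      _ = cs.simple j * cs.simple i * (cs.simple j * cs.simple i) * cs.simple i := by rw [← hp]
      _ = cs.simple j * (cs.simple i * cs.simple j) := by simp [mul_assoc]
  rw [← mul_assoc (cs.simple j), ← mul_assoc, this]
  simp [mul_assoc]

/-- Operators satisfying the braid relations take the same value along all reduced words of an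
element, for Coxeter matrices with off-diagonal entries in `{2, 3, 0}`. -/
theorem foldr_eq_foldr_of_isReduced (hM : ∀ i j, i ≠ j → M i j = 2 ∨ M i j = 3 ∨ M i j = 0)
    {X : Type*} (T : B → X → X)
    (h2 : ∀ i j, M i j = 2 → ∀ x, T i (T j x) = T j (T i x))
    (h3 : ∀ i j, M i j = 3 → ∀ x, T i (T j (T i x)) = T j (T i (T j x))) (x₀ : X)
    (l l' : List B) (hl : cs.IsReduced l) (hl' : cs.IsReduced l')
    (h : cs.wordProd l = cs.wordProd l') : l.foldr T x₀ = l'.foldr T x₀ := by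
  induction hn : l.length using Nat.strong_induction_on generalizing l l' with
  | _ n ih =>
  have hlen : l.length = l'.length := by rw [← hl.eq, ← hl'.eq, h]
  match l, l', hl, hl', h, hlen, hn with
  | [], [], _, _, _, _, _ => rfl
  | i :: a, j :: b, hl, hl', h, hlen, hn =>
    have ha := (cs.isReduced_cons_iff.1 hl).1
    have hb := (cs.isReduced_cons_iff.1 hl').1
    simp only [List.length_cons] at hn hlen
    simp only [List.foldr_cons]
    by_cases hij : i = j
    · subst hij
      rw [wordProd_cons, wordProd_cons] at h
      rw [ih a.length (by omega) a b ha hb (mul_left_cancel h) rfl]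
    have hs := cs.simple_ne_simple hM hij
    obtain ⟨w, hw⟩ : ∃ w, w = cs.wordProd (i :: a) := ⟨_, rfl⟩
    have hwa : cs.simple i * w = cs.wordProd a := by rw [hw, wordProd_cons]; simp
    have hwb : cs.simple j * w = cs.wordProd b := by rw [hw, h, wordProd_cons]; simp
    have hlw : cs.length w = a.length + 1 := by rw [hw, hl.eq, List.length_cons]
    have hi : cs.IsLeftDescent w i := by
      rw [IsLeftDescent, hwa, ha.eq]; omega
    have hj : cs.IsLeftDescent w j := by
      rw [IsLeftDescent, hwb, hb.eq]; omega
    rcases hM i j hij with hm | hm | hm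
    · obtain ⟨x, hx, hlx⟩ := cs.exists_eq_simple_mul_simple_mul hs hi hj
      obtain ⟨c, hc, rfl⟩ := cs.exists_isReduced x
      have hxa : cs.wordProd a = cs.wordProd (j :: c) := by
        rw [← hwa, hx, wordProd_cons, cs.simple_commute_of_eq_two (M.symmetric i j ▸ hm)]; simp
      have hxb : cs.wordProd b = cs.wordProd (i :: c) := by
        rw [← hwb, hx, wordProd_cons]; simp
      rw [hc.eq] at hlx
      rw [ih a.length (by omega) a (j :: c) ha
          (by rw [IsReduced, ← hxa, ha.eq, List.length_cons]; omega) hxa rfl,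
        ih b.length (by omega) b (i :: c) hb
          (by rw [IsReduced, ← hxb, hb.eq, List.length_cons]; omega) hxb rfl]
      exact h2 i j hm _
    · obtain ⟨x, hx, hlx⟩ := cs.exists_eq_braid_mul hs hm hi hj
      obtain ⟨c, hc, rfl⟩ := cs.exists_isReduced x
      have hxa : cs.wordProd a = cs.wordProd (j :: i :: c) := by
        rw [← hwa, hx, wordProd_cons, wordProd_cons]; simp
      have hxb : cs.wordProd b = cs.wordProd (i :: j :: c) := by
        rw [← hwb, hx, wordProd_cons, wordProd_cons, cs.simple_braid_of_eq_three hm]; simp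
      rw [hc.eq] at hlx
      rw [ih a.length (by omega) a (j :: i :: c) ha
          (by rw [IsReduced, ← hxa, ha.eq, List.length_cons, List.length_cons]; omega) hxa rfl,
        ih b.length (by omega) b (i :: j :: c) hb
          (by rw [IsReduced, ← hxb, hb.eq, List.length_cons, List.length_cons]; omega) hxb rfl]
      exact h3 i j hm _
    · exact absurd ⟨cs.isRightDescent_inv_iff.2 hi, cs.isRightDescent_inv_iff.2 hj⟩
        (cs.not_isRightDescent_and hM hij hm w⁻¹)

end CoxeterSystem

/-- A finite family of arrows with an involution inside a ring, satisfying the mesh relations and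
the exactness properties of a preprojective algebra. -/
structure PreprojectiveData (R : Type) [Ring R] (ι A : Type) [DecidableEq ι] [Fintype A] where
  e : ι → R
  src : A → ι
  tgt : A → ι
  star : A → A
  sgn : A → ℤ
  arr : A → R
  e_mul_self : ∀ i, e i * e i = e i
  e_mul_of_ne : ∀ i j, i ≠ j → e i * e j = 0
  star_star : ∀ a, star (star a) = a
  src_star : ∀ a, src (star a) = tgt a
  src_ne_tgt : ∀ a, src a ≠ tgt a
  sgn_mul_self : ∀ a, sgn a * sgn a = 1
  e_mul_arr : ∀ a, e (src a) * arr a = arr a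
  arr_mul_e : ∀ a, arr a * e (tgt a) = arr a
  exists_central_add : ∀ i x, ∃ (c : R) (z : A → R), (∀ y, c * y = y * c) ∧
    e i * x = c * e i + ∑ a with src a = i, arr a * z a
  mesh : ∀ i, ∑ a with src a = i, arr a * (sgn a • arr (star a)) = 0
  exact : ∀ i (z : A → R), (∀ a, e (tgt a) * z a = z a) →
    ∑ a with src a = i, arr a * z a = 0 →
    ∃ y, e i * y = y ∧ ∀ a, src a = i → z a = sgn a • (arr (star a) * y)
  e_ne_sum : ∀ i (z : A → R), e i ≠ ∑ a with src a = i, arr a * z a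

namespace TwoSidedIdeal

theorem mul_mem_tmul {R : Type} [Ring R] {I J : TwoSidedIdeal R} {a b : R} (ha : a ∈ I)
    (hb : b ∈ J) : a * b ∈ tmul I J :=
  TwoSidedIdeal.subset_span ⟨a, ha, b, hb, rfl⟩

theorem tmul_le_of_forall {R : Type} [Ring R] {s : Set R} {J L : TwoSidedIdeal R}
    (h : ∀ a ∈ s, ∀ b ∈ J, a * b ∈ L) : tmul (TwoSidedIdeal.span s) J ≤ L := by
  let N : TwoSidedIdeal R := TwoSidedIdeal.mk' {a | ∀ b ∈ J, a * b ∈ L}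
    (fun b _ => by simp)
    (fun hx hy b hb => by rw [add_mul]; exact L.add_mem (hx b hb) (hy b hb))
    (fun hx b hb => by rw [neg_mul]; exact L.neg_mem (hx b hb))
    (fun hy b hb => by rw [mul_assoc]; exact L.mul_mem_left _ _ (hy b hb))
    (fun hx b hb => by rw [mul_assoc]; exact hx _ (J.mul_mem_left _ _ hb))
  have hN : ∀ a, a ∈ N ↔ ∀ b ∈ J, a * b ∈ L := fun a => TwoSidedIdeal.mem_mk' ..
  have hs : TwoSidedIdeal.span s ≤ N := by
    rw [TwoSidedIdeal.span_le]
    intro a ha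
    exact (hN a).2 (h a ha)
  rw [tmul, TwoSidedIdeal.span_le]
  rintro _ ⟨a, ha, b, hb, rfl⟩
  exact (hN a).1 (hs ha) b hb

theorem sum_mem' {R α : Type} [Ring R] (J : TwoSidedIdeal R) (s : Finset α) (f : α → R)
    (h : ∀ a ∈ s, f a ∈ J) : ∑ a ∈ s, f a ∈ J := by
  classical
  induction s using Finset.induction_on with
  | empty => simp
  | insert a s ha ih =>
    rw [Finset.sum_insert ha]
    exact J.add_mem (h a (by simp)) (ih fun b hb => h b (by simp [hb]))

theorem zsmul_mem' {R : Type} [Ring R] (J : TwoSidedIdeal R) (n : ℤ) {x : R} (h : x ∈ J) :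
    n • x ∈ J := by
  rw [← smul_one_mul]
  exact J.mul_mem_left _ _ h

end TwoSidedIdeal

namespace PreprojectiveData

variable {R : Type} [Ring R] {ι A : Type} [DecidableEq ι] [Fintype A]
  (D : PreprojectiveData R ι A)

theorem tgt_star (a : A) : D.tgt (D.star a) = D.src a := by
  rw [← D.src_star, D.star_star]

theorem e_mul_arr_of_ne {i : ι} {a : A} (h : i ≠ D.src a) : D.e i * D.arr a = 0 := by
  rw [← D.e_mul_arr, ← mul_assoc, D.e_mul_of_ne _ _ h, zero_mul]

theorem arr_mul_e_of_ne {i : ι} {a : A} (h : D.tgt a ≠ i) : D.arr a * D.e i = 0 := by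
  rw [← D.arr_mul_e, mul_assoc, D.e_mul_of_ne _ _ h, mul_zero]

/-- The product of `Λ(1 - e i)Λ` with a two-sided ideal. -/
def step (i : ι) (J : TwoSidedIdeal R) : TwoSidedIdeal R :=
  tmul (TwoSidedIdeal.span {1 - D.e i}) J

theorem mem_step_of {i : ι} {J : TwoSidedIdeal R} {x : R} (hx : x ∈ J) {z : A → R}
    (hz : ∀ a, D.src a = i → z a ∈ J)
    (h : D.e i * x = ∑ a with D.src a = i, D.arr a * z a) : x ∈ D.step i J := by
  have hmem : ∀ y ∈ J, (1 - D.e i) * y ∈ D.step i J := fun y hy =>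
    TwoSidedIdeal.mul_mem_tmul (TwoSidedIdeal.subset_span rfl) hy
  have hsplit : x = (1 - D.e i) * x + D.e i * x := by noncomm_ring
  rw [hsplit, h]
  refine (D.step i J).add_mem (hmem x hx) (TwoSidedIdeal.sum_mem' _ _ _ fun a ha => ?_)
  simp only [Finset.mem_filter, Finset.mem_univ, true_and] at ha
  have : D.arr a * z a = D.arr a * ((1 - D.e i) * z a) := by
    rw [← mul_assoc, mul_sub, D.arr_mul_e_of_ne (by rw [← ha]; exact (D.src_ne_tgt a).symm)]
    simp
  rw [this]
  exact (D.step i J).mul_mem_left _ _ (hmem _ (hz a ha))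

theorem step_le_and (i : ι) (J : TwoSidedIdeal R) {x : R} (hx : x ∈ D.step i J) :
    x ∈ J ∧ ∃ z : A → R, (∀ a, z a ∈ J) ∧
      D.e i * x = ∑ a with D.src a = i, D.arr a * z a := by
  let N : TwoSidedIdeal R := TwoSidedIdeal.mk' {x | x ∈ J ∧ ∃ z : A → R, (∀ a, z a ∈ J) ∧
      D.e i * x = ∑ a with D.src a = i, D.arr a * z a}
    ⟨J.zero_mem, 0, fun _ => J.zero_mem, by simp⟩
    (by
      rintro x y ⟨hx, z, hz, hxz⟩ ⟨hy, w, hw, hyw⟩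
      refine ⟨J.add_mem hx hy, z + w, fun a => J.add_mem (hz a) (hw a), ?_⟩
      simp [mul_add, hxz, hyw, Finset.sum_add_distrib])
    (by
      rintro x ⟨hx, z, hz, hxz⟩
      refine ⟨J.neg_mem hx, -z, fun a => J.neg_mem (hz a), ?_⟩
      simp [hxz])
    (by
      rintro r x ⟨hx, z, hz, hxz⟩
      obtain ⟨c, w, hc, hw⟩ := D.exists_central_add i r
      refine ⟨J.mul_mem_left _ _ hx, fun a => c * z a + w a * x, fun a =>
        J.add_mem (J.mul_mem_left _ _ (hz a)) (J.mul_mem_left _ _ hx), ?_⟩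
      rw [← mul_assoc, hw, add_mul, mul_assoc, hxz, Finset.mul_sum, Finset.sum_mul,
        ← Finset.sum_add_distrib]
      refine Finset.sum_congr rfl fun a _ => ?_
      rw [mul_add, ← mul_assoc, ← mul_assoc, ← mul_assoc, hc])
    (by
      rintro x r ⟨hx, z, hz, hxz⟩
      refine ⟨J.mul_mem_right _ _ hx, fun a => z a * r, fun a => J.mul_mem_right _ _ (hz a), ?_⟩
      rw [← mul_assoc, hxz, Finset.sum_mul]
      simp [mul_assoc])
  have hN : ∀ x, x ∈ N ↔ _ := fun x => TwoSidedIdeal.mem_mk' ..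
  refine (hN x).1 (TwoSidedIdeal.tmul_le_of_forall ?_ hx)
  rintro _ rfl b hb
  refine (hN _).2 ⟨J.mul_mem_left _ _ hb, 0, fun _ => J.zero_mem, ?_⟩
  rw [← mul_assoc, mul_sub, D.e_mul_self]
  simp

theorem step_le (i : ι) (J : TwoSidedIdeal R) : D.step i J ≤ J :=
  fun _ hx => (D.step_le_and i J hx).1

theorem exists_of_mem_step {i : ι} {J : TwoSidedIdeal R} {x : R} (hx : x ∈ D.step i J) :
    ∃ z : A → R, (∀ a, z a ∈ J) ∧ (∀ a, D.e (D.tgt a) * z a = z a) ∧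
      D.e i * x = ∑ a with D.src a = i, D.arr a * z a := by
  obtain ⟨-, z, hz, h⟩ := D.step_le_and i J hx
  refine ⟨fun a => D.e (D.tgt a) * z a, fun a => J.mul_mem_left _ _ (hz a), fun a => ?_, ?_⟩
  · rw [← mul_assoc, D.e_mul_self]
  · rw [h]
    refine Finset.sum_congr rfl fun a _ => ?_
    rw [← mul_assoc, D.arr_mul_e]

theorem mem_step_of_e_mul_eq_zero {i : ι} {J : TwoSidedIdeal R} {x : R} (hx : x ∈ J)
    (h : D.e i * x = 0) : x ∈ D.step i J :=
  D.mem_step_of hx (z := 0) (fun _ _ => J.zero_mem) (by simp [h])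

theorem e_mul_eq_zero {i j : ι} (h : j ≠ i) {x : R} (hx : D.e i * x = x) : D.e j * x = 0 := by
  rw [← hx, ← mul_assoc, D.e_mul_of_ne _ _ h, zero_mul]

theorem mem_step_of_e_mul_eq {i j : ι} (hij : j ≠ i) {J : TwoSidedIdeal R} {x : R} (hx : x ∈ J)
    (h : D.e i * x = x) : x ∈ D.step j J :=
  D.mem_step_of_e_mul_eq_zero hx (D.e_mul_eq_zero hij h)

theorem step_mono (i : ι) {J L : TwoSidedIdeal R} (h : J ≤ L) : D.step i J ≤ D.step i L := by
  intro x hx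
  obtain ⟨z, hz, -, hxz⟩ := D.exists_of_mem_step hx
  exact D.mem_step_of (h (D.step_le i J hx)) (fun a _ => h (hz a)) hxz

theorem step_step_self (i : ι) (J : TwoSidedIdeal R) : D.step i (D.step i J) = D.step i J := by
  refine le_antisymm (D.step_le _ _) fun x hx => ?_
  obtain ⟨z, hz, hez, hxz⟩ := D.exists_of_mem_step hx
  refine D.mem_step_of hx (fun a ha => ?_) hxz
  exact D.mem_step_of_e_mul_eq (by rw [← ha]; exact D.src_ne_tgt a) (hz a) (hez a)

theorem step_comm_le {i j : ι} (h : ∀ a, D.src a = i → D.tgt a ≠ j) (J : TwoSidedIdeal R) :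
    D.step i (D.step j J) ≤ D.step j (D.step i J) := by
  have h' : ∀ a, D.src a = j → D.tgt a ≠ i := fun a ha hai =>
    h (D.star a) ((D.src_star a).trans hai) ((D.tgt_star a).trans ha)
  intro x hx
  obtain ⟨w, hw, hew, hxw⟩ := D.exists_of_mem_step (D.step_le i _ hx)
  have hxi : x ∈ D.step i J := D.step_mono i (D.step_le j J) hx
  exact D.mem_step_of hxi
    (fun a ha => D.mem_step_of_e_mul_eq (h' a ha).symm (hw a) (hew a)) hxw

theorem step_comm {i j : ι} (h : ∀ a, D.src a = i → D.tgt a ≠ j) (J : TwoSidedIdeal R) :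
    D.step i (D.step j J) = D.step j (D.step i J) :=
  le_antisymm (D.step_comm_le h J) (D.step_comm_le (fun a ha hai =>
    h (D.star a) ((D.src_star a).trans hai) ((D.tgt_star a).trans ha)) J)

theorem arr_mem_step {a : A} {J : TwoSidedIdeal R} {x : R} (hx : x ∈ J) :
    D.arr a * x ∈ D.step (D.tgt a) J := by
  refine D.mem_step_of_e_mul_eq_zero (J.mul_mem_left _ _ hx) ?_
  rw [← mul_assoc, D.e_mul_arr_of_ne (D.src_ne_tgt a).symm, zero_mul]

theorem arr_mem_step_src {a : A} {J : TwoSidedIdeal R} {x : R} (hx : x ∈ J) :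
    D.arr a * x ∈ D.step (D.src a) J := by
  classical
  refine D.mem_step_of (z := fun b => if b = a then x else 0) (J.mul_mem_left _ _ hx)
    (fun b _ => ?_) ?_
  · split_ifs
    exacts [hx, J.zero_mem]
  · rw [← mul_assoc, D.e_mul_arr]
    simp [Finset.sum_ite_eq']

theorem step_braid_le (a : A)
    (ha : ∀ b, D.src b = D.src a → D.tgt b = D.tgt a → b = a) (J : TwoSidedIdeal R) :
    D.step (D.tgt a) (D.step (D.src a) (D.step (D.tgt a) J)) ≤
      D.step (D.src a) (D.step (D.tgt a) (D.step (D.src a) J)) := by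
  classical
  intro x hx
  have hx1 : x ∈ D.step (D.tgt a) (D.step (D.src a) J) :=
    D.step_mono _ (D.step_mono _ (D.step_le _ _)) hx
  obtain ⟨z, hz, hez, hxz⟩ := D.exists_of_mem_step (D.step_le _ _ hx)
  obtain ⟨y, hy, hey, hzy⟩ := D.exists_of_mem_step (hz a)
  rw [hez] at hzy
  refine D.mem_step_of hx1 (z := fun c =>
    z c - (D.sgn a * D.sgn c) • (D.arr (D.star c) * y (D.star a))) (fun c hc => ?_) ?_
  · by_cases hca : c = a
    · subst hca
      have hsum : z c - (D.sgn c * D.sgn c) • (D.arr (D.star c) * y (D.star c)) =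
          ∑ d with D.src d = D.tgt c, D.arr d * if d = D.star c then 0 else y d := by
        rw [hzy, D.sgn_mul_self, one_smul, sub_eq_iff_eq_add]
        have : D.arr (D.star c) * y (D.star c) =
            ∑ d with D.src d = D.tgt c, D.arr d * if d = D.star c then y d else 0 := by
          simp [Finset.sum_ite_eq', D.src_star]
        rw [this, ← Finset.sum_add_distrib]
        refine Finset.sum_congr rfl fun d _ => ?_
        split_ifs <;> simp
      rw [hsum]
      refine TwoSidedIdeal.sum_mem' _ _ _ fun d hd => ?_
      simp only [Finset.mem_filter, Finset.mem_univ, true_and] at hd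
      rw [← hd]
      refine D.arr_mem_step_src ?_
      split_ifs with hdc
      · exact TwoSidedIdeal.zero_mem _
      · refine D.mem_step_of_e_mul_eq (fun h => hdc ?_) (hy d) (hey d)
        rw [← ha (D.star d) (by rw [D.src_star, h]) (by rw [D.tgt_star, hd]), D.star_star]
    · have hmem : z c - (D.sgn a * D.sgn c) • (D.arr (D.star c) * y (D.star a)) ∈ J :=
        J.sub_mem (D.step_le _ _ (hz c)) (J.zsmul_mem' _ (J.mul_mem_left _ _ (hy _)))
      have he : D.e (D.tgt c) * (z c - (D.sgn a * D.sgn c) •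
          (D.arr (D.star c) * y (D.star a))) =
          z c - (D.sgn a * D.sgn c) • (D.arr (D.star c) * y (D.star a)) := by
        rw [mul_sub, hez, mul_smul_comm, ← mul_assoc, ← D.src_star, D.e_mul_arr]
      refine D.mem_step_of_e_mul_eq (fun h => hca (ha c hc h.symm)) ?_ he
      refine D.mem_step_of_e_mul_eq (fun h => D.src_ne_tgt c (hc.trans h)) hmem he
  · have hmesh := congrArg (fun r => D.sgn a • (r * y (D.star a))) (D.mesh (D.src a))
    simp only [Finset.sum_mul, Finset.smul_sum, zero_mul, smul_zero] at hmesh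
    simp only [mul_sub, Finset.sum_sub_distrib]
    rw [hxz, eq_comm, sub_eq_self, ← hmesh]
    refine Finset.sum_congr rfl fun c _ => ?_
    simp only [mul_smul_comm, smul_mul_assoc, mul_smul, mul_assoc]

theorem step_braid (a : A)
    (ha : ∀ b, D.src b = D.src a → D.tgt b = D.tgt a → b = a) (J : TwoSidedIdeal R) :
    D.step (D.tgt a) (D.step (D.src a) (D.step (D.tgt a) J)) =
      D.step (D.src a) (D.step (D.tgt a) (D.step (D.src a) J)) := by
  refine le_antisymm (D.step_braid_le a ha J) ?_
  have h := D.step_braid_le (D.star a) (fun b hb hb' => ?_) J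
  · rwa [D.src_star, D.tgt_star] at h
  · rw [D.src_star] at hb
    rw [D.tgt_star] at hb'
    rw [← ha (D.star b) (by rw [D.src_star, hb']) (by rw [D.tgt_star, hb]), D.star_star]

/-- An element of `e i R` lies in `J` as soon as all its products with arrows ending at `i` do. -/
def Saturated (i : ι) (J : TwoSidedIdeal R) : Prop :=
  ∀ y, D.e i * y = y → (∀ a, D.src a = i → D.arr (D.star a) * y ∈ J) → y ∈ J

variable {D}

theorem Saturated.exact {i : ι} {J : TwoSidedIdeal R} (h : D.Saturated i J) {z : A → R}
    (hz : ∀ a, D.src a = i → z a ∈ J) (hez : ∀ a, D.e (D.tgt a) * z a = z a)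
    (hsum : ∑ a with D.src a = i, D.arr a * z a = 0) :
    ∃ y ∈ J, D.e i * y = y ∧ ∀ a, D.src a = i → z a = D.sgn a • (D.arr (D.star a) * y) := by
  obtain ⟨y, hy, hzy⟩ := D.exact i z hez hsum
  refine ⟨y, h y hy fun a ha => ?_, hy, hzy⟩
  have := J.zsmul_mem' (D.sgn a) (hz a ha)
  rwa [hzy a ha, smul_smul, D.sgn_mul_self, one_smul] at this

/-- If `arr a * t` has another expression as a combination of arrows out of `i` with coefficients
in `J`, the two expressions differ by a multiple of the mesh relation. -/
theorem Saturated.exact_single {i : ι} {J : TwoSidedIdeal R} (h : D.Saturated i J) [DecidableEq A]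
    {a : A} (ha : D.src a = i) {t : R} (ht : t ∈ J) (het : D.e (D.tgt a) * t = t) {v : A → R}
    (hv : ∀ b, v b ∈ J) (hev : ∀ b, D.e (D.tgt b) * v b = v b)
    (hsum : D.e i * (D.arr a * t) = ∑ b with D.src b = i, D.arr b * v b) :
    ∃ y ∈ J, D.e i * y = y ∧ t = v a + D.sgn a • (D.arr (D.star a) * y) ∧
      ∀ b, D.src b = i → b ≠ a → D.arr (D.star b) * y = -(D.sgn b • v b) := by
  obtain ⟨y, hy, hey, hzy⟩ := h.exact (z := fun b => (if b = a then t else 0) - v b)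
    (fun b _ => J.sub_mem (by split_ifs; exacts [ht, J.zero_mem]) (hv b))
    (fun b => by
      split_ifs with hb
      · subst hb; rw [mul_sub, het, hev]
      · rw [mul_sub, mul_zero, hev])
    (by
      simp only [mul_sub, Finset.sum_sub_distrib]
      rw [← hsum, ← mul_assoc, ← ha, D.e_mul_arr]
      simp)
  refine ⟨y, hy, hey, ?_, fun b hb hba => ?_⟩
  · have := hzy a ha
    rw [if_pos rfl] at this
    rw [← this]; abel
  · have := congrArg (fun r => D.sgn b • r) (hzy b hb)
    simp only [if_neg hba, zero_sub, smul_smul, D.sgn_mul_self, one_smul, smul_neg] at this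
    exact this.symm

end PreprojectiveData

namespace PreprojectiveData

variable {R : Type} [Ring R] {ι A : Type} [DecidableEq ι] [Fintype A]
  {D : PreprojectiveData R ι A}

theorem mem_step_of_e_mul_mem {i : ι} {J : TwoSidedIdeal R} {x : R} (hx : x ∈ J)
    (h : D.e i * x ∈ D.step i J) : x ∈ D.step i J := by
  have hsplit : x = (x - D.e i * x) + D.e i * x := by abel
  rw [hsplit]
  refine (D.step i J).add_mem (D.mem_step_of_e_mul_eq_zero
    (J.sub_mem hx (J.mul_mem_left _ _ hx)) ?_) h
  rw [mul_sub, ← mul_assoc, D.e_mul_self, sub_self]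

variable {M : CoxeterMatrix ι} {W : Type} [Group W]

variable (D) in
/-- A family of ideals indexed by a Coxeter group, built along reduced words. -/
structure IsIdealFamily (cs : CoxeterSystem M W) (F : W → TwoSidedIdeal R) : Prop where
  map_one : F 1 = ⊤
  map_simple_mul : ∀ i w, ¬ cs.IsLeftDescent w i → F (cs.simple i * w) = D.step i (F w)
  eq_two : ∀ i j, i ≠ j → (∀ a, D.src a = i → D.tgt a ≠ j) → M i j = 2
  eq_three : ∀ a, (∀ b, D.src b = D.src a → D.tgt b = D.tgt a → b = a) →
    M (D.src a) (D.tgt a) = 3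

variable (D) in
/-- Multiplication by `arr a` detects membership in `step (tgt a) J`. -/
def Detects (a : A) (J : TwoSidedIdeal R) : Prop :=
  ∀ t ∈ J, D.e (D.tgt a) * t = t → D.arr a * t ∈ D.step (D.src a) (D.step (D.tgt a) J) →
    t ∈ D.step (D.tgt a) J

end PreprojectiveData

namespace CoxeterSystem

variable {B W : Type*} [Group W] {M : CoxeterMatrix B} (cs : CoxeterSystem M W)

theorem exists_eq_simple_mul {w : W} {i : B} (h : cs.IsLeftDescent w i) :
    ∃ u, w = cs.simple i * u ∧ ¬ cs.IsLeftDescent u i ∧ cs.length w = cs.length u + 1 := by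
  have h1 := cs.isLeftDescent_iff.1 h
  refine ⟨cs.simple i * w, by simp, ?_, h1.symm⟩
  rw [not_isLeftDescent_iff, simple_mul_simple_cancel_left, h1]

theorem ne_of_not_isLeftDescent_simple_mul {i j : B} {u : W} (hj : ¬ cs.IsLeftDescent u j)
    (hi : ¬ cs.IsLeftDescent (cs.simple j * u) i) : i ≠ j := by
  rintro rfl
  rw [not_isLeftDescent_iff] at hi hj
  rw [simple_mul_simple_cancel_left] at hi
  omega

theorem ne_two_of_not_isLeftDescent {i j : B} {u : W}
    (hj : ¬ cs.IsLeftDescent (cs.simple i * u) j) (hiu : ¬ cs.IsLeftDescent u i)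
    (hi : ¬ cs.IsLeftDescent (cs.simple j * (cs.simple i * u)) i) : M i j ≠ 2 := by
  intro h
  rw [not_isLeftDescent_iff] at hi hj hiu
  rw [← cs.simple_commute_of_eq_two h] at hi hj
  rw [simple_mul_simple_cancel_left] at hi
  have := cs.length_mul_le (cs.simple j) u
  rw [length_simple] at this
  omega

theorem ne_three_of_not_isLeftDescent {i j : B} {u : W}
    (hj : ¬ cs.IsLeftDescent (cs.simple i * u) j) (hiu : ¬ cs.IsLeftDescent u i)
    (hi : ¬ cs.IsLeftDescent (cs.simple j * (cs.simple i * u)) i)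
    (hju : cs.IsLeftDescent u j) : M i j ≠ 3 := by
  intro h
  obtain ⟨x, rfl, -, hx⟩ := cs.exists_eq_simple_mul hju
  rw [not_isLeftDescent_iff] at hi hj hiu
  rw [← cs.simple_braid_of_eq_three h, simple_mul_simple_cancel_left,
    cs.simple_braid_of_eq_three h] at hi
  have h1 := cs.length_mul_le (cs.simple j) (cs.simple i * x)
  have h2 := cs.length_mul_le (cs.simple i) x
  rw [length_simple] at h1 h2
  omega

end CoxeterSystem

namespace PreprojectiveData.IsIdealFamily

variable {R : Type} [Ring R] {ι A : Type} [DecidableEq ι] [Fintype A]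
  {D : PreprojectiveData R ι A} {M : CoxeterMatrix ι} {W : Type} [Group W]
  {cs : CoxeterSystem M W} {F : W → TwoSidedIdeal R}

theorem exists_of_isLeftDescent (hF : D.IsIdealFamily cs F) {i j : ι} {u : W}
    (hj : ¬ cs.IsLeftDescent u j)
    (hi : ¬ cs.IsLeftDescent (cs.simple j * u) i) (hiu : cs.IsLeftDescent u i) :
    ∃ v, u = cs.simple i * v ∧ ¬ cs.IsLeftDescent v i ∧ cs.length u = cs.length v + 1 ∧
      F u = D.step i (F v) ∧ (∃ a, D.src a = i ∧ D.tgt a = j) ∧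
      ∀ a, D.src a = i → D.tgt a = j →
        (∃ b, b ≠ a ∧ D.src b = D.src a ∧ D.tgt b = D.tgt a) ∨ ¬ cs.IsLeftDescent v j := by
  obtain ⟨v, rfl, hv, hlen⟩ := cs.exists_eq_simple_mul hiu
  refine ⟨v, rfl, hv, hlen, hF.map_simple_mul _ _ hv, ?_, ?_⟩
  · by_contra hno
    exact cs.ne_two_of_not_isLeftDescent hj hv hi
      (hF.eq_two i j (cs.ne_of_not_isLeftDescent_simple_mul hj hi)
        fun a h1 h2 => hno ⟨a, h1, h2⟩)
  · rintro a rfl rfl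
    by_contra! hno
    exact cs.ne_three_of_not_isLeftDescent hj hv hi hno.2
      (hF.eq_three a fun b h1 h2 => by_contra fun hb => hno.1 b hb h1 h2)

theorem saturated_and_detects (hF : D.IsIdealFamily cs F) (n : ℕ) :
    (∀ w i, cs.length w = n → ¬ cs.IsLeftDescent w i → D.Saturated i (F w)) ∧
    ∀ u a, cs.length u = n → ¬ cs.IsLeftDescent u (D.tgt a) →
      ¬ cs.IsLeftDescent (cs.simple (D.tgt a) * u) (D.src a) →
      ((∃ b, b ≠ a ∧ D.src b = D.src a ∧ D.tgt b = D.tgt a) ∨ ¬ cs.IsLeftDescent u (D.src a)) →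
      D.Detects a (F u) := by
  classical
  induction n using Nat.strong_induction_on with
  | _ n ih =>
  have hsat : ∀ w i, cs.length w = n → ¬ cs.IsLeftDescent w i → D.Saturated i (F w) := by
    intro w i hw hi
    by_cases hw1 : w = 1
    · subst hw1
      intro y _ _
      rw [hF.map_one]
      exact TwoSidedIdeal.mem_top _
    obtain ⟨j, hj⟩ := cs.exists_leftDescent_of_ne_one hw1
    obtain ⟨u, rfl, huj, hlen⟩ := cs.exists_eq_simple_mul hj
    have hij := cs.ne_of_not_isLeftDescent_simple_mul huj hi
    rw [hF.map_simple_mul _ _ huj]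
    intro y hey hy
    refine D.mem_step_of_e_mul_eq hij.symm ?_ hey
    by_cases hiu : cs.IsLeftDescent u i
    · obtain ⟨v, huv, hvi, hlv, hFu, ⟨a, rfl, rfl⟩, hpar⟩ :=
        hF.exists_of_isLeftDescent huj hi hiu
      rw [hFu] at hy ⊢
      have hyv : y ∈ F v := (ih _ (by omega)).1 v _ rfl hvi y hey fun b hb =>
        D.step_le _ _ (D.step_le _ _ (hy b hb))
      have hdet := (ih _ (by omega)).2 v (D.star a) rfl (by rwa [D.tgt_star])
        (by rw [D.tgt_star, D.src_star, ← huv]; exact huj)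
        (by
          rw [D.src_star, D.tgt_star]
          refine (hpar a rfl rfl).imp ?_ id
          rintro ⟨b, hba, h1, h2⟩
          refine ⟨D.star b, fun h => hba ?_, by rw [D.src_star, h2], by rw [D.tgt_star, h1]⟩
          rw [← D.star_star b, h, D.star_star])
      have := hdet y hyv (by rwa [D.tgt_star])
        (by rw [D.tgt_star, D.src_star]; exact hy a rfl)
      rwa [D.tgt_star] at this
    · exact (ih _ (by omega)).1 u i rfl hiu y hey fun b hb => D.step_le _ _ (hy b hb)
  refine ⟨hsat, fun u a hu hj hi hpar t ht het hat => ?_⟩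
  obtain ⟨v, hv, hev, hsum⟩ := D.exists_of_mem_step hat
  suffices h : ∃ y ∈ F u, t = v a + D.sgn a • (D.arr (D.star a) * y) by
    obtain ⟨y, hy, rfl⟩ := h
    refine TwoSidedIdeal.add_mem _ (hv a) (TwoSidedIdeal.zsmul_mem' _ _ ?_)
    have := D.arr_mem_step_src (a := D.star a) hy
    rwa [D.src_star] at this
  by_cases hiu : cs.IsLeftDescent u (D.src a)
  · obtain ⟨u', huv, hvi, hlv, hFu, -, -⟩ := hF.exists_of_isLeftDescent hj hi hiu
    obtain ⟨b, hba, hb1, hb2⟩ := hpar.resolve_right (not_not.2 hiu)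
    have hle : F u ≤ F u' := by rw [hFu]; exact D.step_le _ _
    obtain ⟨y, hy, hey, hta, hyb⟩ := ((ih _ (by omega)).1 u' _ rfl hvi).exact_single rfl (hle ht)
      het (fun c => hle (D.step_le _ _ (hv c))) hev hsum
    refine ⟨y, ?_, hta⟩
    have hdet := (ih _ (by omega)).2 u' (D.star b) rfl (by rwa [D.tgt_star, hb1])
        (by rw [D.tgt_star, D.src_star, hb1, hb2, ← huv]; exact hj)
        (Or.inl ⟨D.star a, fun h => hba (by rw [← D.star_star b, ← h, D.star_star]),
          by rw [D.src_star, D.src_star, hb2], by rw [D.tgt_star, D.tgt_star, hb1]⟩)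
    have := hdet y hy (by rwa [D.tgt_star, hb1])
      (by
        rw [hyb b hb1 hba, D.tgt_star, D.src_star, hb1, hb2, ← hFu]
        exact TwoSidedIdeal.neg_mem _ (TwoSidedIdeal.zsmul_mem' _ _ (hv b)))
    rwa [D.tgt_star, hb1, ← hFu] at this
  · obtain ⟨y, hy, -, hta, -⟩ := (hsat u _ hu hiu).exact_single rfl ht het
      (fun c => D.step_le _ _ (hv c)) hev hsum
    exact ⟨y, hy, hta⟩

theorem saturated (hF : D.IsIdealFamily cs F) {w : W} {i : ι} (h : ¬ cs.IsLeftDescent w i)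
    : D.Saturated i (F w) :=
  (hF.saturated_and_detects _).1 w i rfl h

theorem not_le_step (hF : D.IsIdealFamily cs F) {w : W} {i : ι} (h : ¬ cs.IsLeftDescent w i)
    : ¬ F w ≤ D.step i (F w) := by
  classical
  induction hn : cs.length w using Nat.strong_induction_on generalizing w i with
  | _ n ih =>
  intro hle
  by_cases hw1 : w = 1
  · subst hw1
    rw [hF.map_one] at hle
    obtain ⟨z, -, -, hz⟩ := D.exists_of_mem_step (hle (TwoSidedIdeal.mem_top R (x := D.e i)))
    rw [D.e_mul_self] at hz
    exact D.e_ne_sum i z hz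
  obtain ⟨j, hj⟩ := cs.exists_leftDescent_of_ne_one hw1
  obtain ⟨u, rfl, huj, hlen⟩ := cs.exists_eq_simple_mul hj
  have hij := cs.ne_of_not_isLeftDescent_simple_mul huj h
  have hFw := hF.map_simple_mul _ _ huj
  by_cases hiu : cs.IsLeftDescent u i
  · obtain ⟨v, huv, hvi, hlv, hFu, ⟨a, rfl, rfl⟩, hpar⟩ :=
      hF.exists_of_isLeftDescent huj h hiu
    have hle' : F (cs.simple (D.tgt a) * u) ≤ F v := by
      rw [hFw, hFu]; exact (D.step_le _ _).trans (D.step_le _ _)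
    have key : ∀ z ∈ F v, D.e (D.tgt a) * z = z → ∃ c : A → R,
        (∀ b, c b ∈ F (cs.simple (D.tgt a) * u)) ∧ ∃ y ∈ F v, D.e (D.src a) * y = y ∧
          z = c a + D.sgn a • (D.arr (D.star a) * y) ∧
          ∀ b, D.src b = D.src a → b ≠ a → D.arr (D.star b) * y = -(D.sgn b • c b) := by
      intro z hz hez
      have hmem : D.arr a * z ∈ F (cs.simple (D.tgt a) * u) := by
        rw [hFw, hFu]
        exact D.mem_step_of_e_mul_eq (D.src_ne_tgt a).symm (D.arr_mem_step_src hz)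
          (by rw [← mul_assoc, D.e_mul_arr])
      obtain ⟨c, hc, hec, hsum⟩ := D.exists_of_mem_step (hle hmem)
      exact ⟨c, hc, (hF.saturated hvi).exact_single rfl hz hez (fun b => hle' (hc b)) hec hsum⟩
    have hstar : ∀ {y J}, y ∈ J → D.sgn a • (D.arr (D.star a) * y) ∈ D.step (D.tgt a) J := by
      intro y J hy
      have := D.arr_mem_step_src (a := D.star a) hy
      rw [D.src_star] at this
      exact TwoSidedIdeal.zsmul_mem' _ _ this
    have hee : ∀ x, D.e (D.tgt a) * (D.e (D.tgt a) * x) = D.e (D.tgt a) * x := fun x => by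
      rw [← mul_assoc, D.e_mul_self]
    by_cases hvj : cs.IsLeftDescent v (D.tgt a)
    · obtain ⟨b, hba, hb1, hb2⟩ := (hpar a rfl rfl).resolve_right (not_not.2 hvj)
      have hdet := (hF.saturated_and_detects _).2 v (D.star b) rfl (by rwa [D.tgt_star, hb1])
        (by rw [D.tgt_star, D.src_star, hb1, hb2, ← huv]; exact huj)
        (Or.inl ⟨D.star a, fun h => hba (by rw [← D.star_star b, ← h, D.star_star]),
          by rw [D.src_star, D.src_star, hb2], by rw [D.tgt_star, D.tgt_star, hb1]⟩)
      refine ih _ (by omega) huj rfl fun x hx => mem_step_of_e_mul_mem hx ?_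
      have hxv : x ∈ F v := by rw [hFu] at hx; exact D.step_le _ _ hx
      obtain ⟨c, hc, y, hy, hey, hxc, hyb⟩ := key _ ((F v).mul_mem_left (D.e (D.tgt a)) _ hxv)
        (hee x)
      rw [hxc]
      refine TwoSidedIdeal.add_mem _ (hFw ▸ hc a) (hstar ?_)
      have := hdet y hy (by rwa [D.tgt_star, hb1])
        (by
          rw [hyb b hb1 hba, D.tgt_star, D.src_star, hb1, hb2, ← hFu, ← hFw]
          exact TwoSidedIdeal.neg_mem _ (TwoSidedIdeal.zsmul_mem' _ _ (hc b)))
      rwa [D.tgt_star, hb1, ← hFu] at this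
    · refine ih _ (by omega) hvj rfl fun x hx => mem_step_of_e_mul_mem hx ?_
      obtain ⟨c, hc, y, hy, -, hxc, -⟩ := key _ ((F v).mul_mem_left (D.e (D.tgt a)) _ hx) (hee x)
      rw [hxc]
      refine TwoSidedIdeal.add_mem _ ?_ (hstar hy)
      have := hc a
      rw [hFw, hFu] at this
      exact D.step_mono _ (D.step_le _ _) this
  · refine ih _ (by omega) hiu rfl fun x hx => mem_step_of_e_mul_mem hx ?_
    have hmem : D.e i * x ∈ F (cs.simple j * u) := by
      rw [hFw]
      exact D.mem_step_of_e_mul_eq hij.symm ((F u).mul_mem_left _ _ hx)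
        (by rw [← mul_assoc, D.e_mul_self])
    refine D.step_mono i ?_ (hle hmem)
    rw [hFw]
    exact D.step_le _ _

theorem step_eq_self (hF : D.IsIdealFamily cs F) {w : W} {i : ι} (h : cs.IsLeftDescent w i)
    : D.step i (F w) = F w := by
  obtain ⟨u, rfl, hu, -⟩ := cs.exists_eq_simple_mul h
  rw [hF.map_simple_mul _ _ hu, D.step_step_self]

theorem isLeftDescent_iff (hF : D.IsIdealFamily cs F) {w : W} {i : ι}
    : cs.IsLeftDescent w i ↔ D.step i (F w) = F w :=
  ⟨hF.step_eq_self, fun h => by_contra fun hd => hF.not_le_step hd h.ge⟩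

theorem le_of_step_le (hF : D.IsIdealFamily cs F) {u v : W} {i : ι} (hv : ¬ cs.IsLeftDescent v i)
    (h : D.step i (F u) ≤ D.step i (F v)) : F u ≤ F v := by
  intro x hx
  have hsplit : x = (x - D.e i * x) + D.e i * x := by abel
  rw [hsplit]
  refine (F v).add_mem (D.step_le i _ (h (D.mem_step_of_e_mul_eq_zero
    ((F u).sub_mem hx ((F u).mul_mem_left _ _ hx)) ?_))) ?_
  · rw [mul_sub, ← mul_assoc, D.e_mul_self, sub_self]
  · refine hF.saturated hv _ (by rw [← mul_assoc, D.e_mul_self]) fun a ha => ?_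
    refine D.step_le i _ (h ?_)
    have := D.arr_mem_step (a := D.star a) ((F u).mul_mem_left (D.e i) _ hx)
    rwa [D.tgt_star, ha] at this

theorem injective (hF : D.IsIdealFamily cs F) : Function.Injective F := by
  intro w v hwv
  induction hn : cs.length w generalizing w v with
  | zero =>
    have hw := cs.length_eq_zero_iff.1 hn
    by_contra hne
    obtain ⟨i, hi⟩ := cs.exists_leftDescent_of_ne_one (w := v) (fun h => hne (hw.trans h.symm))
    rw [hF.isLeftDescent_iff, ← hwv, ← hF.isLeftDescent_iff] at hi
    unfold CoxeterSystem.IsLeftDescent at hi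
    omega
  | succ n ih =>
    have hw1 : w ≠ 1 := by rintro rfl; simp at hn
    obtain ⟨i, hi⟩ := cs.exists_leftDescent_of_ne_one hw1
    have hi' := hi
    rw [hF.isLeftDescent_iff, hwv, ← hF.isLeftDescent_iff] at hi'
    obtain ⟨u, rfl, hu, hlu⟩ := cs.exists_eq_simple_mul hi
    obtain ⟨u', rfl, hu', -⟩ := cs.exists_eq_simple_mul hi'
    rw [hF.map_simple_mul _ _ hu, hF.map_simple_mul _ _ hu'] at hwv
    rw [ih (le_antisymm (hF.le_of_step_le hu' hwv.le) (hF.le_of_step_le hu hwv.ge)) (by omega)]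

end PreprojectiveData.IsIdealFamily

namespace PreE

variable {K : Type} [Field K] {ι : Type} [Fintype ι] [LinearOrder ι] {m : ι → ι → ℕ}

/-- Taking a coefficient, as an additive homomorphism. -/
def coeffHom (i k : ι) (p : Pth m i k) : PreE K m →+ K where
  toFun f := f.coeff i k p
  map_zero' := rfl
  map_add' _ _ := rfl

theorem coeffHom_apply (i k : ι) (p : Pth m i k) (f : PreE K m) :
    coeffHom i k p f = f.coeff i k p := rfl

theorem ext_coeffHom {f g : PreE K m} (h : ∀ i k p, coeffHom i k p f = coeffHom i k p g) :
    f = g := by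
  ext i k p
  exact h i k p

theorem coeffHom_mul_nil (f g : PreE K m) (i : ι) :
    coeffHom i i (.nil i) (f * g) = coeffHom i i (.nil i) f * coeffHom i i (.nil i) g := rfl

/-- Scalars in the complete path algebra. -/
def scal (m : ι → ι → ℕ) (c : K) : PreE K m :=
  ⟨fun _ _ q => match q with
    | .nil _ => c
    | .cons _ _ => 0⟩

theorem coeffHom_scal_mul (c : K) (f : PreE K m) {i k : ι} (p : Pth m i k) :
    coeffHom i k p (scal m c * f) = c * coeffHom i k p f := by
  cases p with
  | nil => rfl
  | cons a p =>
    change c * f.coeff i k (.cons a p) + go f.coeff _ (fun _ _ => 0) k p = _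
    rw [go_zeroF, add_zero]
    rfl

theorem coeffHom_mul_scal (c : K) (f : PreE K m) {i k : ι} (p : Pth m i k) :
    coeffHom i k p (f * scal m c) = coeffHom i k p f * c := by
  change go (scal m c).coeff i (f.coeff i) k p = f.coeff i k p * c
  have key : ∀ {i k : ι} (F : ∀ j, Pth m i j → K) (p : Pth m i k),
      go (scal m c).coeff i F k p = F k p * c := by
    intro i k F p
    induction p with
    | nil => rfl
    | cons a p ih =>
      change F _ _ * 0 + go (scal m c).coeff _ _ _ p = _
      rw [ih, mul_zero, zero_add]
  exact key _ p

theorem scal_mul_comm (c : K) (f : PreE K m) : scal m c * f = f * scal m c :=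
  ext_coeffHom fun i k p => by rw [coeffHom_scal_mul, coeffHom_mul_scal, mul_comm]

/-- The arrows of the double quiver. -/
abbrev Arrow (m : ι → ι → ℕ) : Type := (i : ι) × (j : ι) × Fin (m i j)

/-- The idempotent at a vertex of the complete path algebra. -/
def idem (K : Type) [Field K] (m : ι → ι → ℕ) (i : ι) : PreE K m :=
  ⟨fun _ _ p => match p with
    | .nil v => if v = i then (1 : K) else 0
    | .cons _ _ => 0⟩

theorem coeffHom_idem_mul (i : ι) (f : PreE K m) {i' k : ι} (p : Pth m i' k) :
    coeffHom i' k p (idem K m i * f) = if i' = i then coeffHom i' k p f else 0 := by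
  cases p with
  | nil =>
    change (if i' = i then (1 : K) else 0) * f.coeff i' i' (.nil i') = _
    split_ifs <;> simp [coeffHom_apply]
  | cons a p =>
    change (if i' = i then (1 : K) else 0) * f.coeff i' k (.cons a p) +
      go f.coeff _ (fun _ _ => 0) k p = _
    rw [go_zeroF, add_zero]
    split_ifs <;> simp [coeffHom_apply]

/-- An arrow, as an element of the complete path algebra. -/
def ofArrow (K : Type) [Field K] {m : ι → ι → ℕ} (a : Arrow m) : PreE K m :=
  ⟨fun i _ p => match p with
    | .nil _ => 0
    | .cons (j := j) b q => match q with
      | .nil _ => if (⟨i, j, b⟩ : Arrow m) = a then 1 else 0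
      | .cons _ _ => 0⟩

theorem coeffHom_ofArrow_mul_nil (a : Arrow m) (f : PreE K m) (i : ι) :
    coeffHom i i (.nil i) (ofArrow K a * f) = 0 :=
  zero_mul _

theorem coeffHom_ofArrow_mul_cons (a : Arrow m) (f : PreE K m) {i j k : ι} (b : Fin (m i j))
    (p : Pth m j k) : coeffHom i k (.cons b p) (ofArrow K a * f) =
      if (⟨i, j, b⟩ : Arrow m) = a then coeffHom j k p f else 0 := by
  change 0 * _ + go f.coeff j (fun j' q => (ofArrow K a).coeff i j' (.cons b q)) k p = _
  rw [zero_mul, zero_add]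
  split_ifs with h
  · rw [go_congrF f.coeff (F' := fun j' q => (1 : PreE K m).coeff j j' q)]
    · exact go_oneF f.coeff p
    · intro j' q
      cases q with
      | nil => exact if_pos h
      | cons => rfl
  · rw [go_congrF f.coeff (F' := fun _ _ => 0), go_zeroF]
    intro j' q
    cases q with
    | nil => exact if_neg h
    | cons => rfl

theorem coeffHom_ofArrow_mul (a : Arrow m) (f : PreE K m) {k : ι} (p : Pth m a.2.1 k) :
    coeffHom a.1 k (.cons a.2.2 p) (ofArrow K a * f) = coeffHom a.2.1 k p f := by
  rw [coeffHom_ofArrow_mul_cons, if_pos rfl]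

/-- Removal of the leading arrow `a`. -/
def tail (a : Arrow m) (f : PreE K m) : PreE K m :=
  ⟨fun i k p => if h : a.2.1 = i then f.coeff a.1 k (.cons a.2.2 (h ▸ p)) else 0⟩

theorem coeffHom_tail (a : Arrow m) (f : PreE K m) {k : ι} (p : Pth m a.2.1 k) :
    coeffHom a.2.1 k p (tail a f) = coeffHom a.1 k (.cons a.2.2 p) f :=
  dif_pos rfl

theorem coeffHom_tail_of_ne (a : Arrow m) (f : PreE K m) {i k : ι} (h : a.2.1 ≠ i)
    (p : Pth m i k) : coeffHom i k p (tail a f) = 0 :=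
  dif_neg h

theorem ext_tail {a : Arrow m} {f g : PreE K m}
    (h : ∀ k (p : Pth m a.2.1 k), coeffHom a.1 k (.cons a.2.2 p) f = coeffHom a.2.1 k p g)
    (hg : ∀ i k (p : Pth m i k), a.2.1 ≠ i → coeffHom i k p g = 0) : tail a f = g := by
  refine ext_coeffHom fun i k p => ?_
  by_cases hi : a.2.1 = i
  · subst hi
    rw [coeffHom_tail, h]
  · rw [coeffHom_tail_of_ne _ _ hi, hg _ _ _ hi]

theorem tail_add (a : Arrow m) (f g : PreE K m) : tail a (f + g) = tail a f + tail a g := by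
  refine ext_tail (fun k p => ?_) fun i k p hi => ?_
  · simp [coeffHom_tail]
  · simp [coeffHom_tail_of_ne _ _ hi]

theorem tail_neg (a : Arrow m) (f : PreE K m) : tail a (-f) = -tail a f := by
  refine ext_tail (fun k p => ?_) fun i k p hi => ?_
  · simp [coeffHom_tail]
  · simp [coeffHom_tail_of_ne _ _ hi]

theorem tail_mul (a : Arrow m) (f g : PreE K m) :
    tail a (f * g) = tail a f * g + scal m (coeffHom a.1 a.1 (.nil a.1) f) * tail a g := by
  have hcoeff : ∀ i, a.2.1 ≠ i → (tail a f).coeff i = fun _ _ => 0 := fun i hi =>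
    funext fun k => funext fun p => coeffHom_tail_of_ne a f hi p
  refine ext_tail (fun k p => ?_) fun i k p hi => ?_
  · rw [map_add, coeffHom_scal_mul, coeffHom_tail, add_comm]
    change _ + go _ _ _ _ _ = _ + go _ _ ((tail a f).coeff a.2.1) _ _
    congr 2
    funext j q
    exact (coeffHom_tail a f q).symm
  · rw [map_add, coeffHom_scal_mul, coeffHom_tail_of_ne _ _ hi, mul_zero, add_zero]
    change go _ _ ((tail a f).coeff i) _ _ = 0
    rw [hcoeff i hi, go_zeroF]

theorem idem_mul_eq (i : ι) (f : PreE K m) :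
    idem K m i * f = scal m (coeffHom i i (.nil i) f) * idem K m i +
      ∑ a : Arrow m with a.1 = i, ofArrow K a * tail a f := by
  refine ext_coeffHom fun i' k p => ?_
  rw [coeffHom_idem_mul, map_add, map_sum, coeffHom_scal_mul]
  cases p with
  | nil =>
    simp only [coeffHom_ofArrow_mul_nil, Finset.sum_const_zero, add_zero]
    change _ = _ * (if i' = i then (1 : K) else 0)
    split_ifs with h
    · subst h; simp
    · simp
  | cons b p =>
    rename_i j
    simp only [coeffHom_ofArrow_mul_cons, Finset.sum_filter]
    change _ = _ * (0 : K) + _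
    rw [mul_zero, zero_add, Finset.sum_eq_single_of_mem (⟨i', j, b⟩ : Arrow m) (Finset.mem_univ _)]
    · simp only [if_true]
      split_ifs
      · exact (coeffHom_tail (⟨i', j, b⟩ : Arrow m) f p).symm
      · rfl
    · intro a _ ha
      simp [ha.symm]

theorem tail_sum_ofArrow_mul {i : ι} (X : Arrow m → PreE K m) {a : Arrow m} (ha : a.1 = i) :
    tail a (∑ b : Arrow m with b.1 = i, ofArrow K b * X b) = idem K m a.2.1 * X a := by
  refine ext_tail (fun k p => ?_) fun i k p hi => ?_
  · rw [coeffHom_idem_mul, if_pos rfl, map_sum, Finset.sum_eq_single_of_mem a (by simp [ha])]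
    · rw [coeffHom_ofArrow_mul]
    · intro b _ hb
      rw [coeffHom_ofArrow_mul_cons, if_neg hb.symm]
  · rw [coeffHom_idem_mul, if_neg hi.symm]

/-- The homogeneous component of degree `n`. -/
def hom (n : ℕ) (f : PreE K m) : PreE K m :=
  ⟨fun i k p => if p.len = n then f.coeff i k p else 0⟩

theorem coeffHom_hom (n : ℕ) (f : PreE K m) {i k : ι} (p : Pth m i k) :
    coeffHom i k p (hom n f) = if p.len = n then coeffHom i k p f else 0 := rfl

theorem hom_add (n : ℕ) (f g : PreE K m) : hom n (f + g) = hom n f + hom n g := by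
  refine ext_coeffHom fun i k p => ?_
  simp only [map_add, coeffHom_hom]
  split_ifs <;> simp

theorem hom_neg (n : ℕ) (f : PreE K m) : hom n (-f) = -hom n f := by
  refine ext_coeffHom fun i k p => ?_
  simp only [map_neg, coeffHom_hom]
  split_ifs <;> simp

theorem hom_zero (n : ℕ) : hom n (0 : PreE K m) = 0 := by
  refine ext_coeffHom fun i k p => ?_
  simp [coeffHom_hom]

theorem hom_hom (n k : ℕ) (f : PreE K m) : hom n (hom k f) = if n = k then hom n f else 0 := by
  refine ext_coeffHom fun i j p => ?_
  split_ifs with h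
  · subst h
    simp only [coeffHom_hom]
    split_ifs <;> rfl
  · simp only [coeffHom_hom, map_zero]
    split_ifs <;> first | rfl | omega

theorem go_hom (n : ℕ) (g : ∀ i j : ι, Pth m i j → K) {i k : ι} (F : ∀ j, Pth m i j → K)
    (p : Pth m i k) :
    ∑ x ∈ Finset.HasAntidiagonal.antidiagonal n,
      go (fun i j q => if q.len = x.2 then g i j q else 0) i
        (fun j q => if q.len = x.1 then F j q else 0) k p =
      if p.len = n then go g i F k p else 0 := by
  induction p generalizing n with
  | nil i =>
    have h0 : (Pth.nil (m := m) i).len = 0 := rfl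
    simp only [go]
    cases n with
    | zero => simp [h0]
    | succ n =>
      rw [if_neg (by omega)]
      refine Finset.sum_eq_zero fun x hx => ?_
      rw [Finset.HasAntidiagonal.mem_antidiagonal] at hx
      by_cases h : (Pth.nil (m := m) i).len = x.1
      · rw [if_neg (show ¬ (Pth.nil (m := m) i).len = x.2 by omega), mul_zero]
      · rw [if_neg h, zero_mul]
  | cons a p ih =>
    simp only [go, Pth.len, Finset.sum_add_distrib]
    cases n with
    | zero => simp [go_zeroF]
    | succ n =>
      simp only [Finset.Nat.sum_antidiagonal_succ, Nat.add_right_cancel_iff, ih]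
      simp [go_zeroF]
      split_ifs <;> simp

theorem hom_mul (n : ℕ) (f g : PreE K m) :
    hom n (f * g) = ∑ x ∈ Finset.HasAntidiagonal.antidiagonal n, hom x.1 f * hom x.2 g := by
  refine ext_coeffHom fun i k p => ?_
  rw [map_sum, coeffHom_hom]
  exact (go_hom n g.coeff (f.coeff i) p).symm

end PreE

namespace PreE

variable {K : Type} [Field K] {ι : Type} [Fintype ι] [LinearOrder ι] {m : ι → ι → ℕ}

/-- The dual of an arrow. -/
def Arrow.star (hsymm : ∀ i j, m i j = m j i) (a : Arrow m) : Arrow m :=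
  ⟨a.2.1, a.1, Fin.cast (hsymm _ _) a.2.2⟩

/-- The sign of an arrow in the preprojective relation. -/
def Arrow.sgn (a : Arrow m) : ℤ := if a.1 < a.2.1 then 1 else -1

/-- The closure of the preprojective ideal, as a two-sided ideal. -/
def relClosureIdeal (K : Type) [Field K] (m : ι → ι → ℕ) : TwoSidedIdeal (PreE K m) :=
  TwoSidedIdeal.mk' {f | ∀ n, hom n f ∈ relIdeal K m}
    (fun n => by rw [hom_zero]; exact TwoSidedIdeal.zero_mem _)
    (fun hx hy n => by rw [hom_add]; exact TwoSidedIdeal.add_mem _ (hx n) (hy n))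
    (fun hx n => by rw [hom_neg]; exact TwoSidedIdeal.neg_mem _ (hx n))
    (fun hy n => by
      rw [hom_mul]
      exact TwoSidedIdeal.sum_mem' _ _ _ fun x _ => TwoSidedIdeal.mul_mem_left _ _ _ (hy _))
    (fun hx n => by
      rw [hom_mul]
      exact TwoSidedIdeal.sum_mem' _ _ _ fun x _ => TwoSidedIdeal.mul_mem_right _ _ _ (hx _))

theorem mem_relClosureIdeal {f : PreE K m} :
    f ∈ relClosureIdeal K m ↔ ∀ n, hom n f ∈ relIdeal K m :=
  TwoSidedIdeal.mem_mk' ..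

theorem hom_rho (n : ℕ) : hom n (rho K m) = if n = 2 then rho K m else 0 := by
  refine ext_coeffHom fun i k p => ?_
  rw [coeffHom_hom, apply_ite (coeffHom i k p), map_zero]
  match p with
  | .nil _ => split_ifs <;> rfl
  | .cons a (.nil _) => split_ifs <;> rfl
  | .cons a (.cons b (.nil _)) => simp only [Pth.len, zero_add, Nat.reduceAdd, eq_comm (a := 2)]
  | .cons a (.cons b (.cons c p)) => split_ifs <;> rfl

theorem relIdeal_le_relClosureIdeal : relIdeal K m ≤ relClosureIdeal K m := by
  rw [relIdeal, TwoSidedIdeal.span_le, Set.singleton_subset_iff]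
  refine mem_relClosureIdeal.2 fun n => ?_
  rw [hom_rho]
  split_ifs
  · exact TwoSidedIdeal.subset_span rfl
  · exact TwoSidedIdeal.zero_mem _

theorem hom_mem_relIdeal {f : PreE K m} (hf : f ∈ relIdeal K m) (n : ℕ) :
    hom n f ∈ relIdeal K m :=
  mem_relClosureIdeal.1 (relIdeal_le_relClosureIdeal hf) n

theorem coeffHom_sum_hom (f : PreE K m) {n : ℕ} {i k : ι} (p : Pth m i k) (hp : p.len < n) :
    coeffHom i k p (∑ d ∈ Finset.range n, hom d f) = coeffHom i k p f := by
  simp only [map_sum, coeffHom_hom, Finset.sum_ite_eq, Finset.mem_range, hp, if_true]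

theorem mem_relClosure_iff {f : PreE K m} :
    f ∈ relClosure K m ↔ ∀ n, hom n f ∈ relIdeal K m := by
  constructor
  · intro hf n
    obtain ⟨g, hg, hfg⟩ := hf (n + 1)
    have : hom n f = hom n g := by
      refine ext_coeffHom fun i k p => ?_
      rw [coeffHom_hom, coeffHom_hom]
      split_ifs with h
      · exact hfg i k p (by omega)
      · rfl
    rw [this]
    exact hom_mem_relIdeal hg n
  · intro hf n
    exact ⟨∑ d ∈ Finset.range n, hom d f, TwoSidedIdeal.sum_mem' _ _ _ fun d _ => hf d,
      fun i k p hp => (coeffHom_sum_hom f p hp).symm⟩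

theorem ppCon_iff {x y : PreE K m} : ppCon K m x y ↔ x - y ∈ relClosureIdeal K m := by
  constructor
  · intro h
    have hle : ppCon K m ≤ (relClosureIdeal K m).ringCon := by
      refine RingCon.ringConGen_le.2 fun a b hab => ?_
      rw [TwoSidedIdeal.rel_iff, mem_relClosureIdeal]
      exact mem_relClosure_iff.1 hab
    have := hle h
    rwa [TwoSidedIdeal.rel_iff] at this
  · intro h
    refine RingConGen.Rel.of _ _ ?_
    exact mem_relClosure_iff.2 (mem_relClosureIdeal.1 h)

theorem tail_rho (hsymm : ∀ i j, m i j = m j i) (a : Arrow m) :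
    tail a (rho K m) = a.sgn • ofArrow K (a.star hsymm) := by
  refine ext_tail (fun k p => ?_) fun i k p hi => ?_
  · rw [map_zsmul]
    match p with
    | .nil _ => simp [coeffHom_apply, rho, ofArrow]
    | .cons b (.nil _) =>
      obtain ⟨i, j, a⟩ := a
      simp only [coeffHom_apply, rho, ofArrow, Arrow.star, Arrow.sgn]
      by_cases hk : k = i
      · subst hk
        simp [Fin.ext_iff, eq_comm (a := a.val)]
      · simp [hk]
    | .cons b (.cons c p) => simp [coeffHom_apply, rho, ofArrow]
  · rw [map_zsmul]
    match p with
    | .nil _ => simp [coeffHom_apply, ofArrow]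
    | .cons b (.nil _) =>
      have : ¬ ((⟨i, k, b⟩ : Arrow m) = a.star hsymm) := fun h => hi (congrArg Sigma.fst h).symm
      simp [coeffHom_apply, ofArrow, this]
    | .cons b (.cons c p) => simp [coeffHom_apply, ofArrow]

theorem mem_relIdeal_tail (hsymm : ∀ i j, m i j = m j i) {f : PreE K m}
    (hf : f ∈ relIdeal K m) : (∀ i, coeffHom i i (.nil i) f = 0) ∧ ∀ i, ∃ t, ∀ a : Arrow m,
      a.1 = i → tail a f - a.sgn • (ofArrow K (a.star hsymm) * t) ∈ relIdeal K m := by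
  let N : TwoSidedIdeal (PreE K m) := TwoSidedIdeal.mk' {f | f ∈ relIdeal K m ∧
      (∀ i, coeffHom i i (.nil i) f = 0) ∧ ∀ i, ∃ t, ∀ a : Arrow m,
        a.1 = i → tail a f - a.sgn • (ofArrow K (a.star hsymm) * t) ∈ relIdeal K m}
    (by
      refine ⟨TwoSidedIdeal.zero_mem _, fun i => map_zero _, fun i => ⟨0, fun a _ => ?_⟩⟩
      have : tail a (0 : PreE K m) = 0 :=
        ext_tail (fun _ _ => by simp) fun _ _ _ _ => by simp
      rw [this, mul_zero, smul_zero, sub_zero]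
      exact TwoSidedIdeal.zero_mem _)
    (by
      rintro x y ⟨hx, hx0, hxt⟩ ⟨hy, hy0, hyt⟩
      refine ⟨TwoSidedIdeal.add_mem _ hx hy, fun i => by rw [map_add, hx0, hy0, add_zero],
        fun i => ?_⟩
      obtain ⟨t, ht⟩ := hxt i
      obtain ⟨u, hu⟩ := hyt i
      refine ⟨t + u, fun a ha => ?_⟩
      rw [tail_add, mul_add, smul_add, add_sub_add_comm]
      exact TwoSidedIdeal.add_mem _ (ht a ha) (hu a ha))
    (by
      rintro x ⟨hx, hx0, hxt⟩
      refine ⟨TwoSidedIdeal.neg_mem _ hx, fun i => by rw [map_neg, hx0, neg_zero], fun i => ?_⟩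
      obtain ⟨t, ht⟩ := hxt i
      refine ⟨-t, fun a ha => ?_⟩
      rw [tail_neg, mul_neg, smul_neg, ← neg_sub']
      exact TwoSidedIdeal.neg_mem _ (ht a ha))
    (by
      rintro g x ⟨hx, hx0, hxt⟩
      refine ⟨TwoSidedIdeal.mul_mem_left _ _ _ hx,
        fun i => by rw [coeffHom_mul_nil, hx0, mul_zero], fun i => ?_⟩
      obtain ⟨t, ht⟩ := hxt i
      refine ⟨scal m (coeffHom i i (.nil i) g) * t, fun a ha => ?_⟩
      subst ha
      rw [tail_mul, ← mul_assoc, ← scal_mul_comm, mul_assoc, ← mul_smul_comm, add_sub_assoc,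
        ← mul_sub]
      exact TwoSidedIdeal.add_mem _ (TwoSidedIdeal.mul_mem_left _ _ _ hx)
        (TwoSidedIdeal.mul_mem_left _ _ _ (ht a rfl)))
    (by
      rintro x g ⟨hx, hx0, hxt⟩
      refine ⟨TwoSidedIdeal.mul_mem_right _ _ _ hx,
        fun i => by rw [coeffHom_mul_nil, hx0, zero_mul], fun i => ?_⟩
      obtain ⟨t, ht⟩ := hxt i
      refine ⟨t * g, fun a ha => ?_⟩
      have h0 : scal m (coeffHom a.1 a.1 (.nil a.1) x) * tail a g = 0 :=
        ext_coeffHom fun i k p => by rw [coeffHom_scal_mul, hx0, zero_mul, map_zero]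
      rw [tail_mul, h0, add_zero, ← mul_assoc, ← smul_mul_assoc, ← sub_mul]
      exact TwoSidedIdeal.mul_mem_right _ _ _ (ht a ha))
  have hN : ∀ f, f ∈ N ↔ _ := fun f => TwoSidedIdeal.mem_mk' ..
  have hle : relIdeal K m ≤ N := by
    conv_lhs => rw [relIdeal]
    rw [TwoSidedIdeal.span_le, Set.singleton_subset_iff]
    refine (hN _).2 ⟨TwoSidedIdeal.subset_span rfl, fun i => rfl, fun i => ⟨1, fun a _ => ?_⟩⟩
    rw [tail_rho hsymm, mul_one, sub_self]
    exact TwoSidedIdeal.zero_mem _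
  exact ((hN f).1 (hle hf)).2

theorem hom_tail (n : ℕ) (a : Arrow m) (f : PreE K m) :
    hom n (tail a f) = tail a (hom (n + 1) f) := by
  refine (ext_tail (fun k p => ?_) fun i k p hi => ?_).symm
  · simp only [coeffHom_hom, coeffHom_tail, Pth.len, Nat.add_right_cancel_iff]
  · rw [coeffHom_hom, coeffHom_tail_of_ne _ _ hi, ite_self]

theorem hom_succ_ofArrow_mul (n : ℕ) (a : Arrow m) (f : PreE K m) :
    hom (n + 1) (ofArrow K a * f) = ofArrow K a * hom n f := by
  refine ext_coeffHom fun i k p => ?_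
  cases p with
  | nil => rw [coeffHom_hom, coeffHom_ofArrow_mul_nil, coeffHom_ofArrow_mul_nil, ite_self]
  | cons b p =>
    simp only [coeffHom_hom, coeffHom_ofArrow_mul_cons, Pth.len, Nat.add_right_cancel_iff]
    split_ifs <;> rfl

theorem hom_zero_ofArrow_mul (a : Arrow m) (f : PreE K m) :
    hom 0 (ofArrow K a * f) = 0 := by
  refine ext_coeffHom fun i k p => ?_
  cases p with
  | nil => rw [coeffHom_hom, coeffHom_ofArrow_mul_nil, ite_self, map_zero]
  | cons b p => rw [coeffHom_hom, if_neg (by simp [Pth.len]), map_zero]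

theorem hom_zsmul (n : ℕ) (c : ℤ) (f : PreE K m) : hom n (c • f) = c • hom n f := by
  refine ext_coeffHom fun i k p => ?_
  simp only [map_zsmul, coeffHom_hom]
  split_ifs <;> simp

theorem hom_sub (n : ℕ) (f g : PreE K m) : hom n (f - g) = hom n f - hom n g := by
  rw [sub_eq_add_neg, hom_add, hom_neg, ← sub_eq_add_neg]

theorem mem_relClosureIdeal_tail (hsymm : ∀ i j, m i j = m j i) {f : PreE K m}
    (hf : f ∈ relClosureIdeal K m) (i : ι) : ∃ t, ∀ a : Arrow m,
      a.1 = i → tail a f - a.sgn • (ofArrow K (a.star hsymm) * t) ∈ relClosureIdeal K m := by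
  rw [mem_relClosureIdeal] at hf
  choose t ht using fun n => (mem_relIdeal_tail hsymm (hf n)).2 i
  refine ⟨⟨fun j k p => (t (p.len + 2)).coeff j k p⟩, fun a ha => ?_⟩
  rw [mem_relClosureIdeal]
  intro n
  have h := hom_mem_relIdeal (ht (n + 1) a ha) n
  rw [hom_sub, hom_zsmul, hom_tail, hom_hom, if_pos rfl] at h
  rw [hom_sub, hom_zsmul, hom_tail]
  convert h using 3
  cases n with
  | zero => rw [hom_zero_ofArrow_mul, hom_zero_ofArrow_mul]
  | succ n =>
    rw [hom_succ_ofArrow_mul, hom_succ_ofArrow_mul]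
    congr 1
    refine ext_coeffHom fun i k p => ?_
    rw [coeffHom_hom, coeffHom_hom]
    split_ifs with hp
    · subst hp; rfl
    · rfl

theorem coeffHom_nil_of_mem_relClosureIdeal (hsymm : ∀ i j, m i j = m j i) {f : PreE K m}
    (hf : f ∈ relClosureIdeal K m) (i : ι) : coeffHom i i (.nil i) f = 0 :=
  (mem_relIdeal_tail hsymm (mem_relClosureIdeal.1 hf 0)).1 i

end PreE

namespace PreE

variable {K : Type} [Field K] {ι : Type} [Fintype ι] [LinearOrder ι] {m : ι → ι → ℕ}

theorem idem_mul_self (i : ι) : idem K m i * idem K m i = idem K m i := by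
  refine ext_coeffHom fun i' k p => ?_
  rw [coeffHom_idem_mul, ite_eq_left_iff]
  intro h
  cases p with
  | nil => exact (if_neg h).symm
  | cons => rfl

theorem idem_mul_idem_of_ne {i j : ι} (h : i ≠ j) : idem K m i * idem K m j = 0 := by
  refine ext_coeffHom fun i' k p => ?_
  rw [coeffHom_idem_mul, map_zero, ite_eq_right_iff]
  rintro rfl
  cases p with
  | nil => exact if_neg h
  | cons => rfl

theorem idem_mul_ofArrow (a : Arrow m) : idem K m a.1 * ofArrow K a = ofArrow K a := by
  rw [← mul_one (ofArrow K a), ← mul_assoc]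
  refine ext_coeffHom fun i k p => ?_
  rw [mul_assoc, coeffHom_idem_mul, ite_eq_left_iff]
  intro h
  cases p with
  | nil => rw [coeffHom_ofArrow_mul_nil]
  | cons b p =>
    rw [coeffHom_ofArrow_mul_cons, if_neg fun hb => h (congrArg Sigma.fst hb)]

theorem ofArrow_mul_idem (a : Arrow m) : ofArrow K a * idem K m a.2.1 = ofArrow K a := by
  conv_rhs => rw [← mul_one (ofArrow K a)]
  refine ext_coeffHom fun i k p => ?_
  cases p with
  | nil => rw [coeffHom_ofArrow_mul_nil, coeffHom_ofArrow_mul_nil]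
  | cons b p =>
    rw [coeffHom_ofArrow_mul_cons, coeffHom_ofArrow_mul_cons]
    split_ifs with h
    · subst h
      cases p with
      | nil => exact if_pos rfl
      | cons => rfl
    · rfl

theorem Arrow.sgn_mul_self (a : Arrow m) : a.sgn * a.sgn = 1 := by
  unfold Arrow.sgn
  split_ifs <;> rfl

/-- The projection from the complete path algebra to the preprojective algebra. -/
def toPPA (K : Type) [Field K] (m : ι → ι → ℕ) : PreE K m →+* PPA K m := (ppCon K m).mk'

theorem toPPA_surjective : Function.Surjective (toPPA K m) := (ppCon K m).mk'_surjective

theorem toPPA_eq_zero_iff {f : PreE K m} : toPPA K m f = 0 ↔ f ∈ relClosureIdeal K m := by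
  rw [← map_zero (toPPA K m), ← sub_zero f, ← ppCon_iff, sub_zero]
  exact (ppCon K m).eq

theorem sum_ofArrow_mul_star_mem (hsymm : ∀ i j, m i j = m j i) (i : ι) :
    ∑ a : Arrow m with a.1 = i, ofArrow K a * (a.sgn • ofArrow K (a.star hsymm)) ∈
      relClosureIdeal K m := by
  have h := idem_mul_eq i (rho K m)
  have h0 : scal m (coeffHom i i (.nil i) (rho K m)) * idem K m i = 0 :=
    ext_coeffHom fun _ _ _ => by rw [coeffHom_scal_mul, map_zero]; exact zero_mul _
  simp only [h0, zero_add, tail_rho hsymm] at h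
  rw [← h]
  exact TwoSidedIdeal.mul_mem_left _ _ _
    (relIdeal_le_relClosureIdeal (TwoSidedIdeal.subset_span rfl))

/-- The complete preprojective algebra satisfies the axioms of `PreprojectiveData`. -/
def preprojectiveData (K : Type) [Field K] (m : ι → ι → ℕ) (hsymm : ∀ i j, m i j = m j i)
    (hloop : ∀ i, m i i = 0) : PreprojectiveData (PPA K m) ι (Arrow m) where
  e := eIdem K m
  src a := a.1
  tgt a := a.2.1
  star := Arrow.star hsymm
  sgn := Arrow.sgn
  arr a := toPPA K m (ofArrow K a)
  e_mul_self i := by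
    change toPPA K m (idem K m i) * toPPA K m (idem K m i) = toPPA K m (idem K m i)
    rw [← map_mul, idem_mul_self]
  e_mul_of_ne i j h := by
    change toPPA K m (idem K m i) * toPPA K m (idem K m j) = 0
    rw [← map_mul, idem_mul_idem_of_ne h, map_zero]
  star_star a := rfl
  src_star a := rfl
  src_ne_tgt := by
    rintro ⟨i, j, a⟩ (rfl : i = j)
    exact (Fin.cast (hloop i) a).elim0
  sgn_mul_self := Arrow.sgn_mul_self
  e_mul_arr a := by
    change toPPA K m (idem K m a.1) * _ = _
    rw [← map_mul, idem_mul_ofArrow]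
  arr_mul_e a := by
    change _ * toPPA K m (idem K m a.2.1) = _
    rw [← map_mul, ofArrow_mul_idem]
  exists_central_add i x := by
    obtain ⟨f, rfl⟩ := toPPA_surjective x
    refine ⟨toPPA K m (scal m (coeffHom i i (.nil i) f)), fun a => toPPA K m (tail a f), ?_, ?_⟩
    · intro y
      obtain ⟨g, rfl⟩ := toPPA_surjective y
      rw [← map_mul, ← map_mul, scal_mul_comm]
    · change toPPA K m (idem K m i) * _ = _ * toPPA K m (idem K m i) + _
      simp only [← map_mul, ← map_sum, ← map_add]
      rw [idem_mul_eq]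
  mesh i := by
    simp only [← map_zsmul, ← map_mul, ← map_sum]
    exact toPPA_eq_zero_iff.2 (sum_ofArrow_mul_star_mem hsymm i)
  exact i z hz h := by
    choose X hX using fun a => toPPA_surjective (z a)
    have hmem : ∑ a : Arrow m with a.1 = i, ofArrow K a * X a ∈ relClosureIdeal K m := by
      rw [← toPPA_eq_zero_iff, map_sum]
      simpa only [map_mul, hX] using h
    obtain ⟨t, ht⟩ := mem_relClosureIdeal_tail hsymm hmem i
    refine ⟨toPPA K m (idem K m i * t), ?_, fun a ha => ?_⟩
    · change toPPA K m (idem K m i) * _ = _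
      rw [← map_mul, ← mul_assoc, idem_mul_self]
    · have h1 := toPPA_eq_zero_iff.2 (ht a ha)
      rw [tail_sum_ofArrow_mul X ha, map_sub, sub_eq_zero, map_mul, hX, map_zsmul] at h1
      have h2 : ofArrow K (a.star hsymm) * (idem K m i * t) = ofArrow K (a.star hsymm) * t := by
        subst ha
        rw [← mul_assoc]
        exact congrArg (· * t) (ofArrow_mul_idem (a.star hsymm))
      rw [← map_mul, h2, ← h1]
      exact (hz a).symm
  e_ne_sum i z h := by
    choose X hX using fun a => toPPA_surjective (z a)
    have hmem : idem K m i - ∑ a : Arrow m with a.1 = i, ofArrow K a * X a ∈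
        relClosureIdeal K m := by
      rw [← toPPA_eq_zero_iff, map_sub, map_sum, sub_eq_zero]
      simp only [map_mul, hX]
      exact h
    have h0 := coeffHom_nil_of_mem_relClosureIdeal hsymm hmem i
    simp only [map_sub, map_sum, coeffHom_ofArrow_mul_nil, Finset.sum_const_zero, sub_zero] at h0
    exact one_ne_zero ((if_pos rfl).symm.trans h0)

end PreE

/-- **[BIRS, Theorem III.1.9]** Let `Δ` be a (connected) non-Dynkin graph (equivalently, its
Coxeter group `W` is infinite), `Λ` the complete preprojective algebra of `Δ` over an
algebraically closed field `K`, and `I_i = Λ(1 - e_i)Λ`.  Then for every `w ∈ W` the ideal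
`I_w := I_{i_1} ⋯ I_{i_l}` is independent of the choice of reduced expression
`w = s_{i_1} ⋯ s_{i_l}`, and `w ↦ I_w` is a bijection from `W` onto the set
`⟨I_1, …, I_n⟩` of products of the ideals `I_i`. -/
theorem Iw_well_defined_and_bijective
    (K : Type) [Field K] [IsAlgClosed K]
    {ι : Type} [Fintype ι] [LinearOrder ι] [Nonempty ι]
    (m : ι → ι → ℕ) (hsymm : ∀ i j, m i j = m j i) (hloop : ∀ i, m i i = 0)
    (hconn : (SimpleGraph.fromRel (fun i j => m i j ≠ 0)).Connected)
    (Mc : CoxeterMatrix ι)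
    (hMc : ∀ i j, i ≠ j → Mc i j = if m i j = 0 then 2 else if m i j = 1 then 3 else 0)
    (hNonDynkin : Infinite Mc.Group) :
    ∃ F : Mc.Group → TwoSidedIdeal (PPA K m),
      (∀ (w : Mc.Group) (l : List ι), Mc.toCoxeterSystem.wordProd l = w →
        l.length = Mc.toCoxeterSystem.length w → F w = prodI K m l) ∧
      Set.BijOn F Set.univ
        {J : TwoSidedIdeal (PPA K m) | ∃ l : List ι, J = prodI K m l} := by
  let D := PreE.preprojectiveData K m hsymm hloop
  let cs := Mc.toCoxeterSystem
  have hM : ∀ i j, i ≠ j → Mc i j = 2 ∨ Mc i j = 3 ∨ Mc i j = 0 := by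
    intro i j hij
    rw [hMc i j hij]
    split_ifs <;> simp
  have h2 : ∀ i j, Mc i j = 2 → ∀ J, D.step i (D.step j J) = D.step j (D.step i J) := by
    intro i j h J
    have hij : i ≠ j := by rintro rfl; simp at h
    have hm : m i j = 0 := by
      rw [hMc i j hij] at h
      split_ifs at h <;> simp_all
    refine D.step_comm ?_ J
    rintro ⟨i', j', a⟩ (rfl : i' = i) (rfl : j' = j)
    exact (Fin.cast hm a).elim0
  have h3 : ∀ i j, Mc i j = 3 → ∀ J,
      D.step i (D.step j (D.step i J)) = D.step j (D.step i (D.step j J)) := by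
    intro i j h J
    have hij : i ≠ j := by rintro rfl; simp at h
    have hm : m i j = 1 := by
      rw [hMc i j hij] at h
      split_ifs at h <;> simp_all
    refine (D.step_braid (⟨i, j, Fin.cast hm.symm 0⟩ : PreE.Arrow m) ?_ J).symm
    rintro ⟨i', j', b⟩ (rfl : i' = i) (rfl : j' = j)
    have : Subsingleton (Fin (m i' j')) := by rw [hm]; infer_instance
    rw [Subsingleton.elim b]
  choose red hred using cs.exists_isReduced
  let F : Mc.Group → TwoSidedIdeal (PPA K m) := fun w => prodI K m (red w)
  have hF : ∀ (w : Mc.Group) (l : List ι), cs.wordProd l = w → l.length = cs.length w →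
      F w = prodI K m l := by
    rintro w l rfl hl
    exact cs.foldr_eq_foldr_of_isReduced hM D.step h2 h3 ⊤ _ _ (hred _).1 hl.symm (hred _).2.symm
  have hfam : D.IsIdealFamily cs F :=
    { map_one := hF 1 [] rfl (by simp)
      map_simple_mul := fun i w hw => by
        refine hF _ (i :: red w) ?_ ?_
        · rw [cs.wordProd_cons, ← (hred w).2]
        · rw [cs.not_isLeftDescent_iff.1 hw, List.length_cons, ← (hred w).1.eq, ← (hred w).2]
      eq_two := fun i j hij h => by
        rw [hMc i j hij, if_pos]
        by_contra hm
        exact h ⟨i, j, ⟨0, Nat.pos_of_ne_zero hm⟩⟩ rfl rfl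
      eq_three := by
        rintro ⟨i, j, a⟩ h
        have hij : i ≠ j := D.src_ne_tgt ⟨i, j, a⟩
        have hm : m i j = 1 := by
          have : Subsingleton (Fin (m i j)) := ⟨fun b c => by
            have hb := h ⟨i, j, b⟩ rfl rfl
            have hc := h ⟨i, j, c⟩ rfl rfl
            simpa using hb.trans hc.symm⟩
          have := Fin.subsingleton_iff_le_one.1 this
          have := a.pos
          omega
        exact (hMc i j hij).trans (by simp [hm]) }
  refine ⟨F, hF, fun w _ => ⟨red w, rfl⟩, hfam.injective.injOn, ?_⟩
  rintro _ ⟨l, rfl⟩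
  rw [Set.image_univ]
  induction l with
  | nil => exact ⟨1, hfam.map_one⟩
  | cons i l ih =>
    obtain ⟨w, hw⟩ := ih
    have hcons : prodI K m (i :: l) = D.step i (F w) := by rw [hw]; rfl
    by_cases hd : cs.IsLeftDescent w i
    · exact ⟨w, by rw [hcons, hfam.step_eq_self hd]⟩
    · exact ⟨cs.simple i * w, by rw [hcons, hfam.map_simple_mul i w hd]⟩
end
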